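/- Let d ≥ 1, ν ∈ (0,1), α ∈ (0,2), λ ≥ 0, p₀ ∈ (1,∞), and let μ, ā₀, c̄₀, ā_{ij} be as in the context. Set δ₀ = min{2-α, 1}. Then there exists N > 0, depending only on d, ν, α, p₀, such that for every function u that is smooth, with all derivatives bounded, on a neighborhood of the closure of Q₁⁺ = (-1,0) × (B₁ ∩ ℝ^d_+), vanishes on {x_d = 0}, and satisfies ā₀(x_d)u_t + λ c̄₀(x_d)u - μ(x_d)ā_{ij}(x_d)D_iD_ju = 0 almost everywhere in Q₁⁺, one has ‖u‖_{C^{1,1}(Q_{1/2}⁺)} + ‖D_{x'}u‖_{C^{1,1}(Q_{1/2}⁺)} + ‖D_d u‖_{C^{1,δ₀}(Q_{1/2}⁺)} + λ^{1/2} ‖χ^{-α/2} u‖_{C^{1,1-α/2}(Q_{1/2}⁺)} ≤ N ‖Du‖_{L_{p₀}(Q₁⁺)}, where Q_ρ⁺ = (-ρ^{2-α},0) × (B_ρ ∩ ℝ^d_+) and for vector-valued functions the C^{1,β} norm is the sum over components. -/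

import Mathlib

open MeasureTheory ENNReal Set

noncomputable section

abbrev Ed (d : ℕ) : Type := EuclideanSpace ℝ (Fin d)

/-- The last coordinate `x_d` of a point `x ∈ ℝ^d` (junk value `0` if `d = 0`). -/
def xd {d : ℕ} (x : Ed d) : ℝ :=
  if h : 0 < d then x ⟨d - 1, Nat.sub_lt h one_pos⟩ else 0

/-- `Ω_T = (-∞, T) × ℝ^d_+`. -/
def OmegaT (d : ℕ) (T : EReal) : Set (ℝ × Ed d) :=
  {z | (z.1 : EReal) < T ∧ 0 < xd z.2}

/-- Time derivative `u_t`. -/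
def ut {d : ℕ} (u : ℝ × Ed d → ℝ) (z : ℝ × Ed d) : ℝ :=
  deriv (fun s => u (s, z.2)) z.1

/-- Spatial gradient `Du`. -/
def Du {d : ℕ} (u : ℝ × Ed d → ℝ) (z : ℝ × Ed d) : Ed d →L[ℝ] ℝ :=
  fderiv ℝ (fun y => u (z.1, y)) z.2

/-- Spatial Hessian `D²u`. -/
def D2u {d : ℕ} (u : ℝ × Ed d → ℝ) (z : ℝ × Ed d) : Ed d →L[ℝ] Ed d →L[ℝ] ℝ :=
  fderiv ℝ (fun y => Du u (z.1, y)) z.2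

/-- Spatial Laplacian `Δu`. -/
def lap {d : ℕ} (u : ℝ × Ed d → ℝ) (z : ℝ × Ed d) : ℝ :=
  ∑ i : Fin d, D2u u z (EuclideanSpace.single i 1) (EuclideanSpace.single i 1)

/-- Weighted Lebesgue norm `‖g‖_{L_p(Ω_T, x_d^γ dz)}`. -/
def wLp (d : ℕ) (T : EReal) (p γ : ℝ) (g : ℝ × Ed d → ℝ) : ℝ≥0∞ :=
  (∫⁻ z in OmegaT d T, ENNReal.ofReal (|g z| ^ p * xd z.2 ^ γ)) ^ (1 / p)

/-- Conditions (1.3)–(1.4) on the (measurable) coefficients `μ, ā₀, c̄₀, ā_{ij}`,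
depending only on the `x_d` variable. -/
def CoeffOK (d : ℕ) (ν α : ℝ) (μc a0 c0 : ℝ → ℝ) (aij : Fin d → Fin d → ℝ → ℝ) : Prop :=
  Measurable μc ∧ Measurable a0 ∧ Measurable c0 ∧ (∀ i j, Measurable (aij i j)) ∧
  (∀ s : ℝ, 0 < s →
      a0 s ∈ Set.Icc ν ν⁻¹ ∧ c0 s ∈ Set.Icc ν ν⁻¹ ∧ μc s / s ^ α ∈ Set.Icc ν ν⁻¹) ∧
  (∀ s : ℝ, 0 < s → ∀ ξ : Fin d → ℝ,
      ν * ∑ i, ξ i ^ 2 ≤ ∑ i, ∑ j, aij i j s * ξ i * ξ j) ∧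
  (∀ s : ℝ, 0 < s → ∀ i j, |aij i j s| ≤ ν⁻¹)

/-- `f = μ(x_d)⁻¹ (ā₀ u_t + λ c̄₀ u) - ā_{ij} D_i D_j u`, i.e. `𝓛₀ u = μ(x_d) f`. -/
def fL0 {d : ℕ} (μc a0 c0 : ℝ → ℝ) (aij : Fin d → Fin d → ℝ → ℝ) (lam : ℝ)
    (u : ℝ × Ed d → ℝ) (z : ℝ × Ed d) : ℝ :=
  (μc (xd z.2))⁻¹ * (a0 (xd z.2) * ut u z + lam * c0 (xd z.2) * u z) -
    ∑ i, ∑ j, aij i j (xd z.2) *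
      D2u u z (EuclideanSpace.single i 1) (EuclideanSpace.single j 1)

/-- Origin-centered cylinder `Q_ρ⁺ = (-ρ^{2-α}, 0) × (B_ρ ∩ ℝ^d_+)`. -/
def Qo (d : ℕ) (α ρ : ℝ) : Set (ℝ × Ed d) :=
  {z | -(ρ ^ (2 - α)) < z.1 ∧ z.1 < 0 ∧ ‖z.2‖ < ρ ∧ 0 < xd z.2}

/-- First-order spatial derivative `D_i`. -/
def pd {d : ℕ} (i : Fin d) (u : ℝ × Ed d → ℝ) : ℝ × Ed d → ℝ :=
  fun z => Du u z (EuclideanSpace.single i 1)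

/-- Time derivative `∂_t` as an operator. -/
def td {d : ℕ} (u : ℝ × Ed d → ℝ) : ℝ × Ed d → ℝ := fun z => ut u z

/-- Sup-norm `‖f‖_{L_∞(Q)}` (with value in `ℝ≥0∞`). -/
def supN {d : ℕ} (Q : Set (ℝ × Ed d)) (f : ℝ × Ed d → ℝ) : ℝ≥0∞ :=
  ⨆ (z : ℝ × Ed d) (_ : z ∈ Q), ENNReal.ofReal |f z|

/-- The spatial Hölder seminorm `⟦f⟧_{C^{0,β}(Q)}`. -/
def hSemi {d : ℕ} (β : ℝ) (Q : Set (ℝ × Ed d)) (f : ℝ × Ed d → ℝ) : ℝ≥0∞ :=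
  ⨆ (t : ℝ) (x : Ed d) (y : Ed d) (_ : (t, x) ∈ Q) (_ : (t, y) ∈ Q) (_ : x ≠ y),
    ENNReal.ofReal (|f (t, x) - f (t, y)| / ‖x - y‖ ^ β)

/-- The Hölder norm
`‖f‖_{C^{1,β}(Q)} = ‖f‖_{L_∞} + ‖f_t‖_{L_∞} + ⟦f⟧_{C^{0,β}} + ⟦f_t⟧_{C^{0,β}}`. -/
def c1Norm {d : ℕ} (β : ℝ) (Q : Set (ℝ × Ed d)) (f : ℝ × Ed d → ℝ) : ℝ≥0∞ :=
  supN Q f + supN Q (td f) + hSemi β Q f + hSemi β Q (td f)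

section

open Filter Topology ContDiff

/-- The symmetric second difference quotient of `f` at `0` converges to `b`. -/
def HasSymmDeriv2 (f : ℝ → ℝ) (b : ℝ) : Prop :=
  Tendsto (fun s => (f s + f (-s) - 2 * f 0) / s ^ 2) (𝓝[>] 0) (𝓝 b)

namespace HasSymmDeriv2

lemma add {f g : ℝ → ℝ} {a b : ℝ} (hf : HasSymmDeriv2 f a) (hg : HasSymmDeriv2 g b) :
    HasSymmDeriv2 (fun s => f s + g s) (a + b) := by
  refine (Tendsto.add hf hg).congr fun s => ?_
  ring

lemma sub {f g : ℝ → ℝ} {a b : ℝ} (hf : HasSymmDeriv2 f a) (hg : HasSymmDeriv2 g b) :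
    HasSymmDeriv2 (fun s => f s - g s) (a - b) := by
  refine (Tendsto.sub hf hg).congr fun s => ?_
  ring

lemma const_mul {f : ℝ → ℝ} {a : ℝ} (c : ℝ) (hf : HasSymmDeriv2 f a) :
    HasSymmDeriv2 (fun s => c * f s) (c * a) := by
  refine (Tendsto.const_mul c hf).congr fun s => ?_
  ring

lemma const (c : ℝ) : HasSymmDeriv2 (fun _ => c) 0 := by
  refine tendsto_const_nhds.congr fun s => ?_
  ring

lemma affine (a c : ℝ) : HasSymmDeriv2 (fun s => a + s * c) 0 := by
  refine tendsto_const_nhds.congr fun s => ?_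
  ring

lemma nonpos {f : ℝ → ℝ} {b : ℝ} (hf : HasSymmDeriv2 f b)
    (hmax : ∀ᶠ s in 𝓝[>] (0 : ℝ), f s ≤ f 0 ∧ f (-s) ≤ f 0) : b ≤ 0 := by
  refine le_of_tendsto hf ?_
  filter_upwards [hmax] with s hs
  exact div_nonpos_of_nonpos_of_nonneg (by linarith [hs.1, hs.2]) (sq_nonneg s)

lemma of_hasDerivAt {f f' : ℝ → ℝ} {b : ℝ} (hf : ∀ᶠ s in 𝓝 (0 : ℝ), HasDerivAt f (f' s) s)
    (hf' : HasDerivAt f' b 0) : HasSymmDeriv2 f b := by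
  have hneg : Tendsto (fun s : ℝ => -s) (𝓝 0) (𝓝 0) := by
    simpa using (continuous_neg (G := ℝ)).tendsto 0
  have hf2 : ∀ᶠ s in 𝓝 (0 : ℝ), HasDerivAt (fun s => f s + f (-s) - 2 * f 0)
      (f' s - f' (-s)) s := by
    filter_upwards [hf, hneg.eventually hf] with s h1 h2
    have h3 : HasDerivAt (fun s => f (-s)) (f' (-s) * (-1)) s := h2.comp s (hasDerivAt_neg s)
    exact ((h1.add h3).sub_const (2 * f 0)).congr_deriv (by ring)
  have hc0 : ContinuousAt f 0 := hf.self_of_nhds.continuousAt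
  have hcn : Tendsto (fun s => f (-s)) (𝓝 0) (𝓝 (f 0)) := hc0.tendsto.comp hneg
  refine HasDerivAt.lhopital_zero_nhdsGT (g' := fun s => 2 * s) (hf2.filter_mono nhdsWithin_le_nhds)
    ?_ ?_ ?_ ?_ ?_
  · refine Eventually.of_forall fun s => ?_
    simpa using hasDerivAt_pow 2 s
  · filter_upwards [self_mem_nhdsWithin] with s hs
    have : (0 : ℝ) < s := hs
    positivity
  · have := ((hc0.tendsto.add hcn).sub_const (2 * f 0)).mono_left
      (nhdsWithin_le_nhds (s := Ioi (0 : ℝ)))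
    convert this using 2
    ring
  · have : Tendsto (fun s : ℝ => s ^ 2) (𝓝 0) (𝓝 (0 ^ 2)) := (continuous_pow 2).tendsto 0
    simpa using this.mono_left (nhdsWithin_le_nhds (s := Ioi (0 : ℝ)))
  · have h3 : HasDerivAt (fun s => f' (-s)) (b * (-1)) 0 := by
      refine HasDerivAt.comp (0 : ℝ) (h₂ := f') ?_ (hasDerivAt_neg 0)
      simpa using hf'
    have h4 := (hf'.sub h3).tendsto_slope_zero_right
    have h5 := h4.const_mul (1 / 2 : ℝ)
    refine (h5.congr' ?_).trans (le_of_eq ?_)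
    · filter_upwards [self_mem_nhdsWithin] with s hs
      have : s ≠ 0 := ne_of_gt hs
      simp
      field_simp
    · congr 1
      ring

lemma normSq {E : Type*} [NormedAddCommGroup E] [InnerProductSpace ℝ E] (x v : E) :
    HasSymmDeriv2 (fun s => ‖x + s • v‖ ^ 2) (2 * ‖v‖ ^ 2) := by
  refine tendsto_const_nhds.congr' ?_
  filter_upwards [self_mem_nhdsWithin] with s hs
  have hs0 : s ≠ 0 := ne_of_gt hs
  have h := parallelogram_law_with_norm ℝ x (s • v)
  have e : ‖s • v‖ ^ 2 = s ^ 2 * ‖v‖ ^ 2 := by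
    rw [norm_smul, mul_pow, Real.norm_eq_abs, sq_abs]
  rw [eq_div_iff (pow_ne_zero 2 hs0), neg_smul, ← sub_eq_add_neg]
  simp only [zero_smul, add_zero]
  nlinarith

end HasSymmDeriv2

lemma nonneg_of_hasDerivAt_of_max_left {f : ℝ → ℝ} {p t : ℝ} (hf : HasDerivAt f p t)
    (h : ∀ᶠ s in 𝓝[<] t, f s ≤ f t) : 0 ≤ p := by
  have h1 := hf.hasDerivWithinAt (s := Iio t)
  rw [hasDerivWithinAt_iff_tendsto_slope' (by simp)] at h1
  refine ge_of_tendsto h1 ?_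
  filter_upwards [h, self_mem_nhdsWithin] with s hs hst
  rw [slope_def_field]
  have : s < t := hst
  exact div_nonneg_of_nonpos (by linarith) (by linarith)

section MaxPrinciple

variable {E : Type*} [NormedAddCommGroup E] [NormedSpace ℝ E]

lemma eventually_line_mem {V : Set E} (hV : IsOpen V) {y : E} (hy : y ∈ V) (v : E) :
    ∀ᶠ s in 𝓝 (0 : ℝ), y + s • v ∈ V := by
  have hc : Continuous fun s : ℝ => y + s • v := by fun_prop
  exact hc.continuousAt.eventually (hV.mem_nhds (by simpa using hy))

lemma symmDeriv2_le_of_isMaxOn {Y V : Set E} (hV : IsOpen V) (hVY : V ⊆ Y) {w ψ : E → ℝ} {y : E}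
    (hy : y ∈ V) (hmax : IsMaxOn (fun x => w x - ψ x) Y y) {v : E} {σ σ' : ℝ}
    (hw : HasSymmDeriv2 (fun s => w (y + s • v)) σ)
    (hψ : HasSymmDeriv2 (fun s => ψ (y + s • v)) σ') : σ ≤ σ' := by
  have h := (hw.sub hψ).nonpos ?_
  · linarith
  have h1 := eventually_line_mem hV hy v
  have h2 := eventually_line_mem hV hy (-v)
  filter_upwards [h1.filter_mono nhdsWithin_le_nhds, h2.filter_mono nhdsWithin_le_nhds]
    with s hs hs'
  rw [smul_neg, ← neg_smul] at hs'
  have e0 : y + (0 : ℝ) • v = y := by simp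
  rw [e0]
  exact ⟨hmax (hVY hs), hmax (hVY hs')⟩

/-- Elliptic maximum principle, with the differential inequality in the form of an abstract
exclusion of interior positive maxima. -/
lemma elliptic_comparison {Y V : Set E} (hY : IsCompact Y) (hV : IsOpen V) (hVY : V ⊆ Y)
    {w ψ : E → ℝ} (hw : ContinuousOn w Y) (hψ : ContinuousOn ψ Y)
    (hb : ∀ y ∈ Y, y ∉ V → w y ≤ ψ y)
    (hno : ∀ y ∈ V, ψ y < w y →
      (∀ v σ σ', HasSymmDeriv2 (fun s => w (y + s • v)) σ →
        HasSymmDeriv2 (fun s => ψ (y + s • v)) σ' → σ ≤ σ') → False) :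
    ∀ y ∈ Y, w y ≤ ψ y := by
  intro y hy
  obtain ⟨q, hq, hmax⟩ := hY.exists_isMaxOn ⟨y, hy⟩ (hw.sub hψ)
  have hyq : w y - ψ y ≤ w q - ψ q := hmax hy
  by_cases hle : w q ≤ ψ q
  · linarith
  · have hqV : q ∈ V := by
      by_contra h
      exact hle (hb q hq h)
    exact (hno q hqV (not_le.1 hle) fun v σ σ' h1 h2 =>
      symmDeriv2_le_of_isMaxOn hV hVY hqV hmax h1 h2).elim

/-- Parabolic maximum principle, with the differential inequality in the form of an abstract
exclusion of interior positive maxima. -/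
lemma parabolic_comparison {t₁ t₀ : ℝ} {Y V : Set E} (hY : IsCompact Y) (hV : IsOpen V)
    (hVY : V ⊆ Y) {w ψ : ℝ → E → ℝ}
    (hw : ContinuousOn (fun z : ℝ × E => w z.1 z.2) (Icc t₁ t₀ ×ˢ Y))
    (hψ : ContinuousOn (fun z : ℝ × E => ψ z.1 z.2) (Icc t₁ t₀ ×ˢ Y))
    (h0 : ∀ y ∈ Y, w t₁ y ≤ ψ t₁ y)
    (hb : ∀ t ∈ Icc t₁ t₀, ∀ y ∈ Y, y ∉ V → w t y ≤ ψ t y)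
    (hno : ∀ t ∈ Ioc t₁ t₀, ∀ y ∈ V, ψ t y < w t y →
      (∀ p q, HasDerivAt (fun s => w s y) p t → HasDerivAt (fun s => ψ s y) q t → q ≤ p) →
      (∀ v σ σ', HasSymmDeriv2 (fun s => w t (y + s • v)) σ →
        HasSymmDeriv2 (fun s => ψ t (y + s • v)) σ' → σ ≤ σ') → False) :
    ∀ t ∈ Icc t₁ t₀, ∀ y ∈ Y, w t y ≤ ψ t y := by
  intro t ht y hy
  obtain ⟨⟨t', q⟩, ⟨ht', hq⟩, hmax⟩ :=
    (isCompact_Icc.prod hY).exists_isMaxOn ⟨(t, y), ht, hy⟩ (hw.sub hψ)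
  have hyq : w t y - ψ t y ≤ w t' q - ψ t' q := hmax (show (t, y) ∈ _ from ⟨ht, hy⟩)
  by_cases hle : w t' q ≤ ψ t' q
  · linarith
  · have hqV : q ∈ V := by
      by_contra h
      exact hle (hb t' ht' q hq h)
    have ht1 : t₁ ≠ t' := by
      rintro rfl
      exact hle (h0 q hq)
    have ht2 : t₁ < t' := lt_of_le_of_ne ht'.1 ht1
    refine (hno t' ⟨ht2, ht'.2⟩ q hqV (not_le.1 hle) ?_ ?_).elim
    · intro p p' hp hp'
      have := nonneg_of_hasDerivAt_of_max_left (hp.sub hp') ?_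
      · linarith
      filter_upwards [Ioo_mem_nhdsLT ht2] with s hs
      exact hmax (show (s, q) ∈ _ from ⟨⟨hs.1.le, hs.2.le.trans ht'.2⟩, hq⟩)
    · intro v σ σ' h1 h2
      refine symmDeriv2_le_of_isMaxOn hV hVY hqV (w := w t') (ψ := ψ t') ?_ h1 h2
      intro x hx
      exact hmax (show (t', x) ∈ _ from ⟨ht', hx⟩)

end MaxPrinciple

section DirectionalDerivative

variable {d : ℕ}

/-- Space-time directional derivative. -/
def dv (V : ℝ × Ed d) (f : ℝ × Ed d → ℝ) : ℝ × Ed d → ℝ := fun z => fderiv ℝ f z V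

variable {f g : ℝ × Ed d → ℝ} {z : ℝ × Ed d}

lemma ContDiffAt.dir (hf : ContDiffAt ℝ ∞ f z) (V : ℝ × Ed d) : ContDiffAt ℝ ∞ (dv V f) z :=
  (hf.fderiv_right (m := ∞) (by simp)).clm_apply contDiffAt_const

lemma ContDiffAt.differentiableAt_top (hf : ContDiffAt ℝ ∞ f z) : DifferentiableAt ℝ f z :=
  hf.differentiableAt (by simp)

lemma ContDiffAt.eventually_two (hf : ContDiffAt ℝ ∞ f z) : ∀ᶠ y in 𝓝 z, ContDiffAt ℝ 2 f y :=
  (hf.of_le (m := 2) (WithTop.coe_le_coe.2 (le_top : (2 : ℕ∞) ≤ ⊤))).eventually (by simp)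

lemma dv_comm_two (hf : ContDiffAt ℝ 2 f z) (V W : ℝ × Ed d) :
    dv V (dv W f) z = dv W (dv V f) z := by
  have hs := hf.isSymmSndFDerivAt (by simp)
  have hd : DifferentiableAt ℝ (fderiv ℝ f) z :=
    (hf.fderiv_right (m := 1) (by norm_num)).differentiableAt (by simp)
  have e : ∀ V W : ℝ × Ed d, dv V (dv W f) z = fderiv ℝ (fderiv ℝ f) z V W := by
    intro V W
    change fderiv ℝ (fun y => fderiv ℝ f y W) z V = _
    rw [fderiv_clm_apply hd (differentiableAt_const W)]
    simp
  rw [e, e]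
  exact hs V W

lemma dv_congr {V : ℝ × Ed d} (h : f =ᶠ[𝓝 z] g) : dv V f z = dv V g z := by
  simp only [dv]
  rw [h.fderiv_eq]

lemma dv_comm (hf : ContDiffAt ℝ ∞ f z) (V W : ℝ × Ed d) :
    dv V (dv W f) z = dv W (dv V f) z :=
  dv_comm_two hf.eventually_two.self_of_nhds V W

lemma dv_comm_three (hf : ContDiffAt ℝ ∞ f z) (V W : ℝ × Ed d) :
    dv V (dv W (dv W f)) z = dv W (dv W (dv V f)) z := by
  rw [dv_comm (hf.dir W)]
  exact dv_congr (hf.eventually_two.mono fun y hy => dv_comm_two hy V W)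

lemma dv_add (hf : ContDiffAt ℝ ∞ f z) (hg : ContDiffAt ℝ ∞ g z) (V : ℝ × Ed d) :
    dv V (fun y => f y + g y) z = dv V f z + dv V g z := by
  simp only [dv]
  rw [fderiv_fun_add hf.differentiableAt_top hg.differentiableAt_top]
  simp

lemma dv_const_mul (a : ℝ) (hf : ContDiffAt ℝ ∞ f z) (V : ℝ × Ed d) :
    dv V (fun y => a * f y) z = a * dv V f z := by
  simp only [dv]
  rw [fderiv_const_mul hf.differentiableAt_top]
  simp

lemma dv_sum {ι : Type*} (s : Finset ι) {F : ι → ℝ × Ed d → ℝ}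
    (hF : ∀ i ∈ s, ContDiffAt ℝ ∞ (F i) z) (V : ℝ × Ed d) :
    dv V (fun y => ∑ i ∈ s, F i y) z = ∑ i ∈ s, dv V (F i) z := by
  simp only [dv]
  rw [fderiv_fun_sum fun i hi => (hF i hi).differentiableAt_top]
  simp

lemma hasDerivAt_line {s : ℝ} {V : ℝ × Ed d} (hf : DifferentiableAt ℝ f (z + s • V)) :
    HasDerivAt (fun r => f (z + r • V)) (dv V f (z + s • V)) s := by
  have h : HasDerivAt (fun r : ℝ => z + r • V) V s := by
    simpa using ((hasDerivAt_id s).smul_const V).const_add z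
  exact hf.hasFDerivAt.comp_hasDerivAt s h

lemma hasDerivAt_line_zero {V : ℝ × Ed d} (hf : DifferentiableAt ℝ f z) :
    HasDerivAt (fun r : ℝ => f (z + r • V)) (dv V f z) 0 := by
  have := hasDerivAt_line (z := z) (s := 0) (V := V) (f := f) (by simpa using hf)
  simpa using this

lemma eventually_line {p : ℝ × Ed d → Prop} (h : ∀ᶠ y in 𝓝 z, p y) (V : ℝ × Ed d) :
    ∀ᶠ s in 𝓝 (0 : ℝ), p (z + s • V) := by
  have hc : Continuous fun s : ℝ => z + s • V := by fun_prop
  exact hc.continuousAt.eventually (by simpa using h)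

lemma hasSymmDeriv2_line (hf : ContDiffAt ℝ ∞ f z) (V : ℝ × Ed d) :
    HasSymmDeriv2 (fun s => f (z + s • V)) (dv V (dv V f) z) := by
  refine HasSymmDeriv2.of_hasDerivAt (f' := fun s => dv V f (z + s • V)) ?_
    (hasDerivAt_line_zero (hf.dir V).differentiableAt_top)
  filter_upwards [eventually_line hf.eventually_two V] with s hs
  exact hasDerivAt_line (hs.differentiableAt (by simp))

lemma hasSymmDeriv2_space {t : ℝ} {x : Ed d} (hf : ContDiffAt ℝ ∞ f (t, x)) (v : Ed d) :
    HasSymmDeriv2 (fun s => f (t, x + s • v)) (dv (0, v) (dv (0, v) f) (t, x)) := by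
  have := hasSymmDeriv2_line hf (0, v)
  simpa using this

lemma hasDerivAt_time {t : ℝ} {x : Ed d} (hf : DifferentiableAt ℝ f (t, x)) :
    HasDerivAt (fun s => f (s, x)) (dv (1, 0) f (t, x)) t := by
  have h : HasDerivAt (fun r : ℝ => (r, x)) ((1 : ℝ), (0 : Ed d)) t :=
    (hasDerivAt_id t).prodMk (hasDerivAt_const t x)
  exact hf.hasFDerivAt.comp_hasDerivAt t h

lemma ut_eq_dv (hf : DifferentiableAt ℝ f z) : ut f z = dv (1, 0) f z :=
  (hasDerivAt_time (t := z.1) (x := z.2) hf).deriv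

lemma hasFDerivAt_space {t : ℝ} {x : Ed d} (hf : DifferentiableAt ℝ f (t, x)) :
    HasFDerivAt (fun y => f (t, y))
      ((fderiv ℝ f (t, x)).comp (ContinuousLinearMap.inr ℝ ℝ (Ed d))) x := by
  have h : HasFDerivAt (fun y : Ed d => (t, y)) (ContinuousLinearMap.inr ℝ ℝ (Ed d)) x := by
    exact hasFDerivAt_prodMk_right t x
  exact hf.hasFDerivAt.comp x h

lemma Du_eq_comp (hf : DifferentiableAt ℝ f z) :
    Du f z = (fderiv ℝ f z).comp (ContinuousLinearMap.inr ℝ ℝ (Ed d)) :=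
  (hasFDerivAt_space (t := z.1) (x := z.2) hf).fderiv

lemma Du_apply (hf : DifferentiableAt ℝ f z) (v : Ed d) : Du f z v = dv (0, v) f z := by
  rw [Du_eq_comp hf]
  simp [dv]

lemma D2u_apply (hf : ContDiffAt ℝ ∞ f z) (v w : Ed d) :
    D2u f z v w = dv (0, v) (dv (0, w) f) z := by
  have hev : ∀ᶠ y in 𝓝 z.2, Du f (z.1, y)
      = (fderiv ℝ f (z.1, y)).comp (ContinuousLinearMap.inr ℝ ℝ (Ed d)) := by
    have hc : Continuous fun y : Ed d => (z.1, y) := by fun_prop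
    have := (hc.continuousAt (x := z.2)).eventually hf.eventually_two
    filter_upwards [this] with y hy
    exact Du_eq_comp (hy.differentiableAt (by simp))
  have hd : DifferentiableAt ℝ (fderiv ℝ f) z :=
    (hf.fderiv_right (m := ∞) (by simp)).differentiableAt (by simp)
  have h1 : HasFDerivAt (fun y : Ed d => fderiv ℝ f (z.1, y))
      ((fderiv ℝ (fderiv ℝ f) z).comp (ContinuousLinearMap.inr ℝ ℝ (Ed d))) z.2 :=
    HasFDerivAt.comp (g := fderiv ℝ f) z.2 hd.hasFDerivAt
      (hasFDerivAt_prodMk_right z.1 z.2)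
  have h2 := h1.clm_comp (hasFDerivAt_const (ContinuousLinearMap.inr ℝ ℝ (Ed d)) z.2)
  have h3 : D2u f z = _ := (h2.congr_of_eventuallyEq hev).fderiv
  rw [h3]
  change _ = fderiv ℝ (fun y => fderiv ℝ f y (0, w)) z (0, v)
  rw [fderiv_clm_apply hd (differentiableAt_const _)]
  simp

end DirectionalDerivative

section Solutions

variable {d : ℕ}

/-- The open half cylinder `(-1,0) × (B₁ ∩ {x_l > 0})`. -/
def Qop (l : Fin d) : Set (ℝ × Ed d) := {z | -1 < z.1 ∧ z.1 < 0 ∧ ‖z.2‖ < 1 ∧ 0 < z.2 l}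

/-- The closed half cylinder. -/
def Qcl (l : Fin d) : Set (ℝ × Ed d) := {z | -1 ≤ z.1 ∧ z.1 ≤ 0 ∧ ‖z.2‖ ≤ 1 ∧ 0 ≤ z.2 l}

/-- The standard basis vector. -/
abbrev ei (i : Fin d) : Ed d := EuclideanSpace.single i 1

/-- Pure second derivative of `u` in the spatial direction `v`. -/
abbrev d2 (v : Ed d) (u : ℝ × Ed d → ℝ) (z : ℝ × Ed d) : ℝ := dv (0, v) (dv (0, v) u) z

/-- Bounds for the normalized coefficients. -/
structure Coef (κ α : ℝ) (c : ℝ → ℝ) (b : ℝ → Fin d → Ed d) : Prop where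
  c_lower : ∀ s, 0 < s → s < 1 → κ ≤ c s
  c_upper : ∀ s, 0 < s → s < 1 → c s ≤ κ⁻¹
  b_upper : ∀ s, 0 < s → s < 1 → ∑ k, ‖b s k‖ ^ 2 ≤ κ⁻¹ * s ^ α

/-- Smooth solutions of `u_t + λ c u = ∑ₖ D²u(bₖ, bₖ) + κ x_l^α Δu`, with `c, bₖ` functions of `x_l`,
which vanish on the flat part of the boundary. -/
structure Sol (κ α lam : ℝ) (l : Fin d) (c : ℝ → ℝ) (b : ℝ → Fin d → Ed d)
    (u : ℝ × Ed d → ℝ) : Prop where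
  smooth : ∀ z ∈ Qcl l, ContDiffAt ℝ ∞ u z
  zero : ∀ z : ℝ × Ed d, -1 < z.1 → z.1 < 0 → ‖z.2‖ < 1 → z.2 l = 0 → u z = 0
  eq : ∀ z ∈ Qop l, dv (1, 0) u z + lam * c (z.2 l) * u z
    = ∑ k, d2 (b (z.2 l) k) u z + κ * (z.2 l) ^ α * ∑ i, d2 (ei i) u z

lemma Qop_subset_Qcl (l : Fin d) : Qop l ⊆ Qcl l :=
  fun _ h => ⟨h.1.le, h.2.1.le, h.2.2.1.le, h.2.2.2.le⟩

lemma isOpen_Qop (l : Fin d) : IsOpen (Qop l) := by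
  have h1 : Continuous fun z : ℝ × Ed d => z.2 l := by fun_prop
  exact (isOpen_lt continuous_const continuous_fst).inter
    ((isOpen_lt continuous_fst continuous_const).inter
      ((isOpen_lt continuous_snd.norm continuous_const).inter (isOpen_lt continuous_const h1)))

lemma isCompact_Qcl (l : Fin d) : IsCompact (Qcl l) := by
  have h1 : Continuous fun z : ℝ × Ed d => z.2 l := by fun_prop
  have hc : IsClosed (Qcl l) := (isClosed_le continuous_const continuous_fst).inter
    ((isClosed_le continuous_fst continuous_const).inter
      ((isClosed_le continuous_snd.norm continuous_const).inter (isClosed_le continuous_const h1)))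
  refine IsCompact.of_isClosed_subset (isCompact_Icc.prod (isCompact_closedBall (0 : Ed d) 1)) hc
    (s := Icc (-1 : ℝ) 0 ×ˢ Metric.closedBall (0 : Ed d) 1) ?_
  intro z hz
  exact ⟨⟨hz.1, hz.2.1⟩, by simpa using hz.2.2.1⟩

variable {κ α lam : ℝ} {l : Fin d} {c : ℝ → ℝ} {b : ℝ → Fin d → Ed d} {u : ℝ × Ed d → ℝ}

lemma Sol.continuousOn (hu : Sol κ α lam l c b u) : ContinuousOn u (Qcl l) :=
  fun z hz => (hu.smooth z hz).continuousAt.continuousWithinAt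

lemma exists_bound_of_smooth (hu : ∀ z ∈ Qcl l, ContDiffAt ℝ ∞ u z) :
    ∃ M : ℝ, 0 < M ∧ ∀ z ∈ Qcl l, |u z| ≤ M := by
  obtain ⟨M, hM⟩ := (isCompact_Qcl l).exists_bound_of_continuousOn
    (f := u) fun z hz => (hu z hz).continuousAt.continuousWithinAt
  exact ⟨max M 1, lt_max_of_lt_right one_pos, fun z hz => (hM z hz).trans (le_max_left _ _)⟩

lemma Sol.const_mul (hu : Sol κ α lam l c b u) (a : ℝ) :
    Sol κ α lam l c b (fun z => a * u z) where
  smooth z hz := contDiffAt_const.mul (hu.smooth z hz)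
  zero z h1 h2 h3 h4 := by rw [hu.zero z h1 h2 h3 h4, mul_zero]
  eq z hz := by
    have hs := hu.smooth z (Qop_subset_Qcl l hz)
    have h2 : ∀ v : Ed d, d2 v (fun z => a * u z) z = a * d2 v u z := by
      intro v
      have : dv (0, v) (fun y => a * u y) =ᶠ[𝓝 z] fun y => a * dv (0, v) u y := by
        filter_upwards [(isOpen_Qop l).mem_nhds hz] with y hy
        exact dv_const_mul a (hu.smooth y (Qop_subset_Qcl l hy)) _
      rw [d2, dv_congr this, dv_const_mul a (hs.dir _)]
    rw [dv_const_mul a hs]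
    simp only [h2]
    rw [← Finset.mul_sum, ← Finset.mul_sum]
    linear_combination a * hu.eq z hz

lemma Sol.neg (hu : Sol κ α lam l c b u) : Sol κ α lam l c b (fun z => -u z) := by
  simpa using hu.const_mul (-1)

lemma Sol.tangential (hu : Sol κ α lam l c b u) {V : ℝ × Ed d} (hV : V.2 l = 0) :
    Sol κ α lam l c b (dv V u) where
  smooth z hz := (hu.smooth z hz).dir V
  zero z h1 h2 h3 h4 := by
    have hz : z ∈ Qcl l := ⟨h1.le, h2.le, h3.le, h4.ge⟩
    have hd := hasDerivAt_line_zero (V := V) (hu.smooth z hz).differentiableAt_top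
    have hev : ∀ᶠ y : ℝ × Ed d in 𝓝 z, -1 < y.1 ∧ y.1 < 0 ∧ ‖y.2‖ < 1 :=
      (continuous_fst.continuousAt.eventually (lt_mem_nhds h1)).and
        ((continuous_fst.continuousAt.eventually (gt_mem_nhds h2)).and
          (continuous_snd.norm.continuousAt.eventually (gt_mem_nhds h3)))
    have h0 : (fun s : ℝ => u (z + s • V)) =ᶠ[𝓝 0] fun _ => 0 := by
      filter_upwards [eventually_line hev V] with s hs
      exact hu.zero _ hs.1 hs.2.1 hs.2.2 (by simp [h4, hV])
    exact hd.unique ((hasDerivAt_const (0 : ℝ) (0 : ℝ)).congr_of_eventuallyEq h0)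
  eq z hz := by
    have hs := hu.smooth z (Qop_subset_Qcl l hz)
    set C := lam * c (z.2 l)
    set A := κ * (z.2 l) ^ α
    set B := b (z.2 l)
    let F : ℝ × Ed d → ℝ := fun y => dv (1, 0) u y + C * u y +
      (-1) * ((∑ k, d2 (B k) u y) + A * ∑ i, d2 (ei i) u y)
    have hd2 : ∀ v : Ed d, ContDiffAt ℝ ∞ (d2 v u) z := fun v => (hs.dir _).dir _
    have hs1 : ContDiffAt ℝ ∞ (fun y => ∑ k, d2 (B k) u y) z :=
      ContDiffAt.sum fun k _ => hd2 (B k)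
    have hs2 : ContDiffAt ℝ ∞ (fun y => ∑ i, d2 (ei i) u y) z :=
      ContDiffAt.sum fun i _ => hd2 (ei i)
    have hF : dv V F z = dv (1, 0) (dv V u) z + C * dv V u z +
        (-1) * ((∑ k, d2 (B k) (dv V u) z) + A * ∑ i, d2 (ei i) (dv V u) z) := by
      rw [dv_add ((hs.dir _).add (contDiffAt_const.mul hs))
          (contDiffAt_const.mul (hs1.add (contDiffAt_const.mul hs2))),
        dv_add (hs.dir _) (contDiffAt_const.mul hs), dv_const_mul _ hs,
        dv_const_mul _ (hs1.add (contDiffAt_const.mul hs2)),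
        dv_add hs1 (contDiffAt_const.mul hs2), dv_const_mul _ hs2,
        dv_sum _ (fun k _ => hd2 (B k)), dv_sum _ (fun i _ => hd2 (ei i)), dv_comm hs V (1, 0)]
      simp only [d2, dv_comm_three hs V]
    have hFs : ContDiffAt ℝ ∞ F z := ((hs.dir _).add (contDiffAt_const.mul hs)).add
      (contDiffAt_const.mul (hs1.add (contDiffAt_const.mul hs2)))
    have h0 : (fun s : ℝ => F (z + s • V)) =ᶠ[𝓝 0] fun _ => 0 := by
      filter_upwards [eventually_line ((isOpen_Qop l).mem_nhds hz) V] with s hs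
      have h := hu.eq _ hs
      have e : (z + s • V).2 l = z.2 l := by simp [hV]
      rw [e] at h
      simp only [F]
      rw [h]
      ring
    have h1 := (hasDerivAt_line_zero (V := V) hFs.differentiableAt_top).unique
      ((hasDerivAt_const (0 : ℝ) (0 : ℝ)).congr_of_eventuallyEq h0)
    rw [hF] at h1
    linarith

end Solutions

section Scales

variable {d : ℕ}

/-- The family of half cylinders between `Q_{1/2}⁺` and `Q₁⁺`. -/
def Pr (α : ℝ) (l : Fin d) (r : ℝ) : Set (ℝ × Ed d) :=
  {z | -((1 / 2 : ℝ) ^ (2 - α) + r) < z.1 ∧ z.1 < 0 ∧ ‖z.2‖ < 1 / 2 + r ∧ 0 < z.2 l}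

/-- The largest admissible enlargement in `Pr`. -/
def rtop (α : ℝ) : ℝ := min (1 / 2) (1 - (1 / 2 : ℝ) ^ (2 - α))

variable {κ α lam r r' y : ℝ} {l : Fin d} {c : ℝ → ℝ} {b : ℝ → Fin d → Ed d}
  {u : ℝ × Ed d → ℝ}

lemma rtop_pos (hα : α < 2) : 0 < rtop α := by
  have : (1 / 2 : ℝ) ^ (2 - α) < 1 :=
    Real.rpow_lt_one (by norm_num) (by norm_num) (by linarith)
  exact lt_min (by norm_num) (by linarith)

lemma Pr_subset_Qop (hr : r ≤ rtop α) : Pr α l r ⊆ Qop l := by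
  intro z hz
  have h1 : r ≤ 1 / 2 := hr.trans (min_le_left _ _)
  have h2 : r ≤ 1 - (1 / 2 : ℝ) ^ (2 - α) := hr.trans (min_le_right _ _)
  exact ⟨by linarith [hz.1], hz.2.1, by linarith [hz.2.2.1], hz.2.2.2⟩

lemma Pr_mono (h : r ≤ r') : Pr α l r ⊆ Pr α l r' :=
  fun _ hz => ⟨by linarith [hz.1], hz.2.1, by linarith [hz.2.2.1], hz.2.2.2⟩

lemma isOpen_Pr : IsOpen (Pr α l r) := by
  have h1 : Continuous fun z : ℝ × Ed d => z.2 l := by fun_prop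
  exact (isOpen_lt continuous_const continuous_fst).inter
    ((isOpen_lt continuous_fst continuous_const).inter
      ((isOpen_lt continuous_snd.norm continuous_const).inter (isOpen_lt continuous_const h1)))

lemma abs_coord_le (x : Ed d) (i : Fin d) : |x i| ≤ ‖x‖ := by
  simpa using PiLp.norm_apply_le x i

lemma Pr_coord_lt_one (hr : r ≤ rtop α) {z : ℝ × Ed d} (hz : z ∈ Pr α l r) : z.2 l < 1 :=
  ((le_abs_self _).trans (abs_coord_le z.2 l)).trans_lt (Pr_subset_Qop hr hz).2.2.1

lemma mem_Pr_of_near (hy : 1 ≤ y) (hρ : 1 ≤ y * (r' - r)) {z₀ : ℝ × Ed d} (hz : z₀ ∈ Pr α l r)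
    {t : ℝ} {x : Ed d} (ht : z₀.1 - y⁻¹ ≤ t) (ht' : t ≤ z₀.1) (hx : ‖x - z₀.2‖ ≤ y⁻¹)
    (hl : 0 < x l) : (t, x) ∈ Pr α l r' := by
  have h0 : y⁻¹ ≤ r' - r := by
    rw [inv_le_iff_one_le_mul₀ (by linarith)]
    linarith
  have h1 : ‖x‖ ≤ ‖x - z₀.2‖ + ‖z₀.2‖ := by simpa using norm_add_le (x - z₀.2) z₀.2
  exact ⟨by linarith [hz.1], by linarith [hz.2.1], by linarith [hz.2.2.1], hl⟩

lemma lt_of_one_le_mul (hy : 1 ≤ y) (hρ : 1 ≤ y * (r' - r)) : r < r' := by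
  by_contra h
  nlinarith

/-- Interior-type bound: `|F λ u| ≤ C y^K S` at points of `Pr r` whenever `|u| ≤ S` in
`Pr r'` and `1 / y ≤ r' - r`, uniformly over all solutions. -/
def Bd (κ α : ℝ) (l : Fin d) (F : ℝ → (ℝ × Ed d → ℝ) → ℝ × Ed d → ℝ) : Prop :=
  ∃ C : ℝ, 0 < C ∧ ∃ K : ℕ, ∀ (lam : ℝ) (c : ℝ → ℝ) (b : ℝ → Fin d → Ed d)
    (u : ℝ × Ed d → ℝ) (r r' y S : ℝ), 0 ≤ lam → Coef κ α c b → Sol κ α lam l c b u →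
    0 ≤ r → r' ≤ rtop α → 1 ≤ y → 1 ≤ y * (r' - r) → (∀ z ∈ Pr α l r', |u z| ≤ S) →
    ∀ z ∈ Pr α l r, |F lam u z| ≤ C * y ^ K * S

/-- The analogue of `Bd` away from the flat boundary: only points with `1 / y ≤ x_l`. -/
def BdI (κ α : ℝ) (l : Fin d) (F : ℝ → (ℝ × Ed d → ℝ) → ℝ × Ed d → ℝ) : Prop :=
  ∃ C : ℝ, 0 < C ∧ ∃ K : ℕ, ∀ (lam : ℝ) (c : ℝ → ℝ) (b : ℝ → Fin d → Ed d)
    (u : ℝ × Ed d → ℝ) (r r' y S : ℝ), 0 ≤ lam → Coef κ α c b → Sol κ α lam l c b u →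
    0 ≤ r → r' ≤ rtop α → 1 ≤ y → 1 ≤ y * (r' - r) → (∀ z ∈ Pr α l r', |u z| ≤ S) →
    ∀ z ∈ Pr α l r, 1 ≤ y * z.2 l → |F lam u z| ≤ C * y ^ K * S

lemma Bd.bdI {F : ℝ → (ℝ × Ed d → ℝ) → ℝ × Ed d → ℝ} (h : Bd κ α l F) : BdI κ α l F := by
  obtain ⟨C, hC, K, h⟩ := h
  exact ⟨C, hC, K, fun lam c b u r r' y S h1 h2 h3 h4 h5 h6 h7 h8 z hz _ =>
    h lam c b u r r' y S h1 h2 h3 h4 h5 h6 h7 h8 z hz⟩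

/-- An operator which maps solutions to solutions. -/
def Pres (κ α : ℝ) (l : Fin d) (T : ℝ → (ℝ × Ed d → ℝ) → ℝ × Ed d → ℝ) : Prop :=
  ∀ (lam : ℝ) (c : ℝ → ℝ) (b : ℝ → Fin d → Ed d) (u : ℝ × Ed d → ℝ),
    Sol κ α lam l c b u → Sol κ α lam l c b (T lam u)

lemma Pres.dv {V : ℝ × Ed d} (hV : V.2 l = 0) : Pres κ α l (fun _ u => dv V u) :=
  fun _ _ _ _ hu => hu.tangential hV

lemma Pres.lam_mul : Pres κ α l (fun lam u z => lam * u z) :=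
  fun lam _ _ _ hu => hu.const_mul lam

lemma Pres.comp {T₁ T₂ : ℝ → (ℝ × Ed d → ℝ) → ℝ × Ed d → ℝ} (h₁ : Pres κ α l T₁)
    (h₂ : Pres κ α l T₂) : Pres κ α l (fun lam u => T₂ lam (T₁ lam u)) :=
  fun lam c b u hu => h₂ lam c b _ (h₁ lam c b u hu)

lemma midpoint_scale (hρ : 1 ≤ y * (r' - r)) :
    1 ≤ 2 * y * ((r + r') / 2 - r) ∧ 1 ≤ 2 * y * (r' - (r + r') / 2) := by
  constructor <;> linarith

lemma Bd.comp {T F : ℝ → (ℝ × Ed d → ℝ) → ℝ × Ed d → ℝ} (hF : Bd κ α l F) (hT : Bd κ α l T)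
    (hP : Pres κ α l T) : Bd κ α l (fun lam u => F lam (T lam u)) := by
  obtain ⟨C, hC, K, hF⟩ := hF
  obtain ⟨C', hC', K', hT⟩ := hT
  refine ⟨C * 2 ^ K * (C' * 2 ^ K'), by positivity, K + K', ?_⟩
  intro lam c b u r r' y S h1 h2 h3 h4 h5 h6 h7 h8 z hz
  have hlt := lt_of_one_le_mul h6 h7
  obtain ⟨m1, m2⟩ := midpoint_scale h7
  have := hF lam c b (T lam u) r ((r + r') / 2) (2 * y) (C' * (2 * y) ^ K' * S) h1 h2
    (hP _ _ _ _ h3) h4 (by linarith) (by linarith) m1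
    (hT lam c b u ((r + r') / 2) r' (2 * y) S h1 h2 h3 (by linarith) h5 (by linarith) m2 h8) z hz
  refine this.trans (le_of_eq ?_)
  rw [mul_pow, mul_pow, pow_add]
  ring

/-- Absorption on nested cylinders. -/
lemma absorb {g : ℝ × Ed d → ℝ} {K : ℕ} {A M₀ r₀ r₁ Y : ℝ} (hA : 0 ≤ A) (hM₀ : 0 ≤ M₀)
    (hg : ∀ z ∈ Pr α l r₁, g z ≤ M₀)
    (hstep : ∀ r r' y M, r₀ ≤ r → r' ≤ r₁ → 1 ≤ y → 1 ≤ y * (r' - r) → 0 ≤ M →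
      (∀ z ∈ Pr α l r', g z ≤ M) → ∀ z ∈ Pr α l r, g z ≤ M / 2 + A * y ^ K)
    (hY : 1 ≤ Y) (hY' : 1 ≤ Y * (r₁ - r₀)) :
    ∀ z ∈ Pr α l r₀, g z ≤ 3 * (4 * (K + 1)) ^ K * A * Y ^ K := by
  set L : ℝ := 4 * (K + 1) with hL
  have hL4 : 4 ≤ L := by
    have : (0 : ℝ) ≤ K := Nat.cast_nonneg K
    linarith
  set q : ℝ := 1 - L⁻¹ with hq
  have hLi : L⁻¹ ≤ 1 / 4 := by
    rw [inv_le_comm₀ (by linarith) (by norm_num)]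
    linarith
  have hLi0 : 0 < L⁻¹ := by positivity
  have hq0 : 0 < q := by linarith
  have hq1 : q < 1 := by linarith
  have hqK : 3 / 4 ≤ q ^ K := by
    have h := one_add_mul_le_pow (a := -L⁻¹) (by linarith) K
    have h2 : (K : ℝ) * L⁻¹ ≤ 1 / 4 := by
      rw [← div_eq_mul_inv, div_le_div_iff₀ (by linarith) (by norm_num)]
      linarith
    have h3 : (1 + -L⁻¹) = q := by ring
    rw [h3] at h
    linarith
  have key : ∀ n : ℕ, ∀ r y, r₀ ≤ r → 1 ≤ y → 1 ≤ y * (r₁ - r) →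
      ∀ z ∈ Pr α l r, g z ≤ (1 / 2) ^ n * M₀ + 3 * L ^ K * A * y ^ K := by
    intro n
    induction n with
    | zero =>
      intro r y hr hy hyr z hz
      have := hg z (Pr_mono (lt_of_one_le_mul hy hyr).le hz)
      have h0 : 0 ≤ 3 * L ^ K * A * y ^ K := by positivity
      simp only [pow_zero, one_mul]
      linarith
    | succ n ih =>
      intro r y hr hy hyr z hz
      have hlt := lt_of_one_le_mul hy hyr
      set r' := r + (r₁ - r) * L⁻¹ with hr'
      have hy1 : 1 ≤ y / q := by
        rw [le_div_iff₀ hq0]; linarith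
      have e1 : r₁ - r' = q * (r₁ - r) := by rw [hr', hq]; ring
      have e2 : y / q * (r₁ - r') = y * (r₁ - r) := by rw [e1]; field_simp
      have e3 : y * L * (r' - r) = y * (r₁ - r) := by
        rw [hr']; field_simp; ring
      have hrr' : r ≤ r' := by
        have : 0 ≤ (r₁ - r) * L⁻¹ := mul_nonneg (by linarith) hLi0.le
        linarith
      have hr1 : r' ≤ r₁ := by
        have : 0 ≤ q * (r₁ - r) := mul_nonneg hq0.le (by linarith)
        linarith
      have h1 := ih r' (y / q) (hr.trans hrr') hy1 (by rw [e2]; exact hyr)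
      have h2 := hstep r r' (y * L) _ hr hr1 (by nlinarith) (by rw [e3]; exact hyr)
        (by positivity) h1 z hz
      refine h2.trans ?_
      have h3 : (y / q) ^ K ≤ 4 / 3 * y ^ K := by
        rw [div_pow, div_le_iff₀ (by positivity)]
        have : 0 ≤ y ^ K := by positivity
        nlinarith
      have h4 : 3 * L ^ K * A * (y / q) ^ K ≤ 3 * L ^ K * A * (4 / 3 * y ^ K) :=
        mul_le_mul_of_nonneg_left h3 (by positivity)
      rw [mul_pow y L, pow_succ]
      linarith
  intro z hz
  have hlim : Tendsto (fun n : ℕ => (1 / 2 : ℝ) ^ n * M₀ + 3 * L ^ K * A * Y ^ K) atTop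
      (𝓝 (0 * M₀ + 3 * L ^ K * A * Y ^ K)) :=
    ((_root_.tendsto_pow_atTop_nhds_zero_of_lt_one (by norm_num) (by norm_num)).mul_const _).add_const _
  have := ge_of_tendsto' hlim fun n => key n r₀ Y le_rfl hY hY' z hz
  linarith

end Scales

section Barrier

variable {d : ℕ} {κ α lam : ℝ} {l : Fin d} {c : ℝ → ℝ} {b : ℝ → Fin d → Ed d}
  {u : ℝ × Ed d → ℝ}

lemma hasSymmDeriv2_comp_coord {G G' : ℝ → ℝ} {G₂ : ℝ} {x : Ed d}
    (hG : ∀ᶠ s in 𝓝 (x l), HasDerivAt G (G' s) s) (hG' : HasDerivAt G' G₂ (x l)) (v : Ed d) :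
    HasSymmDeriv2 (fun s => G ((x + s • v) l)) (G₂ * v l ^ 2) := by
  have hd : ∀ s : ℝ, HasDerivAt (fun s : ℝ => (x + s • v) l) (v l) s := by
    intro s
    simpa using ((hasDerivAt_id s).mul_const (v l)).const_add (x l)
  refine HasSymmDeriv2.of_hasDerivAt (f' := fun s => G' ((x + s • v) l) * v l) ?_ ?_
  · have hc : ContinuousAt (fun s : ℝ => (x + s • v) l) 0 := (hd 0).continuousAt
    have : ∀ᶠ s : ℝ in 𝓝 0, HasDerivAt G (G' ((x + s • v) l)) ((x + s • v) l) :=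
      hc.eventually (by simpa using hG)
    filter_upwards [this] with s hs
    exact hs.comp s (hd s)
  · have h0 : HasDerivAt G' G₂ ((x + (0 : ℝ) • v) l) := by simpa using hG'
    have := (h0.comp (0 : ℝ) (hd 0)).mul_const (v l)
    exact this.congr_deriv (by ring)

lemma hasSymmDeriv2_normSq_sub (x x₀ v : Ed d) (R : ℝ) :
    HasSymmDeriv2 (fun s => R * ‖x + s • v - x₀‖ ^ 2) (2 * R * ‖v‖ ^ 2) := by
  have h := (HasSymmDeriv2.normSq (x - x₀) v).const_mul R
  convert h using 1
  · ext s
    rw [add_sub_right_comm]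
  · ring

lemma Coef.sum_le (hc : Coef κ α c b) {s : ℝ} (hs : 0 < s) (hs1 : s < 1) {R : ℝ} (hR : 0 ≤ R) :
    ∑ k, 2 * R * ‖b s k‖ ^ 2 ≤ 2 * R * κ⁻¹ * s ^ α := by
  rw [← Finset.mul_sum]
  nlinarith [hc.b_upper s hs hs1]

/-- Comparison of a solution with a barrier of the form
`P x_l (t₀ - t) + Q (t - t₁) + R |x - x₀|² + G(x_l)`, `G` concave. -/
lemma Sol.le_barrier (hc : Coef κ α c b) (hu : Sol κ α lam l c b u) (hκ : 0 < κ)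
    {t₁ t₀ ρ a e P Q R Λ m : ℝ} {x₀ : Ed d} {G G' G₂ : ℝ → ℝ} (hR : 0 ≤ R)
    (hcl : ∀ t ∈ Icc t₁ t₀, ∀ x : Ed d, ‖x - x₀‖ ≤ ρ → a ≤ x l → x l ≤ e → (t, x) ∈ Qcl l)
    (hop : ∀ t ∈ Ioc t₁ t₀, ∀ x : Ed d, ‖x - x₀‖ < ρ → a < x l → x l < e → (t, x) ∈ Qop l)
    (hG : ∀ s ∈ Ioo a e, HasDerivAt G (G' s) s) (hG' : ∀ s ∈ Ioo a e, HasDerivAt G' (G₂ s) s)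
    (hGc : ContinuousOn G (Icc a e)) (hG₂ : ∀ s ∈ Ioo a e, G₂ s ≤ 0)
    (hini : ∀ x : Ed d, ‖x - x₀‖ ≤ ρ → a ≤ x l → x l ≤ e →
      u (t₁, x) - m ≤ P * x l * (t₀ - t₁) + R * ‖x - x₀‖ ^ 2 + G (x l))
    (hlat : ∀ t ∈ Icc t₁ t₀, ∀ x : Ed d, ‖x - x₀‖ ≤ ρ → a ≤ x l → x l ≤ e →
      ‖x - x₀‖ = ρ ∨ x l = a ∨ x l = e →
      u (t, x) - m ≤ P * x l * (t₀ - t) + Q * (t - t₁) + R * ‖x - x₀‖ ^ 2 + G (x l))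
    (hΛ : ∀ t ∈ Ioc t₁ t₀, ∀ x : Ed d, ‖x - x₀‖ < ρ → a < x l → x l < e →
      P * x l * (t₀ - t) + Q * (t - t₁) + R * ‖x - x₀‖ ^ 2 + G (x l) < u (t, x) - m →
      -Λ ≤ lam * c (x l) * u (t, x))
    (hineq : ∀ s ∈ Ioo a e, s < 1 →
      2 * R * (κ⁻¹ + d * κ) * s ^ α + κ * s ^ α * G₂ s + Λ < Q - P * s) :
    ∀ t ∈ Icc t₁ t₀, ∀ x : Ed d, ‖x - x₀‖ ≤ ρ → a ≤ x l → x l ≤ e →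
      u (t, x) - m ≤ P * x l * (t₀ - t) + Q * (t - t₁) + R * ‖x - x₀‖ ^ 2 + G (x l) := by
  set ψ : ℝ → Ed d → ℝ := fun t x =>
    P * x l * (t₀ - t) + Q * (t - t₁) + R * ‖x - x₀‖ ^ 2 + G (x l) with hψ
  have hcoord : Continuous fun x : Ed d => x l := by fun_prop
  have hnorm : Continuous fun x : Ed d => ‖x - x₀‖ := by fun_prop
  set Y : Set (Ed d) := {x | ‖x - x₀‖ ≤ ρ ∧ a ≤ x l ∧ x l ≤ e} with hY
  set V : Set (Ed d) := {x | ‖x - x₀‖ < ρ ∧ a < x l ∧ x l < e} with hV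
  have hYc : IsCompact Y := by
    have h1 : IsClosed Y := (isClosed_le hnorm continuous_const).inter
      ((isClosed_le continuous_const hcoord).inter (isClosed_le hcoord continuous_const))
    refine (isCompact_closedBall x₀ ρ).of_isClosed_subset h1 fun x hx => ?_
    simpa [dist_eq_norm] using hx.1
  have hVo : IsOpen V := (isOpen_lt hnorm continuous_const).inter
      ((isOpen_lt continuous_const hcoord).inter (isOpen_lt hcoord continuous_const))
  have hmain := parabolic_comparison (w := fun t x => u (t, x) - m) (ψ := ψ) hYc hVo
    (fun x hx => ⟨hx.1.le, hx.2.1.le, hx.2.2.le⟩) (t₁ := t₁) (t₀ := t₀) ?_ ?_ ?_ ?_ ?_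
  · intro t ht x h1 h2 h3
    exact hmain t ht x ⟨h1, h2, h3⟩
  · refine ContinuousOn.sub ?_ continuousOn_const
    refine hu.continuousOn.mono ?_
    rintro ⟨t, x⟩ ⟨ht, hx⟩
    exact hcl t ht x hx.1 hx.2.1 hx.2.2
  · have h1 : ContinuousOn (fun z : ℝ × Ed d => G (z.2 l)) (Icc t₁ t₀ ×ˢ Y) :=
      hGc.comp (by fun_prop) fun z hz => ⟨hz.2.2.1, hz.2.2.2⟩
    refine ContinuousOn.add ?_ h1
    fun_prop
  · intro x hx
    have := hini x hx.1 hx.2.1 hx.2.2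
    simp only [hψ]
    linarith
  · intro t ht x hx hxV
    refine hlat t ht x hx.1 hx.2.1 hx.2.2 ?_
    by_contra hcon
    push Not at hcon
    exact hxV ⟨lt_of_le_of_ne hx.1 hcon.1, lt_of_le_of_ne hx.2.1 (Ne.symm hcon.2.1),
      lt_of_le_of_ne hx.2.2 hcon.2.2⟩
  · intro t ht x hx hlt htime hspace
    have hQ := hop t ht x hx.1 hx.2.1 hx.2.2
    have hsm := hu.smooth _ (Qop_subset_Qcl l hQ)
    have hs0 : 0 < x l := hQ.2.2.2
    have hs1 : x l < 1 := ((le_abs_self _).trans (abs_coord_le x l)).trans_lt hQ.2.2.1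
    have hI : x l ∈ Ioo a e := ⟨hx.2.1, hx.2.2⟩
    have hp : Q - P * x l ≤ dv (1, 0) u (t, x) := by
      refine htime _ _ ((hasDerivAt_time hsm.differentiableAt_top).sub_const m) ?_
      have h1 : HasDerivAt (fun s : ℝ => P * x l * (t₀ - s)) (P * x l * (-1)) t :=
        ((hasDerivAt_id t).const_sub t₀).const_mul _
      have h2 : HasDerivAt (fun s : ℝ => Q * (s - t₁)) (Q * 1) t :=
        ((hasDerivAt_id t).sub_const t₁).const_mul _
      have h3 := ((h1.add h2).add_const (R * ‖x - x₀‖ ^ 2)).add_const (G (x l))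
      exact h3.congr_deriv (by ring)
    have hσ : ∀ v : Ed d, d2 v u (t, x) ≤ 2 * R * ‖v‖ ^ 2 + G₂ (x l) * v l ^ 2 := by
      intro v
      refine hspace v _ _ (by
        simpa using (hasSymmDeriv2_space hsm v).sub (HasSymmDeriv2.const m)) ?_
      have h1 := HasSymmDeriv2.affine (P * x l * (t₀ - t) + Q * (t - t₁)) (P * v l * (t₀ - t))
      have h2 := hasSymmDeriv2_normSq_sub x x₀ v R
      have h3 := hasSymmDeriv2_comp_coord (l := l) (G := G) (G' := G')
        (by filter_upwards [Ioo_mem_nhds hI.1 hI.2] with s hs using hG s hs) (hG' _ hI) v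
      have h4 := (h1.add h2).add h3
      convert h4 using 1
      · ext s
        simp only [hψ, PiLp.add_apply, PiLp.smul_apply, smul_eq_mul]
        ring
      · ring
    have hG2 := hG₂ _ hI
    have hα0 : 0 < x l ^ α := Real.rpow_pos_of_pos hs0 α
    have hsum1 : ∑ k, d2 (b (x l) k) u (t, x) ≤ 2 * R * κ⁻¹ * x l ^ α := by
      refine le_trans (Finset.sum_le_sum fun k _ => ?_) (hc.sum_le hs0 hs1 hR)
      exact (hσ _).trans (by nlinarith [sq_nonneg (b (x l) k l)])
    have hsum2 : ∑ i, d2 (ei i) u (t, x) ≤ 2 * R * d + G₂ (x l) := by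
      have h5 : ∀ i, d2 (ei i) u (t, x) ≤ 2 * R + G₂ (x l) * (if i = l then 1 else 0) := by
        intro i
        have := hσ (ei i)
        have e1 : ‖(ei i : Ed d)‖ = 1 := by simp
        have e2 : (ei i : Ed d) l ^ 2 = if i = l then 1 else 0 := by
          by_cases h : i = l
          · simp [h]
          · simp [h, Ne.symm h]
        rw [e1, e2] at this
        linarith
      refine (Finset.sum_le_sum fun i _ => h5 i).trans (le_of_eq ?_)
      rw [Finset.sum_add_distrib, ← Finset.mul_sum]
      simp
      ring
    have heq := hu.eq _ hQ
    simp only at heq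
    have hL := hΛ t ht x hx.1 hx.2.1 hx.2.2 hlt
    have hfin := hineq _ hI hs1
    have h6 : κ * x l ^ α * ∑ i, d2 (ei i) u (t, x) ≤ κ * x l ^ α * (2 * R * d + G₂ (x l)) :=
      mul_le_mul_of_nonneg_left hsum2 (by positivity)
    nlinarith

end Barrier

section FirstBounds

variable {d : ℕ} {κ α lam r r' y : ℝ} {l : Fin d} {c : ℝ → ℝ} {b : ℝ → Fin d → Ed d}
  {u : ℝ × Ed d → ℝ}

lemma strict_of_near (hr' : r' ≤ rtop α) (hy : 1 ≤ y) (hρ : 1 ≤ y * (r' - r)) {z₀ : ℝ × Ed d}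
    (hz : z₀ ∈ Pr α l r) {t : ℝ} {x : Ed d} (ht : z₀.1 - y⁻¹ ≤ t) (ht' : t ≤ z₀.1)
    (hx : ‖x - z₀.2‖ ≤ y⁻¹) : -1 < t ∧ t < 0 ∧ ‖x‖ < 1 := by
  have h0 : y⁻¹ ≤ r' - r := by
    rw [inv_le_iff_one_le_mul₀ (by linarith)]
    linarith
  have h1 : ‖x‖ ≤ ‖x - z₀.2‖ + ‖z₀.2‖ := by simpa using norm_add_le (x - z₀.2) z₀.2
  have h2 : r' ≤ 1 / 2 := hr'.trans (min_le_left _ _)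
  have h3 : r' ≤ 1 - (1 / 2 : ℝ) ^ (2 - α) := hr'.trans (min_le_right _ _)
  exact ⟨by linarith [hz.1], by linarith [hz.2.1], by linarith [hz.2.2.1]⟩

lemma Bd.of_pos_upper {F : ℝ → (ℝ × Ed d → ℝ) → ℝ × Ed d → ℝ}
    (hodd : ∀ (lam : ℝ) (c : ℝ → ℝ) (b : ℝ → Fin d → Ed d) (u : ℝ × Ed d → ℝ),
      Sol κ α lam l c b u → ∀ z ∈ Qop l, F lam (fun z => -u z) z = -F lam u z)
    (h : ∃ C : ℝ, 0 < C ∧ ∃ K : ℕ, ∀ (lam : ℝ) (c : ℝ → ℝ) (b : ℝ → Fin d → Ed d)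
      (u : ℝ × Ed d → ℝ) (r r' y S : ℝ), 0 ≤ lam → Coef κ α c b → Sol κ α lam l c b u →
      0 ≤ r → r' ≤ rtop α → 1 ≤ y → 1 ≤ y * (r' - r) → 0 < S → (∀ z ∈ Pr α l r', |u z| ≤ S) →
      ∀ z ∈ Pr α l r, F lam u z ≤ C * y ^ K * S) : Bd κ α l F := by
  obtain ⟨C, hC, K, h⟩ := h
  refine ⟨C, hC, K, ?_⟩
  intro lam c b u r r' y S h1 h2 h3 h4 h5 h6 h7 h8 z hz
  have hzQ := Pr_subset_Qop h5 (Pr_mono (lt_of_one_le_mul h6 h7).le hz)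
  have hS : 0 ≤ S := (abs_nonneg _).trans (h8 z (Pr_mono (lt_of_one_le_mul h6 h7).le hz))
  have key : ∀ S' > S, |F lam u z| ≤ C * y ^ K * S' := by
    intro S' hS'
    have a1 := h lam c b u r r' y S' h1 h2 h3 h4 h5 h6 h7 (by linarith)
      (fun z hz => (h8 z hz).trans hS'.le) z hz
    have a2 := h lam c b (fun z => -u z) r r' y S' h1 h2 h3.neg h4 h5 h6 h7 (by linarith)
      (fun z hz => by rw [abs_neg]; exact (h8 z hz).trans hS'.le) z hz
    rw [hodd lam c b u h3 z hzQ] at a2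
    exact abs_le.2 ⟨by linarith, a1⟩
  have hlim : Tendsto (fun S' : ℝ => C * y ^ K * S') (𝓝[>] S) (𝓝 (C * y ^ K * S)) :=
    ((continuous_const.mul continuous_id).tendsto S).mono_left nhdsWithin_le_nhds
  exact ge_of_tendsto hlim (by filter_upwards [self_mem_nhdsWithin] with S' hS' using key S' hS')

/-- The bound for `λ u`. -/
lemma bd_lam_mul (hκ : 0 < κ) (hα : 0 ≤ α) : Bd κ α l (fun lam u z => lam * u z) := by
  set A₁ : ℝ := κ⁻¹ + d * κ with hA₁
  have hA₁0 : 0 < A₁ := by positivity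
  set N : ℝ := (2 * A₁ + 2) / κ with hN
  have hN0 : 0 < N := by positivity
  have hκN : κ * N = 2 * A₁ + 2 := by rw [hN]; field_simp
  refine Bd.of_pos_upper (fun lam c b u _ z _ => by ring) ⟨N, hN0, 2, ?_⟩
  intro lam c b u r r' y S hlam hc hu hr hr' hy hρ hS hb z₀ hz₀
  rcases hlam.eq_or_lt with h0 | hlam
  · rw [← h0, zero_mul]; positivity
  have hy0 : 0 < y := by linarith
  have hi : 0 < y⁻¹ := by positivity
  have hyi : y * y⁻¹ = 1 := mul_inv_cancel₀ hy0.ne'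
  have hyi2 : y ^ 2 * y⁻¹ ^ 2 = 1 := by rw [← mul_pow, hyi, one_pow]
  have hcl : ∀ t ∈ Icc (z₀.1 - y⁻¹) z₀.1, ∀ x : Ed d, ‖x - z₀.2‖ ≤ y⁻¹ → 0 ≤ x l → x l ≤ 1 →
      (t, x) ∈ Qcl l := fun t ht x hx h1 _ => by
    obtain ⟨a1, a2, a3⟩ := strict_of_near hr' hy hρ hz₀ ht.1 ht.2 hx
    exact ⟨a1.le, a2.le, a3.le, h1⟩
  have hub : ∀ t ∈ Icc (z₀.1 - y⁻¹) z₀.1, ∀ x : Ed d, ‖x - z₀.2‖ ≤ y⁻¹ → 0 ≤ x l →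
      u (t, x) ≤ S := by
    intro t ht x hx h1
    rcases h1.eq_or_lt with h1 | h1
    · obtain ⟨a1, a2, a3⟩ := strict_of_near hr' hy hρ hz₀ ht.1 ht.2 hx
      rw [hu.zero (t, x) a1 a2 a3 h1.symm]
      exact hS.le
    · exact (le_abs_self _).trans (hb _ (mem_Pr_of_near hy hρ hz₀ ht.1 ht.2 hx h1))
  have hψ : ∀ t ∈ Icc (z₀.1 - y⁻¹) z₀.1, 0 ≤ -S * y * (t - (z₀.1 - y⁻¹)) + S := by
    intro t ht
    have : y * (t - (z₀.1 - y⁻¹)) ≤ y * y⁻¹ :=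
      mul_le_mul_of_nonneg_left (by linarith [ht.2]) hy0.le
    rw [hyi] at this
    nlinarith
  have hG0 : 0 < S * N * y ^ 2 / lam := by positivity
  have hmain := hu.le_barrier hc hκ (t₁ := z₀.1 - y⁻¹) (t₀ := z₀.1) (ρ := y⁻¹) (a := 0) (e := 1)
    (P := 0) (Q := -S * y) (R := S * y ^ 2) (Λ := -(κ * S * N * y ^ 2)) (m := 0) (x₀ := z₀.2)
    (G := fun _ => S + S * N * y ^ 2 / lam) (G' := fun _ => 0) (G₂ := fun _ => 0)
    (by positivity) hcl ?_ (fun s _ => hasDerivAt_const s _) (fun s _ => hasDerivAt_const s _)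
    continuousOn_const (fun _ _ => le_rfl) ?_ ?_ ?_ ?_
  · have := hmain z₀.1 ⟨by linarith, le_rfl⟩ z₀.2 (by simp [hi.le]) hz₀.2.2.2.le
      (Pr_coord_lt_one hr' (Pr_mono (lt_of_one_le_mul hy hρ).le hz₀)).le
    simp only [sub_self, norm_zero, sub_zero] at this
    have e : u z₀ ≤ S * N * y ^ 2 / lam := by
      change u (z₀.1, z₀.2) ≤ _
      nlinarith
    rw [le_div_iff₀ hlam] at e
    linarith
  · intro t ht x hx h1 h2
    obtain ⟨a1, a2, a3⟩ := strict_of_near hr' hy hρ hz₀ ht.1.le ht.2 hx.le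
    exact ⟨a1, a2, a3, h1⟩
  · intro x hx h1 h2
    have := hub _ ⟨le_rfl, by linarith⟩ x hx h1
    have h3 : 0 ≤ S * y ^ 2 * ‖x - z₀.2‖ ^ 2 := by positivity
    linarith
  · intro t ht x hx h1 h2 h3
    have a1 := hub t ht x hx h1
    have a2 := hψ t ht
    have a3 : 0 ≤ S * y ^ 2 * ‖x - z₀.2‖ ^ 2 := by positivity
    obtain ⟨b1, b2, b3⟩ := strict_of_near hr' hy hρ hz₀ ht.1 ht.2 hx
    rcases h3 with h3 | h3 | h3
    · have : S * y ^ 2 * ‖x - z₀.2‖ ^ 2 = S := by rw [h3, mul_assoc, hyi2, mul_one]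
      linarith
    · rw [hu.zero (t, x) b1 b2 b3 h3]
      linarith
    · linarith [le_abs_self (x l), abs_coord_le x l]
  · intro t ht x hx h1 h2 h3
    have a2 := hψ t ⟨ht.1.le, ht.2⟩
    have a3 : 0 ≤ S * y ^ 2 * ‖x - z₀.2‖ ^ 2 := by positivity
    have a4 : S * N * y ^ 2 / lam ≤ u (t, x) := by linarith
    rw [div_le_iff₀ hlam] at a4
    have a5 := hc.c_lower (x l) h1 h2
    have a6 : 0 ≤ u (t, x) * lam := le_trans (by positivity) a4
    nlinarith
  · intro s hs hs1
    have h1 : s ^ α * 0 = 0 := mul_zero _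
    have h2 : S * y ≤ S * y ^ 2 := by nlinarith [mul_nonneg hS.le hy0.le]
    have h3 : s ^ α ≤ 1 := Real.rpow_le_one hs.1.le hs1.le hα
    have h4 : 2 * (S * y ^ 2) * A₁ * s ^ α ≤ 2 * (S * y ^ 2) * A₁ * 1 :=
      mul_le_mul_of_nonneg_left h3 (by positivity)
    have h5 : κ * S * N * y ^ 2 = (2 * A₁ + 2) * (S * y ^ 2) := by rw [← hκN]; ring
    have h6 : 0 < S * y ^ 2 := by positivity
    nlinarith

end FirstBounds

section FlatBoundary

variable {d : ℕ} {κ α lam r r' y : ℝ} {l : Fin d} {c : ℝ → ℝ} {b : ℝ → Fin d → Ed d}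
  {u : ℝ × Ed d → ℝ}

lemma norm_sub_smul_ei_le (x : Ed d) {s : ℝ} (hs : 0 ≤ s) (hs' : s ≤ x l) :
    ‖x - s • ei l‖ ≤ ‖x‖ := by
  rw [EuclideanSpace.norm_eq, EuclideanSpace.norm_eq]
  refine Real.sqrt_le_sqrt (Finset.sum_le_sum fun i _ => ?_)
  by_cases h : i = l
  · subst h
    simp only [PiLp.sub_apply, PiLp.smul_apply, PiLp.single_apply, if_true, smul_eq_mul,
      mul_one, Real.norm_eq_abs, sq_abs]
    nlinarith
  · simp [h]

/-- Integration from the flat boundary. -/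
lemma abs_le_coord_mul_of_deriv_bound (hu : Sol κ α lam l c b u) (hr : r ≤ rtop α) {M : ℝ}
    (hM : ∀ z ∈ Pr α l r, |dv (0, ei l) u z| ≤ M) : ∀ z ∈ Pr α l r, |u z| ≤ M * z.2 l := by
  intro z hz
  have hzQ := Pr_subset_Qop hr hz
  have hpos := hz.2.2.2
  have hpt : ∀ s : ℝ, z + (s - z.2 l) • ((0 : ℝ), ei l) = (z.1, z.2 - (z.2 l - s) • ei l) := by
    intro s
    ext1
    · simp
    · simp only [Prod.snd_add, Prod.smul_snd]
      rw [sub_eq_add_neg z.2, ← neg_smul, neg_sub]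
  have hnorm : ∀ s ∈ Icc 0 (z.2 l), ‖z.2 - (z.2 l - s) • ei l‖ ≤ ‖z.2‖ := fun s hs =>
    norm_sub_smul_ei_le z.2 (by linarith [hs.2]) (by linarith [hs.1])
  have hcoord : ∀ s : ℝ, (z.2 - (z.2 l - s) • ei l) l = s := by intro s; simp
  have hmem : ∀ s ∈ Icc 0 (z.2 l), z + (s - z.2 l) • ((0 : ℝ), ei l) ∈ Qcl l := by
    intro s hs
    rw [hpt]
    exact ⟨hzQ.1.le, hzQ.2.1.le, (hnorm s hs).trans hzQ.2.2.1.le, by rw [hcoord]; exact hs.1⟩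
  have hder : ∀ s ∈ Icc 0 (z.2 l), HasDerivAt (fun s : ℝ => u (z + (s - z.2 l) • ((0 : ℝ), ei l)))
      (dv (0, ei l) u (z + (s - z.2 l) • ((0 : ℝ), ei l))) s := by
    intro s hs
    have h := (hasDerivAt_line (hu.smooth _ (hmem s hs)).differentiableAt_top)
    have h2 := h.comp s ((hasDerivAt_id s).sub_const (z.2 l))
    exact h2.congr_deriv (mul_one _)
  obtain ⟨s, hs, he⟩ := exists_hasDerivAt_eq_slope _ _ hpos
    (fun s hs => (hder s hs).continuousAt.continuousWithinAt)
    (fun s hs => hder s (Ioo_subset_Icc_self hs))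
  have h0 : u (z + (0 - z.2 l) • ((0 : ℝ), ei l)) = 0 := by
    rw [hpt]
    refine hu.zero _ hzQ.1 hzQ.2.1 ((hnorm 0 ⟨le_rfl, hpos.le⟩).trans_lt hzQ.2.2.1) ?_
    exact hcoord 0
  rw [h0] at he
  simp only [sub_self, zero_smul, add_zero, sub_zero] at he
  have hs' : z + (s - z.2 l) • ((0 : ℝ), ei l) ∈ Pr α l r := by
    rw [hpt]
    refine ⟨hz.1, hz.2.1, (hnorm s (Ioo_subset_Icc_self hs)).trans_lt hz.2.2.1, ?_⟩
    change 0 < (z.2 - (z.2 l - s) • ei l) l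
    rw [hcoord]
    exact hs.1
  have h3 := hM _ hs'
  rw [he, abs_div, abs_of_pos hpos, div_le_iff₀ hpos] at h3
  exact h3

lemma Sol.exists_coord_bound (hu : Sol κ α lam l c b u) (hr : r ≤ rtop α) :
    ∃ M : ℝ, 0 ≤ M ∧ ∀ z ∈ Pr α l r, |u z| / z.2 l ≤ M := by
  obtain ⟨M, hM, h⟩ := exists_bound_of_smooth (l := l) fun z hz => (hu.smooth z hz).dir (0, ei l)
  refine ⟨M, hM.le, fun z hz => ?_⟩
  rw [div_le_iff₀ hz.2.2.2]
  exact abs_le_coord_mul_of_deriv_bound hu hr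
    (fun z hz => h z (Qop_subset_Qcl l (Pr_subset_Qop hr hz))) z hz

set_option maxHeartbeats 800000 in
lemma Sol.coord_bound_step (hκ : 0 < κ) (hα2 : α < 2) (hlam : 0 ≤ lam)
    (hc : Coef κ α c b) (hu : Sol κ α lam l c b u) {S M B ε : ℝ} (hS : 0 < S) (hM : 0 ≤ M)
    (hr' : r' ≤ rtop α) (hy : 1 ≤ y) (hρ : 1 ≤ y * (r' - r))
    (hb : ∀ z ∈ Pr α l r', u z ≤ S) (hg : ∀ z ∈ Pr α l r', u z ≤ M * z.2 l)
    (hB1 : 1 ≤ B) (hB2 : 4 / (κ * (2 - α)) ≤ B) (hB3 : 4 * (κ⁻¹ + d * κ) / κ ≤ B)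
    (hε : 0 < ε) (hε1 : ε ≤ (B * y)⁻¹) (hε2 : ε ^ (2 - α) ≤ (B * y)⁻¹) :
    ∀ z ∈ Pr α l r, u z ≤ z.2 l * (M / 2 + 2 * S / ε) := by
  intro z₀ hz₀
  have hy0 : 0 < y := by linarith
  have hBy : 1 ≤ B * y := by nlinarith
  have hεle : ε ≤ 1 := hε1.trans (inv_le_one_of_one_le₀ hBy)
  have hpos := hz₀.2.2.2
  have hSε : S ≤ S / ε := by rw [le_div_iff₀ hε]; nlinarith
  have hz₀' := Pr_mono (lt_of_one_le_mul hy hρ).le hz₀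
  rcases le_or_gt (z₀.2 l) ε with hle | hgt
  swap
  · have h1 := hb _ hz₀'
    have h2 : S ≤ z₀.2 l * (S / ε) := by
      rw [mul_div_assoc', le_div_iff₀ hε]
      nlinarith
    have h3 : 0 ≤ z₀.2 l * (M / 2) := by positivity
    have h4 : 0 ≤ z₀.2 l * (S / ε) := by positivity
    have h5 : z₀.2 l * (M / 2 + 2 * S / ε) = z₀.2 l * (M / 2) + 2 * (z₀.2 l * (S / ε)) := by ring
    linarith
  set A₁ : ℝ := κ⁻¹ + d * κ with hA₁
  have hA₁0 : 0 < A₁ := by positivity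
  have hα' : 0 < 2 - α := by linarith
  have hi : 0 < y⁻¹ := by positivity
  have hyi : y * y⁻¹ = 1 := mul_inv_cancel₀ hy0.ne'
  set N₁ : ℝ := M * y / (κ * (2 - α)) with hN₁
  set N₂ : ℝ := M * ε * y ^ 2 * A₁ / κ + S with hN₂
  have hN₁0 : 0 ≤ N₁ := by positivity
  have hN₂0 : 0 < N₂ := by positivity
  set G : ℝ → ℝ := fun s => S / ε * s + N₁ * (ε ^ (2 - α) * s - s ^ (3 - α)) +
    N₂ * (ε * s - s ^ 2) with hG
  have hGlow : ∀ s, 0 ≤ s → s ≤ ε → S / ε * s ≤ G s := by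
    intro s hs hse
    have h1 : s ^ (3 - α) ≤ ε ^ (2 - α) * s := by
      rcases hs.eq_or_lt with h | h
      · rw [← h, Real.zero_rpow (by linarith)]; simp
      · rw [show 3 - α = (2 - α) + 1 by ring, Real.rpow_add h, Real.rpow_one]
        exact mul_le_mul_of_nonneg_right (Real.rpow_le_rpow hs hse hα'.le) hs
    have h2 : 0 ≤ N₁ * (ε ^ (2 - α) * s - s ^ (3 - α)) := mul_nonneg hN₁0 (by linarith)
    have h3 : 0 ≤ N₂ * (ε * s - s ^ 2) := mul_nonneg hN₂0.le (by nlinarith)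
    simp only [hG]
    linarith
  have hG0 : ∀ s, 0 ≤ s → s ≤ ε → 0 ≤ G s := fun s h1 h2 =>
    le_trans (by positivity) (hGlow s h1 h2)
  have hlow : ∀ t ∈ Icc (z₀.1 - y⁻¹) z₀.1, ∀ x : Ed d, 0 ≤ x l →
      0 ≤ M * y * x l * (z₀.1 - t) := fun t ht x hx =>
    mul_nonneg (by positivity) (by linarith [ht.2])
  have hub : ∀ t ∈ Icc (z₀.1 - y⁻¹) z₀.1, ∀ x : Ed d, ‖x - z₀.2‖ ≤ y⁻¹ → 0 ≤ x l →
      u (t, x) ≤ M * x l ∧ u (t, x) ≤ S := by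
    intro t ht x hx h1
    rcases h1.eq_or_lt with h1 | h1
    · obtain ⟨a1, a2, a3⟩ := strict_of_near hr' hy hρ hz₀ ht.1 ht.2 hx
      rw [hu.zero (t, x) a1 a2 a3 h1.symm, ← h1]
      exact ⟨by simp, hS.le⟩
    · have := mem_Pr_of_near hy hρ hz₀ ht.1 ht.2 hx h1
      exact ⟨hg _ this, hb _ this⟩
  have hmain := hu.le_barrier hc hκ (t₁ := z₀.1 - y⁻¹) (t₀ := z₀.1) (ρ := y⁻¹) (a := 0) (e := ε)
    (P := M * y) (Q := 0) (R := M * ε * y ^ 2) (Λ := 0) (m := 0) (x₀ := z₀.2)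
    (G := G)
    (G' := fun s => S / ε + N₁ * (ε ^ (2 - α) - (3 - α) * s ^ (2 - α)) + N₂ * (ε - 2 * s))
    (G₂ := fun s => -(N₁ * ((3 - α) * (2 - α) * s ^ (1 - α))) - 2 * N₂)
    (by positivity) ?_ ?_ ?_ ?_ ?_ ?_ ?_ ?_ ?_ ?_
  · have := hmain z₀.1 ⟨by linarith, le_rfl⟩ z₀.2 (by simp [hi.le]) hpos.le hle
    simp only [sub_self, norm_zero, sub_zero] at this
    have e : u z₀ ≤ G (z₀.2 l) := by
      change u (z₀.1, z₀.2) ≤ _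
      linarith
    refine e.trans ?_
    have h1 : N₁ * ε ^ (2 - α) ≤ M / 4 := by
      have h2 : N₁ * ε ^ (2 - α) ≤ N₁ * (B * y)⁻¹ := mul_le_mul_of_nonneg_left hε2 hN₁0
      refine h2.trans ?_
      have h3 : N₁ * (B * y)⁻¹ = M / 4 * (4 / (κ * (2 - α))) / B := by
        rw [hN₁]; field_simp
      rw [h3, div_le_iff₀ (by linarith)]
      exact mul_le_mul_of_nonneg_left hB2 (by positivity)
    have h2 : N₂ * ε ≤ M / 4 + S := by
      have h3 : ε * ε ≤ (B * y)⁻¹ * (B * y)⁻¹ := mul_le_mul hε1 hε1 hε.le (by positivity)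
      have h4 : M * ε * y ^ 2 * A₁ / κ * ε ≤ M / 4 := by
        have h5 : M * ε * y ^ 2 * A₁ / κ * ε = M * y ^ 2 * A₁ / κ * (ε * ε) := by ring
        have h6 : M * y ^ 2 * A₁ / κ * (ε * ε) ≤
            M * y ^ 2 * A₁ / κ * ((B * y)⁻¹ * (B * y)⁻¹) :=
          mul_le_mul_of_nonneg_left h3 (by positivity)
        have h7 : M * y ^ 2 * A₁ / κ * ((B * y)⁻¹ * (B * y)⁻¹) =
            M / 4 * (4 * A₁ / κ) / (B * B) := by field_simp
        rw [h5]
        refine h6.trans ?_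
        rw [h7, div_le_iff₀ (by positivity)]
        exact mul_le_mul_of_nonneg_left (hB3.trans (by nlinarith)) (by positivity)
      have h8 : S * ε ≤ S := mul_le_of_le_one_right hS.le hεle
      rw [hN₂, add_mul]
      linarith
    have h3 : 0 ≤ z₀.2 l ^ (3 - α) := by positivity
    have h4 : G (z₀.2 l) ≤ z₀.2 l * (S / ε + N₁ * ε ^ (2 - α) + N₂ * ε) := by
      have h5 : z₀.2 l * (S / ε + N₁ * ε ^ (2 - α) + N₂ * ε) =
          G (z₀.2 l) + N₁ * z₀.2 l ^ (3 - α) + N₂ * z₀.2 l ^ 2 := by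
        simp only [hG]
        ring
      have h6 : 0 ≤ N₁ * z₀.2 l ^ (3 - α) := mul_nonneg hN₁0 h3
      have h7 : 0 ≤ N₂ * z₀.2 l ^ 2 := mul_nonneg hN₂0.le (sq_nonneg _)
      linarith
    refine h4.trans (mul_le_mul_of_nonneg_left ?_ hpos.le)
    rw [mul_div_assoc]
    linarith
  · intro t ht x hx h1 h2
    obtain ⟨a1, a2, a3⟩ := strict_of_near hr' hy hρ hz₀ ht.1 ht.2 hx
    exact ⟨a1.le, a2.le, a3.le, h1⟩
  · intro t ht x hx h1 h2
    obtain ⟨a1, a2, a3⟩ := strict_of_near hr' hy hρ hz₀ ht.1.le ht.2 hx.le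
    exact ⟨a1, a2, a3, h1⟩
  · intro s hs
    have h1 := (Real.hasDerivAt_rpow_const (x := s) (p := 3 - α) (Or.inl hs.1.ne'))
    rw [show 3 - α - 1 = 2 - α by ring] at h1
    have h2 := (((hasDerivAt_id s).const_mul (S / ε)).add
      ((((hasDerivAt_id s).const_mul (ε ^ (2 - α))).sub h1).const_mul N₁)).add
      ((((hasDerivAt_id s).const_mul ε).sub (hasDerivAt_pow 2 s)).const_mul N₂)
    exact h2.congr_deriv (by simp)
  · intro s hs
    have h1 := (Real.hasDerivAt_rpow_const (x := s) (p := 2 - α) (Or.inl hs.1.ne'))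
    rw [show 2 - α - 1 = 1 - α by ring] at h1
    have h2 := (((h1.const_mul (3 - α)).const_sub (ε ^ (2 - α))).const_mul N₁).const_add (S / ε)
    have h3 := h2.add ((((hasDerivAt_id s).const_mul 2).const_sub ε).const_mul N₂)
    exact h3.congr_deriv (by simp; ring)
  · have h1 : Continuous fun s : ℝ => s ^ (3 - α) := Real.continuous_rpow_const (by linarith)
    refine Continuous.continuousOn ?_
    simp only [hG]
    fun_prop
  · intro s hs
    have h1 : 0 < s ^ (1 - α) := Real.rpow_pos_of_pos hs.1 _
    have h2 : 0 ≤ N₁ * ((3 - α) * (2 - α) * s ^ (1 - α)) :=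
      mul_nonneg hN₁0 (mul_nonneg (mul_nonneg (by linarith) hα'.le) h1.le)
    linarith
  · intro x hx h1 h2
    have h3 := (hub _ ⟨le_rfl, by linarith⟩ x hx h1).1
    have h4 : M * y * x l * (z₀.1 - (z₀.1 - y⁻¹)) = M * x l := by
      linear_combination M * x l * hyi
    have h5 := hG0 _ h1 h2
    have h6 : 0 ≤ M * ε * y ^ 2 * ‖x - z₀.2‖ ^ 2 := by positivity
    linarith
  · intro t ht x hx h1 h2 h3
    obtain ⟨a1, a2⟩ := hub t ht x hx h1
    have a3 := hlow t ht x h1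
    have a5 := hG0 _ h1 h2
    have a6 : 0 ≤ M * ε * y ^ 2 * ‖x - z₀.2‖ ^ 2 := by positivity
    obtain ⟨b1, b2, b3⟩ := strict_of_near hr' hy hρ hz₀ ht.1 ht.2 hx
    rcases h3 with h3 | h3 | h3
    · have : M * ε * y ^ 2 * ‖x - z₀.2‖ ^ 2 = M * ε := by
        rw [h3]
        linear_combination M * ε * (y * y⁻¹ + 1) * hyi
      have h7 : M * x l ≤ M * ε := mul_le_mul_of_nonneg_left h2 hM
      linarith
    · rw [hu.zero (t, x) b1 b2 b3 h3]
      linarith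
    · have h7 := hGlow _ h1 h2
      have h8 : S / ε * x l = S := by rw [h3]; field_simp
      linarith
  · intro t ht x hx h1 h2 h3
    have a3 := hlow t ⟨ht.1.le, ht.2⟩ x h1.le
    have a5 := hG0 _ h1.le h2.le
    have a6 : 0 ≤ M * ε * y ^ 2 * ‖x - z₀.2‖ ^ 2 := by positivity
    have a7 : 0 ≤ u (t, x) := by linarith
    obtain ⟨b1, b2, b3⟩ := strict_of_near hr' hy hρ hz₀ ht.1.le ht.2 hx.le
    have a8 := hc.c_lower (x l) h1 ((le_abs_self _).trans_lt ((abs_coord_le x l).trans_lt b3))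
    have : 0 ≤ lam * c (x l) * u (t, x) := mul_nonneg (mul_nonneg hlam (by linarith)) a7
    linarith
  · intro s hs hs1
    have h1 : s ^ α * s ^ (1 - α) = s := by
      rw [← Real.rpow_add hs.1, show α + (1 - α) = 1 by ring, Real.rpow_one]
    have h2 : 0 < s ^ α := Real.rpow_pos_of_pos hs.1 _
    have h3 : κ * s ^ α * (N₁ * ((3 - α) * (2 - α) * s ^ (1 - α))) = (3 - α) * (M * y * s) := by
      have : κ * s ^ α * (N₁ * ((3 - α) * (2 - α) * s ^ (1 - α))) =
        κ * N₁ * (2 - α) * ((3 - α) * (s ^ α * s ^ (1 - α))) := by ring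
      rw [this, h1, hN₁]
      field_simp
    have h4 : κ * s ^ α * (2 * N₂) = 2 * (M * ε * y ^ 2) * A₁ * s ^ α + 2 * κ * S * s ^ α := by
      rw [hN₂]
      field_simp
    have h5 : 0 < κ * S * s ^ α := by positivity
    have h6 : 0 ≤ (2 - α) * (M * y * s) := mul_nonneg hα'.le (by have := hs.1; positivity)
    nlinarith

/-- Solutions are controlled by the distance to the flat boundary. -/
lemma bd_div_coord (hκ : 0 < κ) (hα2 : α < 2) :
    Bd κ α l (fun _ u z => u z / z.2 l) := by
  set B : ℝ := 1 + 4 / (κ * (2 - α)) + 4 * (κ⁻¹ + d * κ) / κ with hB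
  have hα' : 0 < 2 - α := by linarith
  have hp1 : 0 < 4 / (κ * (2 - α)) := by positivity
  have hp2 : 0 < 4 * (κ⁻¹ + d * κ) / κ := by positivity
  obtain ⟨n, hn⟩ := exists_nat_ge (1 + 1 / (2 - α))
  have hn1 : (1 : ℝ) ≤ n := le_trans (by linarith [one_div_pos.2 hα']) hn
  have hn2 : 1 ≤ n * (2 - α) := by
    have : 1 / (2 - α) ≤ n := by linarith
    rwa [div_le_iff₀ hα'] at this
  refine Bd.of_pos_upper (fun lam c b u _ z _ => neg_div _ _)
    ⟨3 * (4 * (n + 1)) ^ n * (2 * B ^ n), by positivity, n, ?_⟩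
  intro lam c b u r r' y S hlam hc hu hr hr' hy hρ hS hb z₀ hz₀
  obtain ⟨M₀, hM₀, hM⟩ := hu.exists_coord_bound hr'
  have := absorb (g := fun z => |u z| / z.2 l) (K := n) (A := 2 * B ^ n * S) (r₀ := r) (r₁ := r')
    (by positivity) hM₀ hM ?_ hy hρ z₀ hz₀
  · have h1 : u z₀ / z₀.2 l ≤ |u z₀| / z₀.2 l :=
      div_le_div_of_nonneg_right (le_abs_self _) hz₀.2.2.2.le
    refine h1.trans (this.trans (le_of_eq (by ring)))
  · intro r₁ r₂ Y M h1 h2 hY hYr hM hg z hz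
    have hBY : 1 ≤ B * Y := by nlinarith
    have hε0 : 0 < ((B * Y) ^ n)⁻¹ := by positivity
    have hε1 : ((B * Y) ^ n)⁻¹ ≤ (B * Y)⁻¹ := by
      refine inv_anti₀ (by linarith) (le_self_pow₀ hBY ?_)
      rintro rfl
      norm_num at hn1
    have hε2 : (((B * Y) ^ n)⁻¹) ^ (2 - α) ≤ (B * Y)⁻¹ := by
      rw [Real.inv_rpow (by positivity), ← Real.rpow_natCast, ← Real.rpow_mul (by linarith)]
      refine inv_anti₀ (by linarith) ?_
      calc B * Y = (B * Y) ^ (1 : ℝ) := (Real.rpow_one _).symm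
        _ ≤ _ := Real.rpow_le_rpow_of_exponent_le hBY hn2
    have hpos := hz.2.2.2
    have hg' : ∀ z ∈ Pr α l r₂, |u z| ≤ M * z.2 l := fun z hz => by
      have := hg z hz
      rwa [div_le_iff₀ hz.2.2.2] at this
    have a1 := hu.coord_bound_step hκ hα2 hlam hc hS hM (h2.trans hr') hY hYr
      (fun z hz => (le_abs_self _).trans (hb z (Pr_mono h2 hz)))
      (fun z hz => (le_abs_self _).trans (hg' z hz)) (by linarith) (by linarith) (by linarith)
      hε0 hε1 hε2 z hz
    have a2 := hu.neg.coord_bound_step hκ hα2 hlam hc hS hM (h2.trans hr') hY hYr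
      (fun z hz => (neg_le_abs _).trans (hb z (Pr_mono h2 hz)))
      (fun z hz => (neg_le_abs _).trans (hg' z hz)) (by linarith) (by linarith) (by linarith)
      hε0 hε1 hε2 z hz
    rw [div_le_iff₀ hpos]
    have e : z.2 l * (M / 2 + 2 * S / ((B * Y) ^ n)⁻¹) =
        (M / 2 + 2 * B ^ n * S * Y ^ n) * z.2 l := by
      rw [div_inv_eq_mul, mul_pow]
      ring
    rw [e] at a1 a2
    exact abs_le.2 ⟨by linarith, a1⟩

/-- A bound with a small multiple of the supremum away from the flat boundary improves to a
bound up to the boundary. -/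
lemma bd_of_interior (hκ : 0 < κ) (hα2 : α < 2)
    {T : ℝ → (ℝ × Ed d → ℝ) → ℝ × Ed d → ℝ} (hP : Pres κ α l T)
    (hT : ∃ C : ℝ, 0 < C ∧ ∃ K : ℕ, ∀ (lam : ℝ) (c : ℝ → ℝ) (b : ℝ → Fin d → Ed d)
      (u : ℝ × Ed d → ℝ) (r r' y S M : ℝ), 0 ≤ lam → Coef κ α c b → Sol κ α lam l c b u →
      0 ≤ r → r' ≤ rtop α → 1 ≤ y → 1 ≤ y * (r' - r) → (∀ z ∈ Pr α l r', |u z| ≤ S) →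
      (∀ z ∈ Pr α l r', |T lam u z| ≤ M) →
      ∀ z ∈ Pr α l r, 1 ≤ y * z.2 l → |T lam u z| ≤ M / 2 + C * y ^ K * S) : Bd κ α l T := by
  obtain ⟨C, hC, K, hT⟩ := hT
  obtain ⟨C₁, hC₁, K₁, hD⟩ := bd_div_coord (d := d) (l := l) hκ hα2
  set B : ℝ := 1 + 2 * C₁ with hB
  refine ⟨3 * (4 * ((K₁ + 1) * K + 1 : ℕ)) ^ ((K₁ + 1) * K) * (C * B ^ K), by positivity,
    (K₁ + 1) * K, ?_⟩
  intro lam c b u r r' y S hlam hc hu hr hr' hy hρ hb z₀ hz₀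
  have hS : 0 ≤ S := (abs_nonneg _).trans (hb z₀ (Pr_mono (lt_of_one_le_mul hy hρ).le hz₀))
  have hTu := hP _ _ _ _ hu
  obtain ⟨M₀, hM₀, hM⟩ := exists_bound_of_smooth hTu.smooth
  have := absorb (g := fun z => |T lam u z|) (K := (K₁ + 1) * K) (A := C * B ^ K * S) (r₀ := r)
    (r₁ := r') (by positivity) hM₀.le
    (fun z hz => hM z (Qop_subset_Qcl l (Pr_subset_Qop hr' hz))) ?_ hy hρ z₀ hz₀
  · refine this.trans (le_of_eq ?_)
    push_cast
    ring
  · intro r₁ r₂ Y M h1 h2 hY hYr hM0 hg z hz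
    set Y' : ℝ := B * Y ^ (K₁ + 1) with hY'
    have hYK : Y ≤ Y ^ (K₁ + 1) := le_self_pow₀ hY (by omega)
    have hYY : Y ≤ Y' := by nlinarith
    have e : C * B ^ K * S * Y ^ ((K₁ + 1) * K) = C * Y' ^ K * S := by
      rw [hY', mul_pow, pow_mul]; ring
    rw [e]
    rcases le_or_gt 1 (Y' * z.2 l) with hle | hlt
    · exact hT lam c b u r₁ r₂ Y' S M hlam hc hu (hr.trans h1) (h2.trans hr') (by linarith)
        (by nlinarith [lt_of_one_le_mul hY hYr]) (fun z hz => hb z (Pr_mono h2 hz)) hg z hz hle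
    · have h3 := hD lam c b (T lam u) r₁ r₂ Y M hlam hc hTu (hr.trans h1) (h2.trans hr') hY hYr hg
        z hz
      have hpos := hz.2.2.2
      rw [abs_div, abs_of_pos hpos, div_le_iff₀ hpos] at h3
      have h4 : 0 ≤ C * Y' ^ K * S := by positivity
      have h5 : C₁ * Y ^ K₁ * 2 ≤ Y' := by
        have : Y ^ K₁ ≤ Y ^ (K₁ + 1) := pow_le_pow_right₀ hY (by omega)
        have : 0 < Y ^ (K₁ + 1) := by positivity
        rw [hY', hB]
        nlinarith
      have h6 : C₁ * Y ^ K₁ * z.2 l ≤ 1 / 2 := by nlinarith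
      nlinarith

lemma bd_of_bdI (hκ : 0 < κ) (hα2 : α < 2)
    {T : ℝ → (ℝ × Ed d → ℝ) → ℝ × Ed d → ℝ} (hP : Pres κ α l T) (hT : BdI κ α l T) :
    Bd κ α l T := by
  obtain ⟨C, hC, K, hT⟩ := hT
  refine bd_of_interior hκ hα2 hP ⟨C, hC, K, ?_⟩
  intro lam c b u r r' y S M h1 h2 h3 h4 h5 h6 h7 h8 h9 z hz hzl
  have hM : 0 ≤ M := (abs_nonneg _).trans (h9 z (Pr_mono (lt_of_one_le_mul h6 h7).le hz))
  have := hT lam c b u r r' y S h1 h2 h3 h4 h5 h6 h7 h8 z hz hzl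
  linarith

end FlatBoundary

section Doubling

variable {d : ℕ} {κ α lam r r' y : ℝ} {l : Fin d} {c : ℝ → ℝ} {b : ℝ → Fin d → Ed d}
  {u : ℝ × Ed d → ℝ}

/-- Comparison with `2H((t₀ - t)/R + |x - x₀|²/R²) + Ah - Bh²`, `A = 2H/R + BR`. -/
lemma doubling_comparison {w : ℝ → Ed d × ℝ → ℝ} {t₀ R H B : ℝ} {x₀ : Ed d} (hR : 0 < R)
    (hH : 0 ≤ H) (hB : 0 ≤ B)
    (hw : ContinuousOn (fun z : ℝ × (Ed d × ℝ) => w z.1 z.2)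
      (Icc (t₀ - R) t₀ ×ˢ {p : Ed d × ℝ | ‖p.1 - x₀‖ ≤ R ∧ 0 ≤ p.2 ∧ p.2 ≤ R}))
    (hbd : ∀ t ∈ Icc (t₀ - R) t₀, ∀ x h, ‖x - x₀‖ ≤ R → 0 ≤ h → h ≤ R → w t (x, h) ≤ 2 * H)
    (hzero : ∀ t x, w t (x, 0) ≤ 0)
    (hno : ∀ t ∈ Ioc (t₀ - R) t₀, ∀ x h, ‖x - x₀‖ < R → 0 < h → h < R → 0 < w t (x, h) →
      (∀ p, HasDerivAt (fun s => w s (x, h)) p t → -(2 * H / R) ≤ p) →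
      (∀ v τ σ, HasSymmDeriv2 (fun s => w t (x + s • v, h + s * τ)) σ →
        σ ≤ 4 * H / R ^ 2 * ‖v‖ ^ 2 - 2 * B * τ ^ 2) → False) :
    ∀ h ∈ Icc 0 R, w t₀ (x₀, h) ≤ (2 * H / R + B * R) * h := by
  set A : ℝ := 2 * H / R + B * R with hA
  set ψ : ℝ → Ed d × ℝ → ℝ := fun t p =>
    2 * H / R * (t₀ - t) + 2 * H / R ^ 2 * ‖p.1 - x₀‖ ^ 2 + (A * p.2 - B * p.2 ^ 2) with hψ
  have hHR : 0 ≤ 2 * H / R := by positivity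
  have hHR2 : 0 ≤ 2 * H / R ^ 2 := by positivity
  have hquad : ∀ h, 0 ≤ h → h ≤ R → 0 ≤ A * h - B * h ^ 2 := by
    intro h h1 h2
    have : A * h - B * h ^ 2 = 2 * H / R * h + B * (h * (R - h)) := by rw [hA]; ring
    rw [this]
    have : 0 ≤ h * (R - h) := mul_nonneg h1 (by linarith)
    positivity
  have hn : Continuous fun p : Ed d × ℝ => ‖p.1 - x₀‖ := by fun_prop
  set Y : Set (Ed d × ℝ) := {p | ‖p.1 - x₀‖ ≤ R ∧ 0 ≤ p.2 ∧ p.2 ≤ R} with hY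
  set V : Set (Ed d × ℝ) := {p | ‖p.1 - x₀‖ < R ∧ 0 < p.2 ∧ p.2 < R} with hV
  have hYc : IsCompact Y := by
    have h1 : IsClosed Y := (isClosed_le hn continuous_const).inter
      ((isClosed_le continuous_const continuous_snd).inter
        (isClosed_le continuous_snd continuous_const))
    refine ((isCompact_closedBall x₀ R).prod (isCompact_Icc (a := (0 : ℝ)) (b := R))).of_isClosed_subset
      h1 fun p hp => ⟨?_, hp.2.1, hp.2.2⟩
    simpa [dist_eq_norm] using hp.1
  have hVo : IsOpen V := (isOpen_lt hn continuous_const).inter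
      ((isOpen_lt continuous_const continuous_snd).inter
        (isOpen_lt continuous_snd continuous_const))
  have hmain := parabolic_comparison (w := w) (ψ := ψ) hYc hVo
    (fun p hp => ⟨hp.1.le, hp.2.1.le, hp.2.2.le⟩) (t₁ := t₀ - R) (t₀ := t₀) hw ?_ ?_ ?_ ?_
  · intro h hh
    have := hmain t₀ ⟨by linarith, le_rfl⟩ (x₀, h) ⟨by simpa using hR.le, hh.1, hh.2⟩
    simp only [hψ, sub_self, norm_zero] at this
    have h2 : 0 ≤ B * h ^ 2 := by positivity
    linarith
  · simp only [hψ]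
    fun_prop
  · intro p hp
    have h1 := hbd _ ⟨le_rfl, by linarith⟩ p.1 p.2 hp.1 hp.2.1 hp.2.2
    have h2 := hquad _ hp.2.1 hp.2.2
    have h3 : 2 * H / R * (t₀ - (t₀ - R)) = 2 * H := by
      rw [show t₀ - (t₀ - R) = R by ring]
      field_simp
    have h4 : 0 ≤ 2 * H / R ^ 2 * ‖p.1 - x₀‖ ^ 2 := by positivity
    simp only [hψ, h3]
    linarith
  · intro t ht p hp hpV
    have h1 := hbd t ht p.1 p.2 hp.1 hp.2.1 hp.2.2
    have h2 := hquad _ hp.2.1 hp.2.2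
    have h3 : 0 ≤ 2 * H / R * (t₀ - t) := mul_nonneg hHR (by linarith [ht.2])
    have h4 : 0 ≤ 2 * H / R ^ 2 * ‖p.1 - x₀‖ ^ 2 := by positivity
    simp only [hψ]
    rcases hp.1.eq_or_lt with a1 | a1
    · have : 2 * H / R ^ 2 * ‖p.1 - x₀‖ ^ 2 = 2 * H := by rw [a1]; field_simp
      linarith
    rcases hp.2.1.eq_or_lt with a2 | a2
    · have := hzero t p.1
      rw [a2] at this
      linarith
    rcases hp.2.2.eq_or_lt with a3 | a3
    · have : A * p.2 - B * p.2 ^ 2 = 2 * H := by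
        rw [a3, hA]; field_simp; ring
      linarith
    exact absurd ⟨a1, a2, a3⟩ hpV
  · intro t ht p hp hlt htime hspace
    refine hno t ht p.1 p.2 hp.1 hp.2.1 hp.2.2 ?_ ?_ ?_
    · have h2 := hquad _ hp.2.1.le hp.2.2.le
      have h3 : 0 ≤ 2 * H / R * (t₀ - t) := mul_nonneg hHR (by linarith [ht.2])
      have h4 : 0 ≤ 2 * H / R ^ 2 * ‖p.1 - x₀‖ ^ 2 := by positivity
      simp only [hψ] at hlt
      linarith
    · intro q hq
      refine htime q _ hq ?_
      have h1 : HasDerivAt (fun s : ℝ => 2 * H / R * (t₀ - s)) (2 * H / R * (-1)) t :=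
        ((hasDerivAt_id t).const_sub t₀).const_mul _
      have h3 := (h1.add_const (2 * H / R ^ 2 * ‖p.1 - x₀‖ ^ 2)).add_const
        (A * p.2 - B * p.2 ^ 2)
      exact h3.congr_deriv (by ring)
    · intro v τ σ hσ
      refine hspace (v, τ) σ _ hσ ?_
      have h1 := HasSymmDeriv2.const (2 * H / R * (t₀ - t))
      have h2 := hasSymmDeriv2_normSq_sub p.1 x₀ v (2 * H / R ^ 2)
      have h3 := HasSymmDeriv2.affine (A * p.2) (A * τ)
      have h4 : HasSymmDeriv2 (fun s : ℝ => (p.2 + s * τ) ^ 2) (2 * τ ^ 2) := by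
        have := HasSymmDeriv2.normSq (p.2 : ℝ) τ
        simpa using this
      have h5 := (h1.add h2).add (h3.sub (h4.const_mul B))
      convert h5 using 1
      · ext s
        simp only [hψ, Prod.fst_add, Prod.smul_fst, Prod.snd_add, Prod.smul_snd, smul_eq_mul]
        ring
      · ring

lemma le_of_increment_le {f : ℝ → ℝ} {f' A R : ℝ} (hR : 0 < R) (hf : HasDerivAt f f' 0)
    (h : ∀ s ∈ Ioo 0 R, f s - f 0 ≤ A * s) : f' ≤ A := by
  refine le_of_tendsto hf.tendsto_slope_zero_right ?_
  filter_upwards [Ioo_mem_nhdsGT hR] with s hs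
  rw [zero_add, smul_eq_mul, inv_mul_le_iff₀ hs.1, mul_comm]
  exact h s hs

/-- One-sided directional derivative bound by doubling the variables in direction `e_j`. -/
lemma Sol.deriv_le_of_doubling (hu : Sol κ α lam l c b u) {j : Fin d} {H B : ℝ} (hH : 0 ≤ H)
    (hB : 0 ≤ B) (hr' : r' ≤ rtop α) (hy : 1 ≤ y) (hρ : 1 ≤ y * (r' - r))
    (hb : ∀ z ∈ Pr α l r', |u z| ≤ H) {z₀ : ℝ × Ed d} (hz₀ : z₀ ∈ Pr α l r)
    (hzl : 1 ≤ y * z₀.2 l) {R : ℝ} (hR : R = y⁻¹ / 4)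
    (hno : ∀ (t : ℝ) (x : Ed d) (h : ℝ), (t, x) ∈ Pr α l r' → (t, x + h • ei j) ∈ Pr α l r' → 0 < h → 2 * R ≤ x l →
      u (t, x) < u (t, x + h • ei j) →
      -(2 * H / R) ≤ dv (1, 0) u (t, x + h • ei j) - dv (1, 0) u (t, x) →
      (∀ (v : Ed d) (τ : ℝ), d2 (v + τ • ei j) u (t, x + h • ei j) - d2 v u (t, x) ≤
        4 * H / R ^ 2 * ‖v‖ ^ 2 - 2 * B * τ ^ 2) → False) :
    dv (0, ei j) u z₀ ≤ 2 * H / R + B * R := by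
  have hy0 : 0 < y := by linarith
  have hi : 0 < y⁻¹ := by positivity
  have hR0 : 0 < R := by rw [hR]; positivity
  have hzl' : 4 * R ≤ z₀.2 l := by
    rw [hR]
    have : y⁻¹ ≤ z₀.2 l := by rw [inv_le_iff_one_le_mul₀ hy0]; linarith
    linarith
  have hne : ‖(ei j : Ed d)‖ = 1 := by simp
  have hel : 0 ≤ (ei j : Ed d) l := by
    simp only [PiLp.single_apply]; split_ifs <;> norm_num
  have hxl : ∀ x : Ed d, ‖x - z₀.2‖ ≤ R → 2 * R ≤ x l := by
    intro x hx
    have := (neg_le_abs _).trans (abs_coord_le (x - z₀.2) l)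
    simp only [PiLp.sub_apply] at this
    linarith
  have hmem : ∀ t ∈ Icc (z₀.1 - R) z₀.1, ∀ x : Ed d, ‖x - z₀.2‖ ≤ R → (t, x) ∈ Pr α l r' := by
    intro t ht x hx
    exact mem_Pr_of_near hy hρ hz₀ (by linarith [ht.1]) ht.2 (by linarith) (by linarith [hxl x hx])
  have hmem' : ∀ t ∈ Icc (z₀.1 - R) z₀.1, ∀ (x : Ed d) (h : ℝ), ‖x - z₀.2‖ ≤ R → 0 ≤ h → h ≤ R →
      (t, x + h • ei j) ∈ Pr α l r' := by
    intro t ht x h hx h0 h1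
    have h2 : ‖x + h • ei j - z₀.2‖ ≤ 2 * R := by
      rw [add_sub_right_comm]
      refine (norm_add_le _ _).trans ?_
      rw [norm_smul, hne, mul_one, Real.norm_eq_abs, abs_of_nonneg h0]
      linarith
    refine mem_Pr_of_near hy hρ hz₀ (by linarith [ht.1]) ht.2 (by linarith) ?_
    simp only [PiLp.add_apply, PiLp.smul_apply, smul_eq_mul]
    have := hxl x hx
    have := mul_nonneg h0 hel
    linarith
  have hcl : ∀ {z}, z ∈ Pr α l r' → z ∈ Qcl l := fun hz =>
    Qop_subset_Qcl l (Pr_subset_Qop hr' hz)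
  have hkey := doubling_comparison (w := fun t p => u (t, p.1 + p.2 • ei j) - u (t, p.1))
    (t₀ := z₀.1) (x₀ := z₀.2) hR0 hH hB ?_ ?_ (by simp) ?_
  · have hd := hasDerivAt_line_zero (V := ((0 : ℝ), ei j))
      (hu.smooth z₀ (hcl (Pr_mono (lt_of_one_le_mul hy hρ).le hz₀))).differentiableAt_top
    refine le_of_increment_le hR0 hd fun s hs => ?_
    have := hkey s ⟨hs.1.le, hs.2.le⟩
    simpa [Prod.add_def] using this
  · refine ContinuousOn.sub ?_ ?_
    · refine hu.continuousOn.comp (f := fun z : ℝ × (Ed d × ℝ) => (z.1, z.2.1 + z.2.2 • ei j))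
        (by fun_prop) fun z hz => ?_
      exact hcl (hmem' z.1 hz.1 z.2.1 z.2.2 hz.2.1 hz.2.2.1 hz.2.2.2)
    · refine hu.continuousOn.comp (f := fun z : ℝ × (Ed d × ℝ) => (z.1, z.2.1))
        (by fun_prop) fun z hz => ?_
      exact hcl (hmem z.1 hz.1 z.2.1 hz.2.1)
  · intro t ht x h hx h0 h1
    have a1 := (abs_le.1 (hb _ (hmem t ht x hx))).1
    have a2 := (abs_le.1 (hb _ (hmem' t ht x h hx h0 h1))).2
    simp only
    linarith
  · intro t ht x h hx h0 h1 hpos htime hspace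
    have m1 := hmem t ⟨ht.1.le, ht.2⟩ x hx.le
    have m2 := hmem' t ⟨ht.1.le, ht.2⟩ x h hx.le h0.le h1.le
    have s1 := hu.smooth _ (hcl m1)
    have s2 := hu.smooth _ (hcl m2)
    refine hno t x h m1 m2 h0 (hxl x hx.le) (by simpa using hpos) ?_ ?_
    · exact htime _ ((hasDerivAt_time s2.differentiableAt_top).sub
        (hasDerivAt_time s1.differentiableAt_top))
    · intro v τ
      refine hspace v τ _ (HasSymmDeriv2.sub ?_ (hasSymmDeriv2_space s1 v))
      have := hasSymmDeriv2_space s2 (v + τ • ei j)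
      convert this using 4 with s
      module

set_option maxHeartbeats 800000 in
/-- Interior bound for tangential derivatives. -/
lemma bdI_tangential (hκ : 0 < κ) (hα : 0 < α) (hα2 : α < 2) {j : Fin d} (hj : j ≠ l) :
    ∃ C : ℝ, 0 < C ∧ ∃ K : ℕ, ∀ (lam : ℝ) (c : ℝ → ℝ) (b : ℝ → Fin d → Ed d)
      (u : ℝ × Ed d → ℝ) (r r' y S : ℝ), 0 ≤ lam → Coef κ α c b → Sol κ α lam l c b u →
      0 ≤ r → r' ≤ rtop α → 1 ≤ y → 1 ≤ y * (r' - r) → 0 < S → (∀ z ∈ Pr α l r', |u z| ≤ S) →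
      ∀ z ∈ Pr α l r, 1 ≤ y * z.2 l → dv (0, ei j) u z ≤ C * y ^ K * S := by
  set A₁ : ℝ := κ⁻¹ + d * κ with hA₁
  have hA₁0 : 0 < A₁ := by positivity
  set N : ℝ := (1 + A₁) / κ with hN
  have hN0 : 0 < N := by positivity
  have hκN : κ * N = 1 + A₁ := by rw [hN]; field_simp
  refine ⟨64 * (2 + N), by positivity, 3, ?_⟩
  intro lam c b u r r' y S hlam hc hu hr hr' hy hρ hS hb z₀ hz₀ hzl
  have hy0 : 0 < y := by linarith
  have hi : 0 < y⁻¹ := by positivity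
  have hi1 : y⁻¹ ≤ 1 := inv_le_one_of_one_le₀ hy
  set R : ℝ := y⁻¹ / 4 with hR
  have hR0 : 0 < R := by positivity
  have hR1 : R ≤ 1 / 4 := by linarith
  have hmain := hu.deriv_le_of_doubling (j := j) (H := S) (B := N * S / R ^ 4) hS.le (by positivity)
    hr' hy hρ hb hz₀ hzl hR ?_
  · refine hmain.trans ?_
    have e1 : 2 * S / R ≤ 2 * S / R ^ 3 :=
      div_le_div_of_nonneg_left (by positivity) (by positivity)
        (pow_le_of_le_one hR0.le (by linarith) (by norm_num))
    have e2 : N * S / R ^ 4 * R = N * S / R ^ 3 := by field_simp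
    have e3 : 64 * (2 + N) * y ^ 3 * S = 2 * S / R ^ 3 + N * S / R ^ 3 := by
      rw [hR]; field_simp; ring
    linarith
  · intro t x h m1 m2 h0 hxl hlt htime hspace
    set X := x + h • ei j with hX
    have hXl : X l = x l := by simp [hX, Ne.symm hj]
    have hx0 : 0 < x l := by linarith
    have hx1 := Pr_coord_lt_one hr' m1
    have q1 := hu.eq _ (Pr_subset_Qop hr' m1)
    have q2 := hu.eq _ (Pr_subset_Qop hr' m2)
    simp only at q1 q2 hx1
    rw [hXl] at q2
    have hs1 : ∀ v, d2 v u (t, X) - d2 v u (t, x) ≤ 4 * S / R ^ 2 * ‖v‖ ^ 2 := by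
      intro v
      have := hspace v 0
      simpa using this
    have hsj : d2 (ei j) u (t, X) - d2 (ei j) u (t, x) ≤ 4 * S / R ^ 2 - 4 * (N * S / R ^ 4) := by
      have a1 := hspace 0 1
      have a2 := hspace (ei j) (-1)
      have e0 : d2 (0 : Ed d) u (t, x) = 0 := by
        simp only [d2, dv, Prod.mk_zero_zero, map_zero]
      have e0' : d2 (0 : Ed d) u (t, X) = 0 := by
        simp only [d2, dv, Prod.mk_zero_zero, map_zero]
      simp only [zero_add, one_smul, neg_smul, add_neg_cancel, e0, e0', norm_zero] at a1 a2
      have hne : ‖(ei j : Ed d)‖ = 1 := by simp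
      rw [hne] at a2
      linarith
    have hT : ∑ k, d2 (b (x l) k) u (t, X) - ∑ k, d2 (b (x l) k) u (t, x) ≤
        4 * S / R ^ 2 * κ⁻¹ * x l ^ α := by
      rw [← Finset.sum_sub_distrib]
      have := hc.sum_le hx0 hx1 (R := 2 * S / R ^ 2) (by positivity)
      have e : 2 * (2 * S / R ^ 2) = 4 * S / R ^ 2 := by ring
      rw [e] at this
      exact (Finset.sum_le_sum fun k _ => hs1 _).trans this
    have hU : ∑ i, d2 (ei i) u (t, X) - ∑ i, d2 (ei i) u (t, x) ≤
        4 * S / R ^ 2 * d - 4 * (N * S / R ^ 4) := by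
      rw [← Finset.sum_sub_distrib]
      have : ∀ i, d2 (ei i) u (t, X) - d2 (ei i) u (t, x) ≤
          4 * S / R ^ 2 + (if i = j then -(4 * (N * S / R ^ 4)) else 0) := by
        intro i
        by_cases h : i = j
        · subst h; simpa [sub_eq_add_neg] using hsj
        · have := hs1 (ei i)
          simpa [h] using this
      refine (Finset.sum_le_sum fun i _ => this i).trans (le_of_eq ?_)
      rw [Finset.sum_add_distrib]
      simp
      ring
    have hα0 : 4 * R ^ 2 ≤ x l ^ α := by
      have a1 : (2 * R) ^ (2 : ℝ) ≤ (2 * R) ^ α :=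
        Real.rpow_le_rpow_of_exponent_ge (by linarith) (by linarith) hα2.le
      have a2 := Real.rpow_le_rpow (by linarith) hxl hα.le
      rw [Real.rpow_two] at a1
      nlinarith
    have hα1 : x l ^ α ≤ 1 := Real.rpow_le_one hx0.le hx1.le hα.le
    set X₀ := x l ^ α with hX₀
    have hcl := hc.c_lower (x l) hx0 hx1
    have hlc : 0 ≤ lam * c (x l) * (u (t, X) - u (t, x)) :=
      mul_nonneg (mul_nonneg hlam (by linarith)) (by linarith)
    have hX0 : 0 < X₀ := lt_of_lt_of_le (by positivity) hα0
    have f1 : κ * X₀ * (∑ i, d2 (ei i) u (t, X) - ∑ i, d2 (ei i) u (t, x)) ≤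
        κ * X₀ * (4 * S / R ^ 2 * d - 4 * (N * S / R ^ 4)) :=
      mul_le_mul_of_nonneg_left hU (by positivity)
    have f2 : -(2 * S / R) ≤ 4 * S / R ^ 2 * A₁ * X₀ - 4 * (κ * N) * (S / R ^ 4) * X₀ := by
      have : 4 * S / R ^ 2 * A₁ * X₀ - 4 * (κ * N) * (S / R ^ 4) * X₀ =
        4 * S / R ^ 2 * κ⁻¹ * X₀ + κ * X₀ * (4 * S / R ^ 2 * d - 4 * (N * S / R ^ 4)) := by
        rw [hA₁]; ring
      rw [this]
      clear_value X X₀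
      linarith
    rw [hκN] at f2
    have f3 : 4 * S / R ^ 2 * A₁ * X₀ ≤ 4 * S / R ^ 2 * A₁ * 1 :=
      mul_le_mul_of_nonneg_left hα1 (by positivity)
    have f4 : 4 * (1 + A₁) * (S / R ^ 4) * (4 * R ^ 2) ≤ 4 * (1 + A₁) * (S / R ^ 4) * X₀ :=
      mul_le_mul_of_nonneg_left hα0 (by positivity)
    have f5 : 4 * (1 + A₁) * (S / R ^ 4) * (4 * R ^ 2) = 16 * (1 + A₁) * (S / R ^ 2) := by
      field_simp; ring
    have f6 : 2 * S / R ≤ 2 * (S / R ^ 2) := by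
      rw [mul_div_assoc]
      refine mul_le_mul_of_nonneg_left (div_le_div_of_nonneg_left hS.le (by positivity)
        (pow_le_of_le_one hR0.le (by linarith) (by norm_num))) (by norm_num)
    have f7 : 0 < S / R ^ 2 := by positivity
    have f8 : 4 * S / R ^ 2 * A₁ * 1 = 4 * A₁ * (S / R ^ 2) := by ring
    have f9 : 0 ≤ A₁ * (S / R ^ 2) := by positivity
    linarith

end Doubling

section Combinators

variable {d : ℕ} {κ α : ℝ} {l : Fin d} {F G : ℝ → (ℝ × Ed d → ℝ) → ℝ × Ed d → ℝ}

lemma Bd.scale_nonneg {r r' y S : ℝ} {u : ℝ × Ed d → ℝ} (hy : 1 ≤ y) (hρ : 1 ≤ y * (r' - r))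
    (hb : ∀ z ∈ Pr α l r', |u z| ≤ S) {z : ℝ × Ed d} (hz : z ∈ Pr α l r) : 0 ≤ S :=
  (abs_nonneg _).trans (hb z (Pr_mono (lt_of_one_le_mul hy hρ).le hz))

lemma bd_id : Bd κ α l (fun _ u z => u z) :=
  ⟨1, one_pos, 0, fun _ _ _ _ _ _ _ _ _ _ _ _ _ h6 h7 h8 z hz => by
    simpa using h8 z (Pr_mono (lt_of_one_le_mul h6 h7).le hz)⟩

lemma bd_zero : Bd κ α l (fun _ _ _ => 0) :=
  ⟨1, one_pos, 0, fun _ _ _ _ _ _ _ _ _ _ _ _ _ h6 h7 h8 z hz => by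
    simpa using Bd.scale_nonneg h6 h7 h8 hz⟩

lemma Bd.of_le (hG : Bd κ α l G) (h : ∀ (lam : ℝ) (c : ℝ → ℝ) (b : ℝ → Fin d → Ed d)
    (u : ℝ × Ed d → ℝ), 0 ≤ lam → Coef κ α c b → Sol κ α lam l c b u →
    ∀ r ≤ rtop α, ∀ z ∈ Pr α l r, |F lam u z| ≤ |G lam u z|) : Bd κ α l F := by
  obtain ⟨C, hC, K, hG⟩ := hG
  refine ⟨C, hC, K, ?_⟩
  intro lam c b u r r' y S h1 h2 h3 h4 h5 h6 h7 h8 z hz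
  exact (h lam c b u h1 h2 h3 r ((lt_of_one_le_mul h6 h7).le.trans h5) z hz).trans
    (hG lam c b u r r' y S h1 h2 h3 h4 h5 h6 h7 h8 z hz)

lemma Bd.add (hF : Bd κ α l F) (hG : Bd κ α l G) :
    Bd κ α l (fun lam u z => |F lam u z| + |G lam u z|) := by
  obtain ⟨C, hC, K, hF⟩ := hF
  obtain ⟨C', hC', K', hG⟩ := hG
  refine ⟨C + C', by positivity, max K K', ?_⟩
  intro lam c b u r r' y S h1 h2 h3 h4 h5 h6 h7 h8 z hz
  have hS := Bd.scale_nonneg h6 h7 h8 hz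
  have e1 := hF lam c b u r r' y S h1 h2 h3 h4 h5 h6 h7 h8 z hz
  have e2 := hG lam c b u r r' y S h1 h2 h3 h4 h5 h6 h7 h8 z hz
  have k1 : C * y ^ K * S ≤ C * y ^ max K K' * S := by
    have := pow_le_pow_right₀ h6 (le_max_left K K')
    gcongr
  have k2 : C' * y ^ K' * S ≤ C' * y ^ max K K' * S := by
    have := pow_le_pow_right₀ h6 (le_max_right K K')
    gcongr
  rw [abs_of_nonneg (by positivity)]
  linarith

lemma Bd.sum {ι : Type*} (s : Finset ι) {F : ι → ℝ → (ℝ × Ed d → ℝ) → ℝ × Ed d → ℝ}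
    (hF : ∀ i, Bd κ α l (F i)) : Bd κ α l (fun lam u z => ∑ i ∈ s, |F i lam u z|) := by
  classical
  induction s using Finset.induction_on with
  | empty => simpa using bd_zero
  | insert i s hi ih =>
    refine ((hF i).add ih).of_le fun lam c b u _ _ _ r _ z _ => ?_
    have h0 : 0 ≤ ∑ i ∈ s, |F i lam u z| := Finset.sum_nonneg fun i _ => abs_nonneg _
    rw [Finset.sum_insert hi, abs_of_nonneg h0]

lemma BdI.of_pos_upper (hodd : ∀ (lam : ℝ) (c : ℝ → ℝ) (b : ℝ → Fin d → Ed d) (u : ℝ × Ed d → ℝ),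
      Sol κ α lam l c b u → ∀ z ∈ Qop l, F lam (fun z => -u z) z = -F lam u z)
    (h : ∃ C : ℝ, 0 < C ∧ ∃ K : ℕ, ∀ (lam : ℝ) (c : ℝ → ℝ) (b : ℝ → Fin d → Ed d)
      (u : ℝ × Ed d → ℝ) (r r' y S : ℝ), 0 ≤ lam → Coef κ α c b → Sol κ α lam l c b u →
      0 ≤ r → r' ≤ rtop α → 1 ≤ y → 1 ≤ y * (r' - r) → 0 < S → (∀ z ∈ Pr α l r', |u z| ≤ S) →
      ∀ z ∈ Pr α l r, 1 ≤ y * z.2 l → F lam u z ≤ C * y ^ K * S) : BdI κ α l F := by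
  obtain ⟨C, hC, K, h⟩ := h
  refine ⟨C, hC, K, ?_⟩
  intro lam c b u r r' y S h1 h2 h3 h4 h5 h6 h7 h8 z hz hzl
  have hzQ := Pr_subset_Qop h5 (Pr_mono (lt_of_one_le_mul h6 h7).le hz)
  have hS : 0 ≤ S := Bd.scale_nonneg h6 h7 h8 hz
  have key : ∀ S' > S, |F lam u z| ≤ C * y ^ K * S' := by
    intro S' hS'
    have a1 := h lam c b u r r' y S' h1 h2 h3 h4 h5 h6 h7 (by linarith)
      (fun z hz => (h8 z hz).trans hS'.le) z hz hzl
    have a2 := h lam c b (fun z => -u z) r r' y S' h1 h2 h3.neg h4 h5 h6 h7 (by linarith)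
      (fun z hz => by rw [abs_neg]; exact (h8 z hz).trans hS'.le) z hz hzl
    rw [hodd lam c b u h3 z hzQ] at a2
    exact abs_le.2 ⟨by linarith, a1⟩
  have hlim : Tendsto (fun S' : ℝ => C * y ^ K * S') (𝓝[>] S) (𝓝 (C * y ^ K * S)) :=
    ((continuous_const.mul continuous_id).tendsto S).mono_left nhdsWithin_le_nhds
  exact ge_of_tendsto hlim (by filter_upwards [self_mem_nhdsWithin] with S' hS' using key S' hS')

lemma dv_neg {V z : ℝ × Ed d} {u : ℝ × Ed d → ℝ} (hu : ContDiffAt ℝ ∞ u z) :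
    dv V (fun z => -u z) z = -dv V u z := by
  simpa using dv_const_mul (V := V) (-1) hu

lemma bd_tangential (hκ : 0 < κ) (hα : 0 < α) (hα2 : α < 2) {j : Fin d} (hj : j ≠ l) :
    Bd κ α l (fun _ u => dv (0, ei j) u) := by
  refine bd_of_bdI hκ hα2 (Pres.dv (by simp [Ne.symm hj])) (BdI.of_pos_upper ?_
    (bdI_tangential hκ hα hα2 hj))
  exact fun lam c b u hu z hz => dv_neg (hu.smooth z (Qop_subset_Qcl l hz))

end Combinators

section NormalInterior

variable {d : ℕ} {κ α : ℝ} {l : Fin d}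

/-- Sum of the absolute values of the tangential second derivatives. -/
def hessT (l : Fin d) (u : ℝ × Ed d → ℝ) (z : ℝ × Ed d) : ℝ :=
  ∑ j, |(∑ k, |(if j ≠ l ∧ k ≠ l then dv (0, ei j) (dv (0, ei k) u) z else 0)|)|

lemma bd_hessT (hκ : 0 < κ) (hα : 0 < α) (hα2 : α < 2) : Bd κ α l (fun _ u => hessT l u) := by
  refine Bd.sum _ fun j => Bd.sum _ fun k => ?_
  by_cases h : j ≠ l ∧ k ≠ l
  · simp only [if_pos h]
    exact (bd_tangential hκ hα hα2 h.1).comp (bd_tangential hκ hα hα2 h.2)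
      (Pres.dv (by simp [Ne.symm h.2]))
  · simp only [if_neg h]
    exact bd_zero

lemma abs_d2_le_hessT {u : ℝ × Ed d → ℝ} {z : ℝ × Ed d} (hu : ContDiffAt ℝ ∞ u z) {v : Ed d}
    (hv : v l = 0) : |d2 v u z| ≤ hessT l u z * ‖v‖ ^ 2 := by
  have hsum : v = ∑ j, v j • ei j := by
    ext i
    simp [Pi.single_apply]
  have e : d2 v u z = ∑ j, ∑ k, v j * v k * dv (0, ei j) (dv (0, ei k) u) z := by
    rw [d2, ← D2u_apply hu]
    conv_lhs => rw [hsum]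
    simp only [map_sum, sum_apply, map_smul, smul_apply, smul_eq_mul, D2u_apply hu,
      Finset.mul_sum]
    rw [Finset.sum_comm]
    simp only [mul_assoc, mul_left_comm]
  rw [e, hessT, Finset.sum_mul]
  refine (Finset.abs_sum_le_sum_abs _ _).trans (Finset.sum_le_sum fun j _ => ?_)
  refine le_trans ?_ (mul_le_mul_of_nonneg_right (le_abs_self _) (sq_nonneg _))
  rw [Finset.sum_mul]
  refine (Finset.abs_sum_le_sum_abs _ _).trans (Finset.sum_le_sum fun k _ => ?_)
  rw [abs_mul, abs_mul, mul_comm]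
  by_cases h : j ≠ l ∧ k ≠ l
  · rw [if_pos h]
    refine mul_le_mul_of_nonneg_left ?_ (abs_nonneg _)
    rw [sq]
    exact mul_le_mul (abs_coord_le v j) (abs_coord_le v k) (abs_nonneg _) (norm_nonneg _)
  · rw [if_neg h]
    have : |v j| * |v k| = 0 := by
      by_cases hj : j = l
      · subst hj; simp [hv]
      · have hk : k = l := by tauto
        subst hk; simp [hv]
    rw [this]; simp

lemma norm_sub_coord_le (v : Ed d) : ‖v - v l • ei l‖ ≤ ‖v‖ := by
  rw [EuclideanSpace.norm_eq, EuclideanSpace.norm_eq]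
  refine Real.sqrt_le_sqrt (Finset.sum_le_sum fun i _ => ?_)
  by_cases h : i = l
  · subst h
    simp [sq_nonneg]
  · simp [h]

set_option maxHeartbeats 1600000 in
lemma bdI_normal (hκ : 0 < κ) (hα : 0 < α) (hα2 : α < 2) :
    BdI κ α l (fun _ u => dv (0, ei l) u) := by
  set A₁ : ℝ := κ⁻¹ + d * κ with hA₁
  have hA₁0 : 0 < A₁ := by positivity
  set N : ℝ := (1 + A₁ + κ⁻¹) / κ with hN
  have hN0 : 0 < N := by positivity
  have hκN : κ * N = 1 + A₁ + κ⁻¹ := by rw [hN]; field_simp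
  obtain ⟨C, hC, K, hH⟩ := (bd_id (κ := κ) (α := α) (l := l)).add
    ((bd_lam_mul hκ hα.le).add (bd_hessT hκ hα hα2))
  refine BdI.of_pos_upper (fun lam c b u hu z hz => dv_neg (hu.smooth z (Qop_subset_Qcl l hz)))
    ⟨512 * (2 + N) * (C * 2 ^ K), by positivity, K + 3, ?_⟩
  intro lam c b u r r' y S hlam hc hu hr hr' hy hρ hS hb z₀ hz₀ hzl
  have hy0 : 0 < y := by linarith
  obtain ⟨m1, m2⟩ := midpoint_scale hρ
  set rm := (r + r') / 2 with hrm
  have hlt := lt_of_one_le_mul hy hρ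
  set H : ℝ := C * (2 * y) ^ K * S with hHdef
  have hH0 : 0 < H := by positivity
  have hHb : ∀ z ∈ Pr α l rm, |u z| ≤ H ∧ |lam * u z| ≤ H ∧ |hessT l u z| ≤ H := by
    intro z hz
    have := hH lam c b u rm r' (2 * y) S hlam hc hu (by linarith) hr' (by linarith) m2 hb z hz
    simp only at this
    have h1 := abs_nonneg (u z)
    have h2 := abs_nonneg (lam * u z)
    have h3 := abs_nonneg (hessT l u z)
    rw [abs_of_nonneg (a := |lam * u z| + |hessT l u z|) (by linarith),
      abs_of_nonneg (by linarith)] at this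
    exact ⟨by linarith, by linarith, by linarith⟩
  have hi : 0 < (2 * y)⁻¹ := by positivity
  have hi1 : (2 * y)⁻¹ ≤ 1 := inv_le_one_of_one_le₀ (by linarith)
  set R : ℝ := (2 * y)⁻¹ / 4 with hR
  have hR0 : 0 < R := by positivity
  have hR1 : R ≤ 1 / 4 := by linarith
  have hrm' : rm ≤ rtop α := by linarith
  have hmain := hu.deriv_le_of_doubling (j := l) (H := H) (B := N * H / R ^ 4) hH0.le
    (by positivity) hrm' (y := 2 * y) (by linarith) m1 (fun z hz => (hHb z hz).1) hz₀
    (by linarith) hR ?_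
  · refine hmain.trans ?_
    have e1 : 2 * H / R ≤ 2 * H / R ^ 3 :=
      div_le_div_of_nonneg_left (by positivity) (by positivity)
        (pow_le_of_le_one hR0.le (by linarith) (by norm_num))
    have e2 : N * H / R ^ 4 * R = N * H / R ^ 3 := by field_simp
    have e3 : 512 * (2 + N) * (C * 2 ^ K) * y ^ (K + 3) * S = 2 * H / R ^ 3 + N * H / R ^ 3 := by
      rw [hR, hHdef, pow_add, mul_pow]; field_simp; ring
    linarith
  · intro t x h n1 n2 h0 hxl hlt2 htime hspace
    set X := x + h • ei l with hX
    have hXl : X l = x l + h := by simp [hX]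
    have hXl' : 2 * R ≤ X l := by linarith
    have s1 := hu.smooth _ (Qop_subset_Qcl l (Pr_subset_Qop hrm' n1))
    have s2 := hu.smooth _ (Qop_subset_Qcl l (Pr_subset_Qop hrm' n2))
    have q1 := hu.eq _ (Pr_subset_Qop hrm' n1)
    have q2 := hu.eq _ (Pr_subset_Qop hrm' n2)
    have hx1 := Pr_coord_lt_one hrm' n1
    have hX1 := Pr_coord_lt_one hrm' n2
    have hx0 : 0 < x l := by linarith
    have hX0 : 0 < X l := by linarith
    simp only at q1 q2 hx1 hX1
    set D : ℝ := 5 * H / R ^ 2 with hD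
    have hR2 : R ^ 2 ≤ 1 := pow_le_one₀ hR0.le (by linarith)
    have hHR : H ≤ H / R ^ 2 := le_div_self hH0.le (by positivity) hR2
    have hDH : 4 * H / R ^ 2 + H ≤ D := by
      have : 5 * H / R ^ 2 = 4 * H / R ^ 2 + H / R ^ 2 := by ring
      rw [hD, this]; linarith
    have hD0 : 0 ≤ D := by positivity
    have hB : ∀ v : Ed d, d2 v u (t, X) ≤ D * ‖v‖ ^ 2 - 2 * (N * H / R ^ 4) * (v l) ^ 2 := by
      intro v
      have a := hspace (v - v l • ei l) (v l)
      rw [sub_add_cancel] at a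
      have hv0 : (v - v l • ei l) l = 0 := by simp
      have a2 := (le_abs_self _).trans (abs_d2_le_hessT s1 hv0)
      have a3 : ‖v - v l • ei l‖ ^ 2 ≤ ‖v‖ ^ 2 := by
        have := norm_sub_coord_le (l := l) v
        gcongr
      have a4 := (le_abs_self _).trans (hHb _ n1).2.2
      have a5 : hessT l u (t, x) * ‖v - v l • ei l‖ ^ 2 ≤ H * ‖v - v l • ei l‖ ^ 2 := by gcongr
      have a6 : (4 * H / R ^ 2 + H) * ‖v - v l • ei l‖ ^ 2 ≤ D * ‖v‖ ^ 2 := by gcongr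
      linarith
    have hb' : ∀ v : Ed d, -d2 v u (t, x) ≤ D * ‖v‖ ^ 2 - 2 * (N * H / R ^ 4) * (v l) ^ 2 := by
      intro v
      have a := hspace v (-v l)
      have hv : v + -v l • ei l = v - v l • ei l := by rw [neg_smul, ← sub_eq_add_neg]
      rw [hv] at a
      have hv0 : (v - v l • ei l) l = 0 := by simp
      have a2 := (neg_le_abs _).trans (abs_d2_le_hessT s2 hv0)
      have a3 : ‖v - v l • ei l‖ ^ 2 ≤ ‖v‖ ^ 2 := by
        have := norm_sub_coord_le (l := l) v
        gcongr
      have a4 := (le_abs_self _).trans (hHb _ n2).2.2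
      have a5 : hessT l u (t, X) * ‖v - v l • ei l‖ ^ 2 ≤ H * ‖v‖ ^ 2 := by gcongr
      have a6 : (4 * H / R ^ 2 + H) * ‖v‖ ^ 2 ≤ D * ‖v‖ ^ 2 := by gcongr
      rw [neg_sq] at a
      linarith
    have hsum : ∀ (s : ℝ) (f : Ed d → ℝ), 2 * R ≤ s → s < 1 →
        (∀ v : Ed d, f v ≤ D * ‖v‖ ^ 2 - 2 * (N * H / R ^ 4) * (v l) ^ 2) →
        ∑ k, f (b s k) + κ * s ^ α * ∑ i, f (ei i) ≤ D * A₁ - 8 * (κ * N) * (H / R ^ 2) := by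
      intro s f hs hs1 hf
      have hs0 : 0 < s := by linarith
      have b1 : ∑ k, f (b s k) ≤ D * κ⁻¹ * s ^ α := by
        have := hc.sum_le hs0 hs1 (R := D / 2) (by positivity)
        have e : 2 * (D / 2) = D := by ring
        rw [e] at this
        refine (Finset.sum_le_sum fun k _ => (hf _).trans ?_).trans this
        have : 0 ≤ 2 * (N * H / R ^ 4) * (b s k l) ^ 2 := by positivity
        linarith
      have b2 : ∑ i, f (ei i) ≤ D * d - 2 * (N * H / R ^ 4) := by
        have : ∀ i, f (ei i) ≤ D + (if i = l then -(2 * (N * H / R ^ 4)) else 0) := by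
          intro i
          have := hf (ei i)
          by_cases h : i = l
          · subst h; simp at this; simpa [sub_eq_add_neg] using this
          · simpa [h, PiLp.single_apply, Ne.symm h] using this
        refine (Finset.sum_le_sum fun i _ => this i).trans (le_of_eq ?_)
        rw [Finset.sum_add_distrib]
        simp
        ring
      have hα0 : 4 * R ^ 2 ≤ s ^ α := by
        have a1 : (2 * R) ^ (2 : ℝ) ≤ (2 * R) ^ α :=
          Real.rpow_le_rpow_of_exponent_ge (by linarith) (by linarith) hα2.le
        have a2 := Real.rpow_le_rpow (by linarith) hs hα.le
        rw [Real.rpow_two] at a1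
        nlinarith
      have hα1 : s ^ α ≤ 1 := Real.rpow_le_one hs0.le hs1.le hα.le
      set X₀ := s ^ α with hX₀
      have hX0 : 0 < X₀ := lt_of_lt_of_le (by positivity) hα0
      have f1 : κ * X₀ * ∑ i, f (ei i) ≤ κ * X₀ * (D * d - 2 * (N * H / R ^ 4)) :=
        mul_le_mul_of_nonneg_left b2 (by positivity)
      have f2 : D * κ⁻¹ * X₀ + κ * X₀ * (D * d - 2 * (N * H / R ^ 4)) =
          D * A₁ * X₀ - 2 * (κ * N) * (H / R ^ 4) * X₀ := by
        rw [hA₁]; ring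
      have f3 : D * A₁ * X₀ ≤ D * A₁ * 1 := mul_le_mul_of_nonneg_left hα1 (by positivity)
      have f4 : 2 * (κ * N) * (H / R ^ 4) * (4 * R ^ 2) ≤ 2 * (κ * N) * (H / R ^ 4) * X₀ :=
        mul_le_mul_of_nonneg_left hα0 (by positivity)
      have f5 : 2 * (κ * N) * (H / R ^ 4) * (4 * R ^ 2) = 8 * (κ * N) * (H / R ^ 2) := by
        field_simp; ring
      linarith
    have g1 := hsum (X l) (fun v => d2 v u (t, X)) hXl' hX1 hB
    have g2 := hsum (x l) (fun v => -d2 v u (t, x)) hxl hx1 hb'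
    simp only [Finset.sum_neg_distrib, mul_neg] at g1 g2
    have hcu : ∀ s z, 0 < s → s < 1 → |lam * u z| ≤ H → |lam * c s * u z| ≤ κ⁻¹ * H := by
      intro s z hs hs1 hz
      have e : lam * c s * u z = c s * (lam * u z) := by ring
      have k1 := hc.c_lower s hs hs1
      have k2 := hc.c_upper s hs hs1
      rw [e, abs_mul, abs_of_nonneg (a := c s) (by linarith)]
      exact mul_le_mul k2 hz (abs_nonneg _) (by positivity)
    have k1 := abs_le.1 (hcu (x l) _ hx0 hx1 (hHb _ n1).2.1)
    have k2 := abs_le.1 (hcu (X l) _ hX0 hX1 (hHb _ n2).2.1)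
    have f6 : 2 * H / R ≤ 2 * (H / R ^ 2) := by
      rw [mul_div_assoc]
      refine mul_le_mul_of_nonneg_left (div_le_div_of_nonneg_left hH0.le (by positivity)
        (pow_le_of_le_one hR0.le (by linarith) (by norm_num))) (by norm_num)
    have f7 : 0 < H / R ^ 2 := by positivity
    have f8 : κ⁻¹ * H ≤ κ⁻¹ * (H / R ^ 2) := by gcongr
    have f9 : D * A₁ = 5 * A₁ * (H / R ^ 2) := by rw [hD]; ring
    have f10 : 8 * (κ * N) * (H / R ^ 2) =
      8 * (H / R ^ 2) + 8 * (A₁ * (H / R ^ 2)) + 8 * (κ⁻¹ * (H / R ^ 2)) := by rw [hκN]; ring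
    have f11 : 0 ≤ A₁ * (H / R ^ 2) := by positivity
    have f12 : 0 ≤ κ⁻¹ * (H / R ^ 2) := by positivity
    linarith [k1.1, k1.2, k2.1, k2.2]

end NormalInterior

section TimeDerivative

variable {d : ℕ} {κ α lam : ℝ} {l : Fin d} {c : ℝ → ℝ} {b : ℝ → Fin d → Ed d}
  {u : ℝ × Ed d → ℝ}

lemma eq_sum_coord_smul (v : Ed d) : v = ∑ j, v j • ei j := by
  ext i
  simp [Pi.single_apply]

lemma abs_dv_space_le {f : ℝ × Ed d → ℝ} {z : ℝ × Ed d} (V : Ed d) :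
    |dv (0, V) f z| ≤ (∑ i, |dv (0, ei i) f z|) * ‖V‖ := by
  have e : dv (0, V) f z = ∑ i, V i * dv (0, ei i) f z := by
    simp only [dv]
    have : ((0 : ℝ), V) = ContinuousLinearMap.inr ℝ ℝ (Ed d) V := rfl
    rw [this]
    conv_lhs => rw [eq_sum_coord_smul V]
    simp only [map_sum, map_smul, smul_eq_mul]
    rfl
  rw [e, Finset.sum_mul]
  refine (Finset.abs_sum_le_sum_abs _ _).trans (Finset.sum_le_sum fun i _ => ?_)
  rw [abs_mul, mul_comm]
  exact mul_le_mul_of_nonneg_left (abs_coord_le V i) (abs_nonneg _)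

lemma abs_increment_le {f : ℝ × Ed d → ℝ} {z V : ℝ × Ed d} {M : ℝ}
    (hf : ∀ s ∈ Icc (0 : ℝ) 1, DifferentiableAt ℝ f (z + s • V))
    (hM : ∀ s ∈ Ioo (0 : ℝ) 1, |dv V f (z + s • V)| ≤ M) : |f (z + V) - f z| ≤ M := by
  have hd : ∀ s ∈ Icc (0 : ℝ) 1, HasDerivAt (fun s : ℝ => f (z + s • V)) (dv V f (z + s • V)) s :=
    fun s hs => hasDerivAt_line (hf s hs)
  obtain ⟨s, hs, h⟩ := exists_hasDerivAt_eq_slope (fun s : ℝ => f (z + s • V))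
    (fun s => dv V f (z + s • V)) one_pos (fun s hs => (hd s hs).continuousAt.continuousWithinAt)
    fun s hs => hd s ⟨hs.1.le, hs.2.le⟩
  have := hM s hs
  rw [h] at this
  simpa using this

lemma BdI.sum {ι : Type*} [Fintype ι] {F : ι → ℝ → (ℝ × Ed d → ℝ) → ℝ × Ed d → ℝ}
    (hF : ∀ i, BdI κ α l (F i)) : BdI κ α l (fun lam u z => ∑ i, |F i lam u z|) := by
  choose C hC K hF using hF
  have hC0 : 0 ≤ ∑ i, C i := Finset.sum_nonneg fun i _ => (hC i).le
  refine ⟨1 + ∑ i, C i, by linarith, ∑ i, K i, ?_⟩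
  intro lam c b u r r' y S h1 h2 h3 h4 h5 h6 h7 h8 z hz hzl
  have hS := Bd.scale_nonneg h6 h7 h8 hz
  simp only
  rw [abs_of_nonneg (Finset.sum_nonneg fun i _ => abs_nonneg _)]
  have : ∀ i, |F i lam u z| ≤ C i * (y ^ ∑ i, K i) * S := by
    intro i
    refine (hF i lam c b u r r' y S h1 h2 h3 h4 h5 h6 h7 h8 z hz hzl).trans ?_
    have k1 := pow_le_pow_right₀ h6 (Finset.single_le_sum (f := K) (fun _ _ => Nat.zero_le _)
      (Finset.mem_univ i))
    have := hC i
    gcongr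
  refine (Finset.sum_le_sum fun i _ => this i).trans ?_
  rw [← Finset.sum_mul, ← Finset.sum_mul]
  have : 0 ≤ y ^ (∑ i, K i) * S := by positivity
  linarith

lemma bdI_grad (hκ : 0 < κ) (hα : 0 < α) (hα2 : α < 2) :
    BdI κ α l (fun _ u z => ∑ i, |dv (0, ei i) u z|) := by
  refine BdI.sum fun i => ?_
  by_cases h : i = l
  · subst h; exact bdI_normal hκ hα hα2
  · exact (bd_tangential hκ hα hα2 h).bdI

lemma Sol.time_increment_le (hu : Sol κ α lam l c b u) (hc : Coef κ α c b) (hκ : 0 < κ)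
    (hα : 0 < α) {t₁ t₀ ρ M Λ E : ℝ} {x₀ : Ed d} (ht : t₁ ≤ t₀) (hρ : 0 < ρ) (hM : 0 < M)
    (hmem : ∀ t ∈ Icc t₁ t₀, ∀ x : Ed d, ‖x - x₀‖ ≤ ρ → (t, x) ∈ Qop l)
    (hb : ∀ t ∈ Icc t₁ t₀, ∀ x : Ed d, ‖x - x₀‖ ≤ ρ → |u (t, x)| ≤ M)
    (hΛ : ∀ t ∈ Icc t₁ t₀, ∀ x : Ed d, ‖x - x₀‖ ≤ ρ → |lam * u (t, x)| ≤ Λ)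
    (hE : ∀ x : Ed d, ‖x - x₀‖ ≤ ρ → |u (t₁, x) - u (t₁, x₀)| ≤ E) :
    u (t₀, x₀) - u (t₁, x₀) ≤ E + (4 * M / ρ ^ 2 * (κ⁻¹ + d * κ) + κ⁻¹ * Λ) * (t₀ - t₁) := by
  have hx₀ : ‖x₀ - x₀‖ ≤ ρ := by simpa using hρ.le
  have hE0 : 0 ≤ E := (abs_nonneg _).trans (hE x₀ hx₀)
  have hA : 0 < κ⁻¹ + d * κ := by positivity
  have hΛ0 : 0 ≤ Λ := (abs_nonneg _).trans (hΛ t₁ ⟨le_rfl, ht⟩ x₀ hx₀)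
  set Q := 4 * M / ρ ^ 2 * (κ⁻¹ + d * κ) + κ⁻¹ * Λ with hQ
  have hQ0 : 0 ≤ Q := by positivity
  have hmain := hu.le_barrier hc hκ (t₁ := t₁) (t₀ := t₀) (ρ := ρ) (a := x₀ l - ρ) (e := x₀ l + ρ)
    (P := 0) (Q := Q) (R := 2 * M / ρ ^ 2) (Λ := κ⁻¹ * Λ) (m := u (t₁, x₀)) (x₀ := x₀)
    (G := fun _ => E) (G' := fun _ => 0) (G₂ := fun _ => 0) (by positivity)
    (fun t ht x hx _ _ => Qop_subset_Qcl l (hmem t ht x hx))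
    (fun t ht x hx _ _ => hmem t ⟨ht.1.le, ht.2⟩ x hx.le)
    (fun s _ => hasDerivAt_const s _) (fun s _ => hasDerivAt_const s _)
    continuousOn_const (fun _ _ => le_rfl) ?_ ?_ ?_ ?_ t₀ ⟨ht, le_rfl⟩ x₀ hx₀
    (by linarith) (by linarith)
  · simp only [sub_self, norm_zero] at hmain
    linarith
  · intro x hx _ _
    have := (le_abs_self _).trans (hE x hx)
    have h3 : 0 ≤ 2 * M / ρ ^ 2 * ‖x - x₀‖ ^ 2 := by positivity
    linarith
  · intro t ht x hx h1 h2 h3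
    have hxρ : ‖x - x₀‖ = ρ := by
      rcases h3 with h3 | h3 | h3
      · exact h3
      · refine le_antisymm hx ?_
        have := (neg_le_abs _).trans (abs_coord_le (x - x₀) l)
        simp only [PiLp.sub_apply] at this
        linarith
      · refine le_antisymm hx ?_
        have := (le_abs_self _).trans (abs_coord_le (x - x₀) l)
        simp only [PiLp.sub_apply] at this
        linarith
    have a1 := (le_abs_self _).trans (hb t ht x hx)
    have a2 := (neg_le_abs _).trans (hb t₁ ⟨le_rfl, by linarith⟩ x₀ hx₀)
    have a3 : 2 * M / ρ ^ 2 * ‖x - x₀‖ ^ 2 = 2 * M := by rw [hxρ]; field_simp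
    have a4 : 0 ≤ Q * (t - t₁) := mul_nonneg hQ0 (by linarith [ht.1])
    linarith
  · intro t ht x hx _ _ _
    have hq := hmem t ⟨ht.1.le, ht.2⟩ x hx.le
    have hl := hΛ t ⟨ht.1.le, ht.2⟩ x hx.le
    have hx1 : x l < 1 := ((le_abs_self _).trans (abs_coord_le x l)).trans_lt hq.2.2.1
    have k1 := hc.c_lower _ hq.2.2.2 hx1
    have k2 := hc.c_upper _ hq.2.2.2 hx1
    simp only at k1 k2
    have e : lam * c (x l) * u (t, x) = c (x l) * (lam * u (t, x)) := by ring
    have : |lam * c (x l) * u (t, x)| ≤ κ⁻¹ * Λ := by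
      rw [e, abs_mul, abs_of_nonneg (a := c (x l)) (by linarith)]
      exact mul_le_mul k2 hl (abs_nonneg _) (by positivity)
    exact (abs_le.1 this).1
  · intro s hs hs1
    have hs0 : 0 < s := by
      have hq := hmem t₁ ⟨le_rfl, by linarith⟩ (x₀ - ρ • ei l) (by
        rw [_root_.sub_sub_cancel_left, norm_neg, norm_smul]; simp [ei, abs_of_pos hρ])
      have := hq.2.2.2
      simp at this
      linarith [hs.1]
    have h1 : s ^ α < 1 := Real.rpow_lt_one hs0.le hs1 hα
    have h2 : 0 < 4 * M / ρ ^ 2 * (κ⁻¹ + d * κ) := by positivity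
    have h3 : 2 * (2 * M / ρ ^ 2) * (κ⁻¹ + d * κ) * s ^ α =
      4 * M / ρ ^ 2 * (κ⁻¹ + d * κ) * s ^ α := by ring
    rw [h3]
    nlinarith

set_option maxHeartbeats 800000 in
lemma bd_time (hκ : 0 < κ) (hα : 0 < α) (hα2 : α < 2) : Bd κ α l (fun _ u => dv (1, 0) u) := by
  obtain ⟨C₁, hC₁, K₁, hG⟩ := bdI_grad (d := d) (l := l) hκ hα hα2
  obtain ⟨C₂, hC₂, K₂, hL⟩ := bd_lam_mul (d := d) (l := l) hκ hα.le
  set A₁ : ℝ := κ⁻¹ + d * κ with hA₁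
  have hA₁0 : 0 < A₁ := by positivity
  set E' : ℝ := 256 * A₁ * (1 + C₁) ^ 2 + κ⁻¹ * C₂ + 1 with hE'
  have hE'0 : 0 < E' := by positivity
  set n := 2 * (K₁ + 1) + K₂ with hn
  have hP : Pres κ α l (fun _ u => dv ((1 : ℝ), (0 : Ed d)) u) := Pres.dv (by simp)
  refine bd_of_interior hκ hα2 hP ⟨16 * E' * 2 ^ n, by positivity, n, ?_⟩
  intro lam c b u r r' y S M hlam hc hu hr hr' hy hρ hb hM z₀ hz₀ hzl
  set v := dv ((1 : ℝ), (0 : Ed d)) u with hv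
  have hvs : Sol κ α lam l c b v := hP _ _ _ _ hu
  have hS := Bd.scale_nonneg hy hρ hb hz₀
  have hM0 := Bd.scale_nonneg hy hρ hM hz₀
  have hz₀' := Pr_mono (lt_of_one_le_mul hy hρ).le hz₀
  rcases hM0.eq_or_lt with hM1 | hM1
  · have := hM z₀ hz₀'
    rw [← hM1] at this
    refine this.trans ?_
    positivity
  obtain ⟨m1, m2⟩ := midpoint_scale hρ
  set rm := (r + r') / 2 with hrm
  have hlt := lt_of_one_le_mul hy hρ
  have hrm' : rm ≤ rtop α := by linarith
  have hy0 : 0 < y := by linarith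
  set Y := 2 * y with hY
  have hY1 : 1 ≤ Y := by linarith
  have hYK : 1 ≤ Y ^ K₁ := one_le_pow₀ hY1
  have hgrad : ∀ z ∈ Pr α l rm, 1 ≤ Y * z.2 l → ∑ i, |dv (0, ei i) v z| ≤ C₁ * Y ^ K₁ * M :=
    fun z hz hl => (le_abs_self _).trans (hG lam c b v rm r' Y M hlam hc hvs (by linarith) hr' hY1
      m2 hM z hz hl)
  have hlamv : ∀ z ∈ Pr α l rm, |lam * v z| ≤ C₂ * Y ^ K₂ * M :=
    hL lam c b v rm r' Y M hlam hc hvs (by linarith) hr' hY1 m2 hM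
  set D : ℝ := 8 * (1 + C₁) * Y ^ (K₁ + 1) with hD
  have hD0 : 0 < D := by positivity
  have hDY : 8 * Y ≤ D := by
    have q1 : Y ≤ Y ^ (K₁ + 1) := le_self_pow₀ hY1 (by omega)
    have q2 : 0 ≤ C₁ * Y ^ (K₁ + 1) := by positivity
    have q3 : D = 8 * Y ^ (K₁ + 1) + 8 * (C₁ * Y ^ (K₁ + 1)) := by rw [hD]; ring
    rw [q3]
    linarith
  set ρ := D⁻¹ with hρdef
  have hρ0 : 0 < ρ := by positivity
  have hYi : 0 < Y⁻¹ := by positivity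
  have hρY : ρ ≤ Y⁻¹ / 8 := by
    have : ρ ≤ (8 * Y)⁻¹ := inv_anti₀ (by positivity) hDY
    rw [mul_inv] at this
    linarith
  set E := 4 / ρ ^ 2 * A₁ + κ⁻¹ * (C₂ * Y ^ K₂) with hE
  have hE0 : 0 < E := by positivity
  set σ := (8 * (E + Y))⁻¹ with hσ
  have hσ0 : 0 < σ := by positivity
  have hσY : σ ≤ Y⁻¹ := inv_anti₀ (by positivity) (by linarith)
  have hEσ : E * σ ≤ 1 / 8 := by
    rw [hσ, ← div_eq_mul_inv, div_le_iff₀ (by positivity)]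
    linarith
  have hzl' : 2 * Y⁻¹ ≤ z₀.2 l := by
    rw [hY, mul_inv, ← mul_assoc, mul_inv_cancel₀ two_ne_zero, one_mul, inv_le_iff_one_le_mul₀ hy0]
    linarith
  have hxl : ∀ x : Ed d, ‖x - z₀.2‖ ≤ ρ → Y⁻¹ ≤ x l := by
    intro x hx
    have := (neg_le_abs _).trans (abs_coord_le (x - z₀.2) l)
    simp only [PiLp.sub_apply] at this
    linarith
  have hmem : ∀ t ∈ Icc (z₀.1 - σ) z₀.1, ∀ x : Ed d, ‖x - z₀.2‖ ≤ ρ → (t, x) ∈ Pr α l rm := by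
    intro t ht x hx
    exact mem_Pr_of_near hY1 m1 hz₀ (by linarith [ht.1]) ht.2 (by linarith)
      (by linarith [hxl x hx])
  have hdiff : ∀ z ∈ Pr α l rm, ContDiffAt ℝ ∞ u z := fun z hz =>
    hu.smooth z (Qop_subset_Qcl l (Pr_subset_Qop hrm' hz))
  have hdiffv : ∀ z ∈ Pr α l rm, DifferentiableAt ℝ v z := fun z hz =>
    (hvs.smooth z (Qop_subset_Qcl l (Pr_subset_Qop hrm' hz))).differentiableAt_top
  have hrmr : Pr α l rm ⊆ Pr α l r' := Pr_mono (by linarith)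
  have hz00 : ‖z₀.2 - z₀.2‖ ≤ ρ := by simpa using hρ0.le
  obtain ⟨t₁, ht₁, hslope⟩ := exists_hasDerivAt_eq_slope (fun t => u (t, z₀.2))
    (fun t => v (t, z₀.2)) (a := z₀.1 - σ) (b := z₀.1) (by linarith)
    (fun t ht => (hasDerivAt_time (hdiff _ (hmem t ht _ hz00)).differentiableAt_top).continuousAt.continuousWithinAt)
    (fun t ht => hasDerivAt_time (hdiff _ (hmem t ⟨ht.1.le, ht.2.le⟩ _ hz00)).differentiableAt_top)
  have hv1 : |v (t₁, z₀.2)| ≤ 2 * S / σ := by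
    rw [hslope, show z₀.1 - (z₀.1 - σ) = σ by ring, abs_div, abs_of_pos hσ0]
    have a1 := hb _ (hrmr (hmem z₀.1 ⟨by linarith, le_rfl⟩ _ hz00))
    have a2 := hb _ (hrmr (hmem (z₀.1 - σ) ⟨le_rfl, by linarith⟩ _ hz00))
    have a3 := abs_sub (u (z₀.1, z₀.2)) (u (z₀.1 - σ, z₀.2))
    gcongr
    linarith
  have hsub : ∀ t ∈ Icc t₁ z₀.1, t ∈ Icc (z₀.1 - σ) z₀.1 := fun t ht => ⟨by linarith [ht.1, ht₁.1], ht.2⟩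
  have hinc : ∀ x : Ed d, ‖x - z₀.2‖ ≤ ρ → |v (t₁, x) - v (t₁, z₀.2)| ≤ M / 8 := by
    intro x hx
    have hpt : ∀ s : ℝ, (t₁, z₀.2) + s • ((0 : ℝ), x - z₀.2) = (t₁, z₀.2 + s • (x - z₀.2)) := by
      intro s; ext1 <;> simp
    have hn : ∀ s ∈ Icc (0 : ℝ) 1, ‖z₀.2 + s • (x - z₀.2) - z₀.2‖ ≤ ρ := by
      intro s hs
      rw [add_sub_cancel_left, norm_smul, Real.norm_eq_abs, abs_of_nonneg hs.1]
      exact (mul_le_of_le_one_left (norm_nonneg _) hs.2).trans hx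
    have hms : ∀ s ∈ Icc (0 : ℝ) 1, (t₁, z₀.2 + s • (x - z₀.2)) ∈ Pr α l rm := fun s hs =>
      hmem t₁ ⟨ht₁.1.le, ht₁.2.le⟩ _ (hn s hs)
    have := abs_increment_le (f := v) (z := (t₁, z₀.2)) (V := ((0 : ℝ), x - z₀.2)) (M := M / 8)
      (fun s hs => by rw [hpt]; exact hdiffv _ (hms s hs)) ?_
    · simpa using this
    · intro s hs
      have hs' : s ∈ Icc (0 : ℝ) 1 := ⟨hs.1.le, hs.2.le⟩
      rw [hpt]
      refine (abs_dv_space_le _).trans ?_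
      have h1 := hgrad _ (hms s hs') (by
        have := hxl _ (hn s hs')
        rw [inv_le_iff_one_le_mul₀ (by linarith)] at this
        simp only
        linarith)
      have h2 : C₁ * Y ^ K₁ * M * ρ ≤ M / 8 := by
        rw [hρdef, ← div_eq_mul_inv, div_le_div_iff₀ hD0 (by norm_num), hD, pow_succ]
        have k1 : 0 ≤ Y ^ K₁ * M := by positivity
        have k2 : C₁ * (Y ^ K₁ * M) ≤ C₁ * (Y ^ K₁ * M) * Y :=
          le_mul_of_one_le_right (by positivity) hY1
        have k3 : 0 ≤ Y ^ K₁ * M * Y := by positivity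
        nlinarith
      refine le_trans (mul_le_mul h1 hx (norm_nonneg _) (by positivity)) h2
  have hcond : ∀ w : ℝ × Ed d → ℝ, Sol κ α lam l c b w → (∀ z, |w z| = |v z|) →
      (∀ z z', |w z - w z'| = |v z - v z'|) →
      w (z₀.1, z₀.2) - w (t₁, z₀.2) ≤ M / 8 + M / 8 := by
    intro w hw hwv hwd
    have := hw.time_increment_le hc hκ hα (t₁ := t₁) (t₀ := z₀.1) (x₀ := z₀.2) (M := M)
      (Λ := C₂ * Y ^ K₂ * M) (E := M / 8) ht₁.2.le hρ0 hM1
      (fun t ht x hx => Pr_subset_Qop hrm' (hmem t (hsub t ht) x hx))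
      (fun t ht x hx => by rw [hwv]; exact hM _ (hrmr (hmem t (hsub t ht) x hx)))
      (fun t ht x hx => by
        rw [abs_mul, hwv, ← abs_mul]; exact hlamv _ (hmem t (hsub t ht) x hx))
      (fun x hx => by rw [hwd]; exact hinc x hx)
    have e : 4 * M / ρ ^ 2 * (κ⁻¹ + d * κ) + κ⁻¹ * (C₂ * Y ^ K₂ * M) = E * M := by
      rw [hE, hA₁]; ring
    rw [e] at this
    have h2 : E * M * (z₀.1 - t₁) ≤ E * M * σ :=
      mul_le_mul_of_nonneg_left (by linarith [ht₁.1]) (by positivity)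
    have h3 : E * M * σ ≤ M / 8 := by
      have := mul_le_mul_of_nonneg_right hEσ hM1.le
      linarith
    linarith
  have c1 := hcond v hvs (fun _ => rfl) (fun _ _ => rfl)
  have c2 := hcond (fun z => -v z) hvs.neg (fun _ => abs_neg _) (fun z z' => by
    rw [← abs_neg]; congr 1; ring)
  have hfin : 2 * S / σ ≤ 16 * E' * 2 ^ n * y ^ n * S := by
    have e1 : 2 * S / σ = 16 * (E + Y) * S := by rw [hσ]; field_simp; ring
    have e2 : 16 * E' * 2 ^ n * y ^ n * S = 16 * (E' * Y ^ n) * S := by rw [hY, mul_pow]; ring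
    rw [e1, e2]
    have k1 : E + Y ≤ E' * Y ^ n := by
      have j1 : Y ^ (2 * (K₁ + 1)) ≤ Y ^ n := pow_le_pow_right₀ hY1 (by omega)
      have j2 : Y ^ K₂ ≤ Y ^ n := pow_le_pow_right₀ hY1 (by omega)
      have j3 : Y ≤ Y ^ n := le_self_pow₀ hY1 (by omega)
      have j4 : 4 / ρ ^ 2 * A₁ = 256 * A₁ * (1 + C₁) ^ 2 * Y ^ (2 * (K₁ + 1)) := by
        rw [hρdef, hD, pow_mul' Y 2 (K₁ + 1)]; field_simp; ring
      have j5 : 256 * A₁ * (1 + C₁) ^ 2 * Y ^ (2 * (K₁ + 1)) ≤ 256 * A₁ * (1 + C₁) ^ 2 * Y ^ n :=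
        mul_le_mul_of_nonneg_left j1 (by positivity)
      have j6 : κ⁻¹ * C₂ * Y ^ K₂ ≤ κ⁻¹ * C₂ * Y ^ n :=
        mul_le_mul_of_nonneg_left j2 (by positivity)
      rw [hE, hE', j4]
      linarith
    gcongr
  change |v (z₀.1, z₀.2)| ≤ _
  have hv2 := abs_le.1 hv1
  refine abs_le.2 ⟨?_, ?_⟩ <;> linarith [hv2.1, hv2.2]

end TimeDerivative

section NormalDerivative

variable {d : ℕ} {κ α lam : ℝ} {l : Fin d} {c : ℝ → ℝ} {b : ℝ → Fin d → Ed d}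
  {u : ℝ × Ed d → ℝ}

lemma Sol.normal_le_of_bounds (hu : Sol κ α lam l c b u) (hc : Coef κ α c b) (hκ : 0 < κ)
    (hα2 : α < 2) {R H t₀ : ℝ} {x₀ : Ed d} (hR : 0 < R) (hH : 0 < H) (hx₀ : 0 < x₀ l)
    (hmem : ∀ y : Ed d, ‖y - x₀‖ ≤ R → x₀ l ≤ y l → (t₀, y) ∈ Qop l)
    (hb : ∀ y : Ed d, ‖y - x₀‖ ≤ R → x₀ l ≤ y l → |u (t₀, y)| ≤ H ∧
      |dv (1, 0) u (t₀, y)| ≤ H * y l ∧ |lam * u (t₀, y)| ≤ H * y l ∧ hessT l u (t₀, y) ≤ H) :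
    dv (0, ei l) u (t₀, x₀) ≤
      (1 + κ⁻¹ + (κ⁻¹ + d * κ) * (1 + 4 / R ^ 2)) / κ * ((2 - α)⁻¹ + 1) * H + 2 * H / R := by
  set A₁ : ℝ := κ⁻¹ + d * κ with hA₁
  have hA₁0 : 0 < A₁ := by positivity
  set N : ℝ := (1 + κ⁻¹ + A₁ * (1 + 4 / R ^ 2)) / κ * H with hN
  have hN0 : 0 < N := by positivity
  have hκN : κ * N = (1 + κ⁻¹) * H + A₁ * H + A₁ * (4 * H / R ^ 2) := by rw [hN]; field_simp; ring
  have hα' : 0 < 2 - α := by linarith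
  set A : ℝ := N * ((2 - α)⁻¹ + 1) with hA
  set G : ℝ → ℝ := fun s => s ^ (3 - α) / ((3 - α) * (2 - α)) + s ^ 2 / 2 with hG
  set G' : ℝ → ℝ := fun s => s ^ (2 - α) / (2 - α) + s with hG'
  have dG : ∀ s, 0 < s → HasDerivAt G (G' s) s := by
    intro s hs
    have h1 := (Real.hasDerivAt_rpow_const (p := 3 - α) (Or.inl hs.ne')).div_const
      ((3 - α) * (2 - α))
    refine (h1.add ((hasDerivAt_pow 2 s).div_const 2)).congr_deriv ?_
    have h3 : 3 - α ≠ 0 := by linarith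
    rw [show 3 - α - 1 = 2 - α by ring, hG']
    field_simp
    simp
    ring
  have dG' : ∀ s, 0 < s → HasDerivAt G' (s ^ (1 - α) + 1) s := by
    intro s hs
    have h1 := (Real.hasDerivAt_rpow_const (p := 2 - α) (Or.inl hs.ne')).div_const (2 - α)
    refine (h1.add (hasDerivAt_id s)).congr_deriv ?_
    rw [show 2 - α - 1 = 1 - α by ring]
    field_simp
  have hcoord : Continuous fun x : Ed d => x l := by fun_prop
  have hnorm : Continuous fun x : Ed d => ‖x - x₀‖ := by fun_prop
  set Y : Set (Ed d) := {x | ‖x - x₀‖ ≤ R ∧ x₀ l ≤ x l} with hY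
  set V : Set (Ed d) := {x | ‖x - x₀‖ < R ∧ x₀ l < x l} with hV
  have hYc : IsCompact Y := by
    refine (isCompact_closedBall x₀ R).of_isClosed_subset
      ((isClosed_le hnorm continuous_const).inter (isClosed_le continuous_const hcoord))
      fun x hx => ?_
    simpa [dist_eq_norm] using hx.1
  have hVo : IsOpen V := (isOpen_lt hnorm continuous_const).inter
    (isOpen_lt continuous_const hcoord)
  have hVY : V ⊆ Y := fun x hx => ⟨hx.1.le, hx.2.le⟩
  set π : Ed d → Ed d := fun y => y - (y l - x₀ l) • ei l with hπ
  have hπY : ∀ y ∈ Y, π y ∈ Y := by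
    intro y hy
    refine ⟨?_, by simp [hπ]⟩
    have e : π y - x₀ = (y - x₀) - (y - x₀) l • ei l := by simp [hπ]; abel
    rw [e]
    exact (norm_sub_coord_le _).trans hy.1
  have hπl : ∀ y, π y l = x₀ l := fun y => by simp [hπ]
  have hπc : Continuous π := by fun_prop
  have hs : ∀ y ∈ Y, ContDiffAt ℝ ∞ u (t₀, y) := fun y hy =>
    hu.smooth _ (Qop_subset_Qcl l (hmem y hy.1 hy.2))
  have huc : ContinuousOn (fun y => u (t₀, y)) Y := fun y hy =>
    (hasFDerivAt_space (hs y hy).differentiableAt_top).continuousAt.continuousWithinAt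
  set w : Ed d → ℝ := fun y => u (t₀, y) - u (t₀, π y) with hw
  set g : ℝ → ℝ := fun s => A * (s - x₀ l) - N * (G s - G (x₀ l)) with hg
  have dg : ∀ s, 0 < s → HasDerivAt g (A - N * G' s) s := fun s hs =>
    ((((hasDerivAt_id s).sub_const (x₀ l)).const_mul A).sub
      (((dG s hs).sub_const _).const_mul N)).congr_deriv (by simp)
  have dg' : ∀ s, 0 < s → HasDerivAt (fun s => A - N * G' s) (-(N * (s ^ (1 - α) + 1))) s :=
    fun s hs => (((dG' s hs).const_mul N).const_sub A)
  have hlt1 : ∀ y ∈ Y, y l < 1 := fun y hy =>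
    ((le_abs_self _).trans (abs_coord_le y l)).trans_lt (hmem y hy.1 hy.2).2.2.1
  have hg0 : ∀ s, x₀ l ≤ s → s < 1 → 0 ≤ g s := by
    intro s h1 h2
    rcases h1.eq_or_lt with h | h
    · rw [← h]; simp [hg]
    · obtain ⟨ξ, hξ, he⟩ := exists_hasDerivAt_eq_slope g (fun s => A - N * G' s) h
        (fun r hr => (dg r (hx₀.trans_le hr.1)).continuousAt.continuousWithinAt)
        (fun r hr => dg r (hx₀.trans hr.1))
      have hξ0 : 0 < ξ := hx₀.trans hξ.1
      have k1 : ξ ^ (2 - α) ≤ 1 := Real.rpow_le_one hξ0.le (by linarith [hξ.2]) hα'.le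
      have k2 : G' ξ ≤ (2 - α)⁻¹ + 1 := by
        have : ξ ^ (2 - α) / (2 - α) ≤ (2 - α)⁻¹ := by
          rw [div_eq_mul_inv]; exact mul_le_of_le_one_left (by positivity) k1
        have := hξ.2
        simp only [hG']
        linarith
      have k3 : 0 ≤ A - N * G' ξ := by
        rw [hA, ← mul_sub]; exact mul_nonneg hN0.le (by linarith)
      simp only at he
      rw [he, le_div_iff₀ (by linarith)] at k3
      have : g (x₀ l) = 0 := by simp [hg]
      linarith
  set ψ : Ed d → ℝ := fun y => 2 * H / R ^ 2 * ‖y - x₀‖ ^ 2 + g (y l) with hψ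
  have hgc : ContinuousOn (fun y : Ed d => g (y l)) Y := fun y hy =>
    ContinuousAt.continuousWithinAt (ContinuousAt.comp (f := fun y : Ed d => y l) (g := g)
      (dg _ (hx₀.trans_le hy.2)).continuousAt hcoord.continuousAt)
  have hmain := elliptic_comparison hYc hVo hVY (w := w) (ψ := ψ)
    (huc.sub (huc.comp hπc.continuousOn fun y hy => hπY y hy))
    ((by fun_prop : Continuous fun y : Ed d => 2 * H / R ^ 2 * ‖y - x₀‖ ^ 2).continuousOn.add hgc)
    ?_ ?_
  · have hx₀Y : x₀ ∈ Y := ⟨by simpa using hR.le, le_rfl⟩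
    have hline := hasDerivAt_line_zero (V := (0, ei l)) (hs x₀ hx₀Y).differentiableAt_top
    refine le_of_increment_le hR hline fun s hsR => ?_
    have hsl : (x₀ + s • ei l) l = x₀ l + s := by simp
    have hsn : ‖x₀ + s • ei l - x₀‖ = s := by
      rw [add_sub_cancel_left, norm_smul]; simp [abs_of_pos hsR.1]
    have hYs : x₀ + s • ei l ∈ Y := ⟨by rw [hsn]; exact hsR.2.le, by rw [hsl]; linarith [hsR.1]⟩
    have h := hmain _ hYs
    have hπs : π (x₀ + s • ei l) = x₀ := by simp [hπ]
    simp only [hw, hψ, hπs, hsn, hsl] at h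
    have hGm : G (x₀ l) ≤ G (x₀ l + s) := by
      have hs0 := hsR.1
      have h3 : 0 < 3 - α := by linarith
      have := Real.rpow_le_rpow hx₀.le (by linarith : x₀ l ≤ x₀ l + s) h3.le
      simp only [hG]
      gcongr
      linarith
    have hgs : g (x₀ l + s) ≤ A * s := by
      simp only [hg]
      have := mul_nonneg hN0.le (sub_nonneg.2 hGm)
      linarith
    have hq : 2 * H / R ^ 2 * s ^ 2 ≤ 2 * H / R * s := by
      have e : 2 * H / R * s = 2 * H / R ^ 2 * (R * s) := by field_simp
      rw [e, pow_two s]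
      have := hsR.1
      have := hsR.2
      gcongr
    simp only [Prod.smul_mk, smul_zero, Prod.mk_add_mk, add_zero]
    have eA : (1 + κ⁻¹ + A₁ * (1 + 4 / R ^ 2)) / κ * ((2 - α)⁻¹ + 1) * H = A := by
      rw [hA, hN]; ring
    rw [eA, zero_smul, add_zero]
    linarith
  · intro y hy hyV
    have hgy := hg0 _ hy.2 (hlt1 y hy)
    by_cases h : y l = x₀ l
    · have : π y = y := by simp [hπ, h]
      simp only [hw, hψ, this, sub_self]
      positivity
    · have hyR : ‖y - x₀‖ = R := by
        refine le_antisymm hy.1 (not_lt.1 fun h' => hyV ⟨h', lt_of_le_of_ne hy.2 (Ne.symm h)⟩)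
      have e : 2 * H / R ^ 2 * ‖y - x₀‖ ^ 2 = 2 * H := by rw [hyR]; field_simp
      have h1 := (le_abs_self _).trans (hb y hy.1 hy.2).1
      have h2 := (neg_le_abs _).trans (hb _ (hπY y hy).1 (hπY y hy).2).1
      simp only [hw, hψ]
      linarith
  · intro y hyV hlt hsd
    have hy := hVY hyV
    set s := y l with hsdef
    have hs0 : 0 < s := hx₀.trans hyV.2
    have hs1 : s < 1 := hlt1 y hy
    obtain ⟨-, b2, b3, -⟩ := hb y hy.1 hy.2
    have b4 := (hb _ (hπY y hy).1 (hπY y hy).2).2.2.2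
    have hd2 : ∀ v : Ed d, d2 v u (t₀, y) ≤
        (H + 4 * H / R ^ 2) * ‖v‖ ^ 2 - N * (s ^ (1 - α) + 1) * v l ^ 2 := by
      intro v
      have hw2 : HasSymmDeriv2 (fun r : ℝ => w (y + r • v))
          (d2 v u (t₀, y) - d2 (v - v l • ei l) u (t₀, π y)) := by
        have h1 := (hasSymmDeriv2_space (hs y hy) v).sub
          (hasSymmDeriv2_space (hs _ (hπY y hy)) (v - v l • ei l))
        convert h1 using 2 with r
        simp only [hw]
        congr 3
        simp [hπ, smul_sub, sub_smul, add_smul, mul_smul]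
        abel
      have hψ2 := (hasSymmDeriv2_normSq_sub y x₀ v (2 * H / R ^ 2)).add
        (hasSymmDeriv2_comp_coord (x := y) (G := g) (lt_mem_nhds hs0 |>.mono dg) (dg' s hs0) v)
      have h := hsd v _ _ hw2 hψ2
      have hv0 : (v - v l • ei l) l = 0 := by simp
      have a2 := (le_abs_self _).trans (abs_d2_le_hessT (hs _ (hπY y hy)) hv0)
      have a3 : ‖v - v l • ei l‖ ^ 2 ≤ ‖v‖ ^ 2 := by
        have := norm_sub_coord_le (l := l) v
        gcongr
      have a5 : hessT l u (t₀, π y) * ‖v - v l • ei l‖ ^ 2 ≤ H * ‖v‖ ^ 2 := by gcongr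
      have e : 2 * (2 * H / R ^ 2) * ‖v‖ ^ 2 = 4 * H / R ^ 2 * ‖v‖ ^ 2 := by ring
      rw [e] at h
      linarith
    set D := H + 4 * H / R ^ 2 with hD
    have hD0 : 0 < D := by positivity
    set X := s ^ α with hX
    have hX0 : 0 < X := Real.rpow_pos_of_pos hs0 _
    have hXs : X * s ^ (1 - α) = s := by
      rw [hX, ← Real.rpow_add hs0]; simp
    have c1 : ∑ k, d2 (b s k) u (t₀, y) ≤ D * κ⁻¹ * X := by
      have := hc.sum_le hs0 hs1 (R := D / 2) (by positivity)
      have e : 2 * (D / 2) = D := by ring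
      rw [e] at this
      refine (Finset.sum_le_sum fun k _ => (hd2 _).trans ?_).trans this
      have : 0 ≤ N * (s ^ (1 - α) + 1) * (b s k l) ^ 2 := by positivity
      linarith
    have c2 : ∑ i, d2 (ei i) u (t₀, y) ≤ D * d - N * (s ^ (1 - α) + 1) := by
      have : ∀ i, d2 (ei i) u (t₀, y) ≤ D + (if i = l then -(N * (s ^ (1 - α) + 1)) else 0) := by
        intro i
        have := hd2 (ei i)
        by_cases h : i = l
        · subst h; simp at this; simpa [sub_eq_add_neg] using this
        · simpa [h, PiLp.single_apply, Ne.symm h] using this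
      refine (Finset.sum_le_sum fun i _ => this i).trans (le_of_eq ?_)
      rw [Finset.sum_add_distrib]
      simp
      ring
    have c3 := mul_le_mul_of_nonneg_left c2 (by positivity : 0 ≤ κ * X)
    have c4 : κ * X * (D * d - N * (s ^ (1 - α) + 1)) =
        D * (d * κ) * X - κ * N * s - κ * N * X := by
      linear_combination (-(κ * N)) * hXs
    have heq := hu.eq _ (hmem y hy.1 hy.2)
    simp only at heq
    have b5 : |lam * c s * u (t₀, y)| ≤ κ⁻¹ * (H * s) := by
      have e : lam * c s * u (t₀, y) = c s * (lam * u (t₀, y)) := by ring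
      have k1 := hc.c_lower s hs0 hs1
      have k2 := hc.c_upper s hs0 hs1
      rw [e, abs_mul, abs_of_nonneg (a := c s) (by linarith)]
      exact mul_le_mul k2 b3 (abs_nonneg _) (by positivity)
    have b2' := (abs_le.1 b2).1
    have b5' := (abs_le.1 b5).1
    have c5 : D * κ⁻¹ * X + D * (d * κ) * X = A₁ * H * X + A₁ * (4 * H / R ^ 2) * X := by
      rw [hA₁, hD]; ring
    have c6 : κ * N * s = (1 + κ⁻¹) * H * s + A₁ * H * s + A₁ * (4 * H / R ^ 2) * s := by
      rw [hκN]; ring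
    have c7 : κ * N * X = (1 + κ⁻¹) * H * X + A₁ * H * X + A₁ * (4 * H / R ^ 2) * X := by
      rw [hκN]; ring
    have p1 : 0 < A₁ * H * s := by positivity
    have p2 : 0 ≤ A₁ * (4 * H / R ^ 2) * s := by positivity
    have p3 : 0 ≤ (1 + κ⁻¹) * H * X := by positivity
    linarith

lemma bd_normal (hκ : 0 < κ) (hα : 0 < α) (hα2 : α < 2) :
    Bd κ α l (fun _ u => dv (0, ei l) u) := by
  have hT : Pres κ α l (fun _ u => dv ((1 : ℝ), (0 : Ed d)) u) := Pres.dv (by simp)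
  obtain ⟨C, hC, K, hH⟩ := (bd_id (κ := κ) (α := α) (l := l)).add
    (((bd_div_coord hκ hα2).comp (bd_time hκ hα hα2) hT).add
      (((bd_div_coord hκ hα2).comp (bd_lam_mul hκ hα.le) Pres.lam_mul).add
        (bd_hessT hκ hα hα2)))
  set A₁ : ℝ := κ⁻¹ + d * κ with hA₁
  have hA₁0 : 0 < A₁ := by positivity
  have hα' : 0 < 2 - α := by linarith
  set B : ℝ := (1 + κ⁻¹ + A₁) / κ * ((2 - α)⁻¹ + 1) with hB
  set B' : ℝ := 16 * A₁ / κ * ((2 - α)⁻¹ + 1) with hB'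
  have hB0 : 0 < B := by positivity
  have hB'0 : 0 < B' := by positivity
  refine Bd.of_pos_upper (fun lam c b u hu z hz => dv_neg (hu.smooth z (Qop_subset_Qcl l hz)))
    ⟨(B + B' + 4) * (C * 2 ^ K), by positivity, K + 2, ?_⟩
  intro lam c b u r r' y S hlam hc hu hr hr' hy hρ hS hb z₀ hz₀
  have hy0 : 0 < y := by linarith
  obtain ⟨m1, m2⟩ := midpoint_scale hρ
  set rm := (r + r') / 2 with hrm
  have hlt := lt_of_one_le_mul hy hρ
  set H : ℝ := C * (2 * y) ^ K * S with hHdef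
  have hH0 : 0 < H := by positivity
  have hrm' : rm ≤ rtop α := by linarith
  have hHb : ∀ z ∈ Pr α l rm, |u z| ≤ H ∧ |dv (1, 0) u z| ≤ H * z.2 l ∧
      |lam * u z| ≤ H * z.2 l ∧ hessT l u z ≤ H := by
    intro z hz
    have hzl : 0 < z.2 l := hz.2.2.2
    have := hH lam c b u rm r' (2 * y) S hlam hc hu (by linarith) hr' (by linarith) m2 hb z hz
    simp only at this
    have h1 := abs_nonneg (u z)
    have h2 := abs_nonneg (dv (1, 0) u z / z.2 l)
    have h3 := abs_nonneg (lam * u z / z.2 l)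
    have h4 := abs_nonneg (hessT l u z)
    have h5 := le_abs_self (hessT l u z)
    rw [abs_of_nonneg (a := |lam * u z / z.2 l| + |hessT l u z|) (by linarith),
      abs_of_nonneg (a := |dv (1, 0) u z / z.2 l| + (|lam * u z / z.2 l| + |hessT l u z|))
        (by linarith), abs_of_nonneg (by linarith)] at this
    refine ⟨by linarith, ?_, ?_, by linarith⟩
    · rw [← div_le_iff₀ hzl, ← abs_of_pos hzl, ← abs_div]
      linarith
    · rw [← div_le_iff₀ hzl, ← abs_of_pos hzl, ← abs_div]
      linarith
  have hmem : ∀ x : Ed d, ‖x - z₀.2‖ ≤ (2 * y)⁻¹ → z₀.2 l ≤ x l → (z₀.1, x) ∈ Pr α l rm := by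
    intro x hx hl
    have : (0 : ℝ) < (2 * y)⁻¹ := by positivity
    exact mem_Pr_of_near (by linarith) m1 hz₀ (by linarith) le_rfl hx (hz₀.2.2.2.trans_le hl)
  have hmain := hu.normal_le_of_bounds hc hκ hα2 (R := (2 * y)⁻¹) (t₀ := z₀.1) (x₀ := z₀.2)
    (by positivity) hH0 hz₀.2.2.2 (fun x hx hl => Pr_subset_Qop hrm' (hmem x hx hl))
    (fun x hx hl => hHb _ (hmem x hx hl))
  refine hmain.trans ?_
  have e1 : (1 + κ⁻¹ + A₁ * (1 + 4 / (2 * y)⁻¹ ^ 2)) / κ * ((2 - α)⁻¹ + 1) * H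
      + 2 * H / (2 * y)⁻¹ = B * H + B' * y ^ 2 * H + 4 * y * H := by
    rw [hB, hB']; field_simp; ring
  have e2 : (B + B' + 4) * (C * 2 ^ K) * y ^ (K + 2) * S =
      B * y ^ 2 * H + B' * y ^ 2 * H + 4 * y ^ 2 * H := by
    rw [hHdef, pow_add, mul_pow]; ring
  rw [e1, e2]
  have q1 : 1 ≤ y ^ 2 := one_le_pow₀ hy
  have q2 : y ≤ y ^ 2 := le_self_pow₀ hy (by norm_num)
  have k1 : B * H ≤ B * y ^ 2 * H := by
    have : B * H * 1 ≤ B * H * y ^ 2 := by gcongr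
    linarith
  have k2 : 4 * y * H ≤ 4 * y ^ 2 * H := by gcongr
  linarith

end NormalDerivative

section SecondDerivatives

variable {d : ℕ} {κ α lam : ℝ} {l : Fin d} {c : ℝ → ℝ} {b : ℝ → Fin d → Ed d}
  {u : ℝ × Ed d → ℝ} {z : ℝ × Ed d}

lemma bd_dv (hκ : 0 < κ) (hα : 0 < α) (hα2 : α < 2) (i : Fin d) :
    Bd κ α l (fun _ u => dv (0, ei i) u) := by
  by_cases h : i = l
  · subst h; exact bd_normal hκ hα hα2
  · exact bd_tangential hκ hα hα2 h

/-- The size of the second spatial derivatives of which at least one is tangential. -/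
def mixT (l : Fin d) (u : ℝ × Ed d → ℝ) (z : ℝ × Ed d) : ℝ :=
  ∑ j, |(∑ k, |(if k ≠ l then dv (0, ei j) (dv (0, ei k) u) z else 0)|)|

lemma bd_mixT (hκ : 0 < κ) (hα : 0 < α) (hα2 : α < 2) : Bd κ α l (fun _ u => mixT l u) := by
  refine Bd.sum _ fun j => Bd.sum _ fun k => ?_
  by_cases h : k ≠ l
  · simp only [if_pos h]
    exact (bd_dv hκ hα hα2 j).comp (bd_tangential hκ hα hα2 h) (Pres.dv (by simp [Ne.symm h]))
  · simp only [if_neg h]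
    exact bd_zero

lemma mixT_nonneg : 0 ≤ mixT l u z := Finset.sum_nonneg fun _ _ => abs_nonneg _

lemma dv_dv_eq_sum (hu : ContDiffAt ℝ ∞ u z) (v w : Ed d) :
    dv (0, v) (dv (0, w) u) z = ∑ j, ∑ k, v j * w k * dv (0, ei j) (dv (0, ei k) u) z := by
  rw [← D2u_apply hu]
  conv_lhs => rw [eq_sum_coord_smul v, eq_sum_coord_smul w]
  simp only [map_sum, sum_apply, map_smul, smul_apply, smul_eq_mul, D2u_apply hu,
    Finset.mul_sum]
  rw [Finset.sum_comm]
  simp only [mul_assoc, mul_left_comm]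

lemma abs_dv_dv_le_mixT (hu : ContDiffAt ℝ ∞ u z) {v w : Ed d} (hw : w l = 0) :
    |dv (0, v) (dv (0, w) u) z| ≤ mixT l u z * (‖v‖ * ‖w‖) := by
  rw [dv_dv_eq_sum hu, mixT, Finset.sum_mul]
  refine (Finset.abs_sum_le_sum_abs _ _).trans (Finset.sum_le_sum fun j _ => ?_)
  refine le_trans ?_ (mul_le_mul_of_nonneg_right (le_abs_self _) (by positivity))
  rw [Finset.sum_mul]
  refine (Finset.abs_sum_le_sum_abs _ _).trans (Finset.sum_le_sum fun k _ => ?_)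
  rw [abs_mul, abs_mul, mul_comm]
  by_cases h : k ≠ l
  · rw [if_pos h]
    refine mul_le_mul_of_nonneg_left ?_ (abs_nonneg _)
    exact mul_le_mul (abs_coord_le v j) (abs_coord_le w k) (abs_nonneg _) (norm_nonneg _)
  · rw [not_not] at h
    subst h
    simp [hw]

lemma abs_d2_sub_le_mixT (hu : ContDiffAt ℝ ∞ u z) (v : Ed d) :
    |d2 v u z - v l ^ 2 * d2 (ei l) u z| ≤ 2 * mixT l u z * ‖v‖ ^ 2 := by
  set v' := v - v l • ei l with hv'
  have hv0 : v' l = 0 := by simp [hv']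
  have hv'n : ‖v'‖ ≤ ‖v‖ := norm_sub_coord_le v
  have e : d2 v u z - v l ^ 2 * d2 (ei l) u z =
      dv (0, v) (dv (0, v') u) z + v l * dv (0, ei l) (dv (0, v') u) z := by
    have hs : D2u u z v (ei l) = D2u u z (ei l) v := by
      rw [D2u_apply hu, D2u_apply hu, dv_comm hu]
    rw [d2, d2, ← D2u_apply hu, ← D2u_apply hu, ← D2u_apply hu, ← D2u_apply hu, hv']
    simp only [map_sub, map_smul, smul_eq_mul, hs]
    ring
  have h1 := abs_dv_dv_le_mixT hu (v := v) hv0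
  have h2 := abs_dv_dv_le_mixT hu (v := ei l) hv0
  have hm := mixT_nonneg (l := l) (u := u) (z := z)
  have h3 : mixT l u z * (‖v‖ * ‖v'‖) ≤ mixT l u z * ‖v‖ ^ 2 := by
    rw [pow_two]; gcongr
  have h4 : |v l * dv (0, ei l) (dv (0, v') u) z| ≤ mixT l u z * ‖v‖ ^ 2 := by
    have e1 : ‖ei l‖ = 1 := by simp
    rw [e1, one_mul] at h2
    have e2 : mixT l u z * ‖v‖ ^ 2 = ‖v‖ * (mixT l u z * ‖v‖) := by ring
    rw [abs_mul, e2]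
    refine mul_le_mul (abs_coord_le v l) (h2.trans ?_) (abs_nonneg _) (norm_nonneg _)
    gcongr
  rw [e]
  refine (abs_add_le _ _).trans ?_
  linarith

lemma Sol.normal_second_le (hu : Sol κ α lam l c b u) (hc : Coef κ α c b) (hκ : 0 < κ)
    (hz : z ∈ Qop l) : κ * z.2 l ^ α * |d2 (ei l) u z| ≤
      |dv (1, 0) u z| + κ⁻¹ * |lam * u z| + 2 * (κ⁻¹ + d * κ) * z.2 l ^ α * mixT l u z := by
  have hs := hu.smooth z (Qop_subset_Qcl l hz)
  have h0 : 0 < z.2 l := hz.2.2.2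
  have h1 : z.2 l < 1 := ((le_abs_self _).trans (abs_coord_le z.2 l)).trans_lt hz.2.2.1
  set s := z.2 l with hsdef
  set X := s ^ α with hX
  have hX0 : 0 < X := Real.rpow_pos_of_pos h0 _
  set m := mixT l u z with hm
  have hm0 : 0 ≤ m := mixT_nonneg
  set D := d2 (ei l) u z with hD
  have b1 : |∑ k, d2 (b s k) u z - (∑ k, b s k l ^ 2) * D| ≤ 2 * κ⁻¹ * X * m := by
    rw [Finset.sum_mul, ← Finset.sum_sub_distrib]
    refine (Finset.abs_sum_le_sum_abs _ _).trans
      ((Finset.sum_le_sum fun k _ => abs_d2_sub_le_mixT hs (b s k)).trans ?_)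
    have := hc.sum_le h0 h1 hm0
    linarith
  have b2 : |∑ i, d2 (ei i) u z - D| ≤ 2 * d * m := by
    have e : D = ∑ i : Fin d, (ei i : Ed d) l ^ 2 * D := by
      simp [PiLp.single_apply]
    rw [e, ← Finset.sum_sub_distrib]
    refine (Finset.abs_sum_le_sum_abs _ _).trans
      ((Finset.sum_le_sum fun k _ => abs_d2_sub_le_mixT hs (ei k)).trans ?_)
    simp
    linarith
  have b3 : |lam * c s * u z| ≤ κ⁻¹ * |lam * u z| := by
    have e : lam * c s * u z = c s * (lam * u z) := by ring
    have k1 := hc.c_lower s h0 h1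
    have k2 := hc.c_upper s h0 h1
    rw [e, abs_mul, abs_of_nonneg (a := c s) (by linarith)]
    gcongr
  have heq := hu.eq z hz
  rw [← hsdef] at heq
  set S₁ := ∑ k, d2 (b s k) u z with hS₁
  set S₂ := ∑ i, d2 (ei i) u z with hS₂
  set q := ∑ k, b s k l ^ 2 with hq
  have hq0 : 0 ≤ q := Finset.sum_nonneg fun _ _ => sq_nonneg _
  have b4 : |κ * X * (S₂ - D)| ≤ κ * X * (2 * d * m) := by
    rw [abs_mul, abs_of_nonneg (by positivity)]
    gcongr
  have key : (q + κ * X) * D =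
      dv (1, 0) u z + lam * c s * u z - (S₁ - q * D) - κ * X * (S₂ - D) := by
    linear_combination -heq
  have h5 : κ * X * |D| ≤ |(q + κ * X) * D| := by
    rw [abs_mul, abs_of_nonneg (a := q + κ * X) (by positivity)]
    gcongr
    linarith
  rw [key] at h5
  have h6 := abs_sub (dv (1, 0) u z + lam * c s * u z - (S₁ - q * D)) (κ * X * (S₂ - D))
  have h7 := abs_sub (dv (1, 0) u z + lam * c s * u z) (S₁ - q * D)
  have h8 := abs_add_le (dv (1, 0) u z) (lam * c s * u z)
  linarith

/-- Pointwise bounds for a function and its spatial derivatives of order up to two. -/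
structure RegOn (α : ℝ) (l : Fin d) (P : Set (ℝ × Ed d)) (B : ℝ) (u : ℝ × Ed d → ℝ) : Prop where
  val : ∀ z ∈ P, |u z| ≤ B * z.2 l
  grad : ∀ z ∈ P, ∀ i, |dv (0, ei i) u z| ≤ B
  mixed : ∀ z ∈ P, mixT l u z ≤ B
  normal : ∀ z ∈ P, |d2 (ei l) u z| ≤ B * (z.2 l ^ (1 - α) + 1)

lemma exists_regOn (hκ : 0 < κ) (hα : 0 < α) (hα2 : α < 2) :
    ∃ C : ℝ, 0 < C ∧ ∃ K : ℕ, ∀ (lam : ℝ) (c : ℝ → ℝ) (b : ℝ → Fin d → Ed d)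
      (u : ℝ × Ed d → ℝ) (r r' y S : ℝ), 0 ≤ lam → Coef κ α c b → Sol κ α lam l c b u →
      0 ≤ r → r' ≤ rtop α → 1 ≤ y → 1 ≤ y * (r' - r) → (∀ z ∈ Pr α l r', |u z| ≤ S) →
      RegOn α l (Pr α l r) (C * y ^ K * S) u := by
  have hT : Pres κ α l (fun _ u => dv ((1 : ℝ), (0 : Ed d)) u) := Pres.dv (by simp)
  obtain ⟨C, hC, K, hH⟩ := (bd_div_coord (d := d) (l := l) hκ hα2).add
    (((bd_div_coord hκ hα2).comp (bd_time hκ hα hα2) hT).add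
      (((bd_div_coord hκ hα2).comp (bd_lam_mul hκ hα.le) Pres.lam_mul).add
        ((bd_mixT hκ hα hα2).add (Bd.sum Finset.univ (bd_dv hκ hα hα2)))))
  set A₁ : ℝ := κ⁻¹ + d * κ with hA₁
  have hA₁0 : 0 < A₁ := by positivity
  set E : ℝ := 1 + (1 + κ⁻¹ + 2 * A₁) / κ with hE
  have hE1 : 1 ≤ E := by
    have : 0 ≤ (1 + κ⁻¹ + 2 * A₁) / κ := by positivity
    linarith
  refine ⟨E * C, by positivity, K, ?_⟩
  intro lam c b u r r' y S hlam hc hu hr hr' hy hρ hb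
  have hrr : r ≤ rtop α := (lt_of_one_le_mul hy hρ).le.trans hr'
  have hall : ∀ z ∈ Pr α l r, 0 ≤ C * y ^ K * S ∧ |u z| ≤ C * y ^ K * S * z.2 l ∧
      |dv (1, 0) u z| ≤ C * y ^ K * S * z.2 l ∧ |lam * u z| ≤ C * y ^ K * S * z.2 l ∧
      mixT l u z ≤ C * y ^ K * S ∧ ∀ i, |dv (0, ei i) u z| ≤ C * y ^ K * S := by
    intro z hz
    have hzl : 0 < z.2 l := hz.2.2.2
    have := hH lam c b u r r' y S hlam hc hu hr hr' hy hρ hb z hz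
    simp only at this
    set B := C * y ^ K * S
    have hsum : 0 ≤ ∑ i, |dv (0, ei i) u z| := Finset.sum_nonneg fun _ _ => abs_nonneg _
    have hm := mixT_nonneg (l := l) (u := u) (z := z)
    have h1 := abs_nonneg (u z / z.2 l)
    have h2 := abs_nonneg (dv (1, 0) u z / z.2 l)
    have h3 := abs_nonneg (lam * u z / z.2 l)
    simp only [abs_of_nonneg hsum, abs_of_nonneg hm] at this
    rw [abs_of_nonneg (a := mixT l u z + ∑ i, |dv (0, ei i) u z|) (by linarith),
      abs_of_nonneg (a := |lam * u z / z.2 l| + (mixT l u z + ∑ i, |dv (0, ei i) u z|))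
        (by linarith),
      abs_of_nonneg (a := |dv (1, 0) u z / z.2 l| +
        (|lam * u z / z.2 l| + (mixT l u z + ∑ i, |dv (0, ei i) u z|))) (by linarith),
      abs_of_nonneg (by linarith)] at this
    have hdiv : ∀ a : ℝ, |a / z.2 l| ≤ B → |a| ≤ B * z.2 l := by
      intro a ha
      rwa [abs_div, abs_of_pos hzl, div_le_iff₀ hzl] at ha
    refine ⟨by linarith, hdiv _ (by linarith), hdiv _ (by linarith), hdiv _ (by linarith),
      by linarith, fun i => ?_⟩
    have := Finset.single_le_sum (f := fun i => |dv (0, ei i) u z|) (fun _ _ => abs_nonneg _)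
      (Finset.mem_univ i)
    linarith
  have eE : E * C * y ^ K * S = E * (C * y ^ K * S) := by ring
  rw [eE]
  generalize C * y ^ K * S = B at hall
  have hBE : ∀ z ∈ Pr α l r, B ≤ E * B := fun z hz => le_mul_of_one_le_left (hall z hz).1 hE1
  refine ⟨fun z hz => (hall z hz).2.1.trans ?_, fun z hz i => ((hall z hz).2.2.2.2.2 i).trans
    (hBE z hz), fun z hz => (hall z hz).2.2.2.2.1.trans (hBE z hz), fun z hz => ?_⟩
  · have := hBE z hz
    have hzl : 0 < z.2 l := hz.2.2.2
    gcongr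
  · obtain ⟨hB, -, h2, h3, h4, -⟩ := hall z hz
    have h := hu.normal_second_le hc hκ (Pr_subset_Qop hrr hz)
    have hzl : 0 < z.2 l := hz.2.2.2
    set s := z.2 l
    set X := s ^ α with hX
    have hX0 : 0 < X := Real.rpow_pos_of_pos hzl _
    have hXs : X * s ^ (1 - α) = s := by
      rw [hX, ← Real.rpow_add hzl]; simp
    have hq : 0 ≤ s ^ (1 - α) := Real.rpow_nonneg hzl.le _
    have k1 : 2 * A₁ * X * mixT l u z ≤ 2 * A₁ * X * B := by gcongr
    have k2 : κ⁻¹ * |lam * u z| ≤ κ⁻¹ * (B * s) := by gcongr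
    have k3 : κ * X * |d2 (ei l) u z| ≤ κ * X * (E * B * (s ^ (1 - α) + 1)) := by
      have e1 : κ * X * (E * B * (s ^ (1 - α) + 1)) = κ * E * B * s + κ * E * B * X := by
        linear_combination (κ * E * B) * hXs
      have e2 : κ * E = κ + 1 + κ⁻¹ + 2 * A₁ := by rw [hE]; field_simp; ring
      rw [e1, e2]
      have p1 : 0 ≤ κ * B * s := by positivity
      have p2 : 0 ≤ A₁ * B * s := by positivity
      have p3 : 0 ≤ κ * B * X := by positivity
      have p4 : 0 ≤ κ⁻¹ * B * X := by positivity
      have p5 : 0 ≤ B * X := by positivity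
      linarith
    exact le_of_mul_le_mul_left k3 (by positivity)

end SecondDerivatives

section Holder

variable {d : ℕ} {κ α lam r B : ℝ} {l : Fin d} {c : ℝ → ℝ} {b : ℝ → Fin d → Ed d}
  {f u : ℝ × Ed d → ℝ} {t : ℝ} {x y : Ed d}

lemma abs_sub_le_of_abs_deriv_le {f g f' g' : ℝ → ℝ} {a b : ℝ} (hab : a < b)
    (hf : ∀ s ∈ Icc a b, HasDerivAt f (f' s) s) (hg : ∀ s ∈ Icc a b, HasDerivAt g (g' s) s)
    (h : ∀ s ∈ Ioo a b, |f' s| ≤ g' s) : |f b - f a| ≤ g b - g a := by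
  have hab' : 0 < b - a := by linarith
  have key : ∀ σ : ℝ, |σ| = 1 → σ * (f b - f a) ≤ g b - g a := by
    intro σ hσ
    have hd : ∀ s ∈ Icc a b, HasDerivAt (fun s => g s - σ * f s) (g' s - σ * f' s) s :=
      fun s hs => (hg s hs).sub ((hf s hs).const_mul σ)
    obtain ⟨ξ, hξ, he⟩ := exists_hasDerivAt_eq_slope (fun s => g s - σ * f s)
      (fun s => g' s - σ * f' s) hab (fun s hs => (hd s hs).continuousAt.continuousWithinAt)
      fun s hs => hd s ⟨hs.1.le, hs.2.le⟩
    have h1 : σ * f' ξ ≤ g' ξ := (le_abs_self _).trans (by rw [abs_mul, hσ, one_mul]; exact h ξ hξ)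
    have h2 : 0 ≤ (g b - σ * f b - (g a - σ * f a)) / (b - a) := by rw [← he]; linarith
    rw [le_div_iff₀ hab'] at h2
    linarith
  refine abs_le.2 ⟨?_, ?_⟩
  · have := key (-1) (by simp); linarith
  · have := key 1 (by simp); linarith

lemma rpow_sub_rpow_le {γ a b : ℝ} (hγ : 0 < γ) (ha : 0 < a) (hab : a ≤ b) (hb : b ≤ 1) :
    b ^ γ - a ^ γ ≤ (γ + 1) * (b - a) ^ min γ 1 := by
  rcases le_total γ 1 with h | h
  · rw [min_eq_left h]
    have h1 := Real.rpow_add_le_add_rpow ha.le (sub_nonneg.2 hab) hγ.le h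
    rw [add_sub_cancel] at h1
    have h2 : 0 ≤ γ * (b - a) ^ γ := mul_nonneg hγ.le (Real.rpow_nonneg (sub_nonneg.2 hab) _)
    linarith
  · rw [min_eq_right h, Real.rpow_one]
    rcases hab.eq_or_lt with rfl | hab
    · simp
    have := abs_sub_le_of_abs_deriv_le (f := fun s => s ^ γ) (g := fun s => γ * s) hab
      (fun s hs => Real.hasDerivAt_rpow_const (Or.inr h))
      (fun s hs => ((hasDerivAt_id s).const_mul γ)) fun s hs => by
        have hs0 : 0 < s := ha.trans hs.1
        rw [abs_of_nonneg (by positivity), mul_one]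
        exact mul_le_of_le_one_right hγ.le
          (Real.rpow_le_one hs0.le (hs.2.le.trans hb) (by linarith))
    have := (le_abs_self _).trans this
    linarith

lemma mem_Pr_segment (hx : (t, x) ∈ Pr α l r) (hy : (t, y) ∈ Pr α l r) {s : ℝ}
    (hs : s ∈ Icc (0 : ℝ) 1) : (t, x + s • (y - x)) ∈ Pr α l r := by
  have e : x + s • (y - x) = (1 - s) • x + s • y := by
    rw [smul_sub, sub_smul, one_smul]; abel
  refine ⟨hx.1, hx.2.1, ?_, ?_⟩
  · have h1 := (convex_ball (0 : Ed d) (1 / 2 + r)) (x := x) (by simpa using hx.2.2.1)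
      (y := y) (by simpa using hy.2.2.1) (sub_nonneg.2 hs.2) hs.1 (by ring)
    rw [e]
    simpa using h1
  · have h1 := (convex_Ioi (0 : ℝ)) (x := x l) hx.2.2.2 (y := y l) hy.2.2.2
      (sub_nonneg.2 hs.2) hs.1 (by ring)
    rw [e]
    simpa using h1

lemma hasDerivAt_segment (hr : r ≤ rtop α) (hf : ∀ z ∈ Qcl l, ContDiffAt ℝ ∞ f z)
    (hx : (t, x) ∈ Pr α l r) (hy : (t, y) ∈ Pr α l r) {s : ℝ} (hs : s ∈ Icc (0 : ℝ) 1) :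
    HasDerivAt (fun s : ℝ => f (t, x + s • (y - x)))
      (dv (0, y - x) f (t, x + s • (y - x))) s := by
  have hm := mem_Pr_segment hx hy hs
  have := hasDerivAt_line (z := (t, x)) (V := ((0 : ℝ), y - x)) (s := s) (f := f)
    (by simpa using (hf _ (Qop_subset_Qcl l (Pr_subset_Qop hr hm))).differentiableAt_top)
  simpa using this

lemma abs_sub_le_of_grad (hr : r ≤ rtop α) (hf : ∀ z ∈ Qcl l, ContDiffAt ℝ ∞ f z)
    (hM : ∀ z ∈ Pr α l r, ∑ i, |dv (0, ei i) f z| ≤ B) (hx : (t, x) ∈ Pr α l r)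
    (hy : (t, y) ∈ Pr α l r) : |f (t, y) - f (t, x)| ≤ B * ‖y - x‖ := by
  have := abs_sub_le_of_abs_deriv_le (f := fun s : ℝ => f (t, x + s • (y - x)))
    (g := fun s => B * ‖y - x‖ * s) zero_lt_one
    (fun s hs => hasDerivAt_segment hr hf hx hy hs)
    (fun s hs => (hasDerivAt_id s).const_mul _) fun s hs => by
      rw [mul_one]
      refine (abs_dv_space_le _).trans ?_
      have := hM _ (mem_Pr_segment hx hy ⟨hs.1.le, hs.2.le⟩)
      gcongr
  simpa using this

lemma RegOn.nonneg {P : Set (ℝ × Ed d)} (h : RegOn α l P B u) {z : ℝ × Ed d} (hz : z ∈ P) :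
    0 ≤ B := (abs_nonneg _).trans (h.grad z hz l)

lemma RegOn.abs_sub_le (hr : r ≤ rtop α) (hu : ∀ z ∈ Qcl l, ContDiffAt ℝ ∞ u z)
    (h : RegOn α l (Pr α l r) B u) (hx : (t, x) ∈ Pr α l r) (hy : (t, y) ∈ Pr α l r) :
    |u (t, y) - u (t, x)| ≤ d * B * ‖y - x‖ :=
  abs_sub_le_of_grad hr hu (fun z hz => (Finset.sum_le_sum fun i _ => h.grad z hz i).trans
    (by simp)) hx hy

lemma abs_dv_tangential_le_mixT {z : ℝ × Ed d} {i j : Fin d} (hj : j ≠ l) :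
    |dv (0, ei i) (dv (0, ei j) u) z| ≤ mixT l u z := by
  have h1 := Finset.single_le_sum
    (f := fun k => |(if k ≠ l then dv (0, ei i) (dv (0, ei k) u) z else 0)|)
    (fun _ _ => abs_nonneg _) (Finset.mem_univ j)
  have h2 := Finset.single_le_sum
    (f := fun j => |(∑ k, |(if k ≠ l then dv (0, ei j) (dv (0, ei k) u) z else 0)|)|)
    (fun _ _ => abs_nonneg _) (Finset.mem_univ i)
  simp only [if_pos hj] at h1
  exact h1.trans ((le_abs_self _).trans h2)

lemma RegOn.abs_sub_tangential_le (hr : r ≤ rtop α) (hu : ∀ z ∈ Qcl l, ContDiffAt ℝ ∞ u z)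
    (h : RegOn α l (Pr α l r) B u) (hx : (t, x) ∈ Pr α l r) (hy : (t, y) ∈ Pr α l r)
    {j : Fin d} (hj : j ≠ l) :
    |dv (0, ei j) u (t, y) - dv (0, ei j) u (t, x)| ≤ d * B * ‖y - x‖ :=
  abs_sub_le_of_grad hr (fun z hz => (hu z hz).dir _)
    (fun z hz => (Finset.sum_le_sum fun i _ =>
      (abs_dv_tangential_le_mixT hj).trans (h.mixed z hz)).trans (by simp)) hx hy

lemma RegOn.abs_sub_normal_le (hα2 : α < 2) (hr : r ≤ rtop α)
    (hu : ∀ z ∈ Qcl l, ContDiffAt ℝ ∞ u z) (h : RegOn α l (Pr α l r) B u)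
    (hx : (t, x) ∈ Pr α l r) (hy : (t, y) ∈ Pr α l r) (hxy : ‖y - x‖ ≤ 1) :
    |dv (0, ei l) u (t, y) - dv (0, ei l) u (t, x)| ≤
      (d + 2 + (2 - α)⁻¹) * B * ‖y - x‖ ^ min (2 - α) 1 := by
  wlog hle : x l ≤ y l generalizing x y
  · have := this hy hx (by rwa [norm_sub_rev]) (by linarith)
    rwa [norm_sub_rev, abs_sub_comm] at this
  have hB := h.nonneg hx
  have hα' : 0 < 2 - α := by linarith
  have hx0 : 0 < x l := hx.2.2.2
  have hy1 : y l < 1 := Pr_coord_lt_one hr hy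
  have hcoord : ∀ s : ℝ, HasDerivAt (fun s : ℝ => (x + s • (y - x)) l) ((y - x) l) s := by
    intro s
    simpa using ((hasDerivAt_id s).mul_const ((y - x) l)).const_add (x l)
  have hpos : ∀ s ∈ Icc (0 : ℝ) 1, 0 < (x + s • (y - x)) l := fun s hs =>
    (mem_Pr_segment hx hy hs).2.2.2
  have hyx : 0 ≤ (y - x) l := by simpa using hle
  set g : ℝ → ℝ := fun s => d * B * ‖y - x‖ * s + B * ((x + s • (y - x)) l ^ (2 - α) / (2 - α) +
    (x + s • (y - x)) l) with hg
  have hgd : ∀ s ∈ Icc (0 : ℝ) 1, HasDerivAt g (d * B * ‖y - x‖ +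
      B * (((x + s • (y - x)) l ^ (1 - α) + 1) * (y - x) l)) s := by
    intro s hs
    have h1 := ((hcoord s).rpow_const (p := 2 - α) (Or.inl (hpos s hs).ne')).div_const (2 - α)
    have h2 := (hasDerivAt_id s).const_mul (d * B * ‖y - x‖)
    refine (h2.add ((h1.add (hcoord s)).const_mul B)).congr_deriv ?_
    rw [show 2 - α - 1 = 1 - α by ring]
    field_simp
  have hmain := abs_sub_le_of_abs_deriv_le
    (f := fun s : ℝ => dv (0, ei l) u (t, x + s • (y - x))) (g := g) zero_lt_one
    (fun s hs => hasDerivAt_segment hr (fun z hz => (hu z hz).dir _) hx hy hs) hgd fun s hs => by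
      have hm := mem_Pr_segment hx hy ⟨hs.1.le, hs.2.le⟩
      set z := (t, x + s • (y - x)) with hz
      have hs' := hu z (Qop_subset_Qcl l (Pr_subset_Qop hr hm))
      have e : dv (0, y - x) (dv (0, ei l) u) z =
          dv (0, ei l) (dv (0, y - x - (y - x) l • ei l) u) z + (y - x) l * d2 (ei l) u z := by
        rw [dv_comm hs', d2, ← D2u_apply hs', ← D2u_apply hs', ← D2u_apply hs']
        simp only [map_sub, map_smul, smul_eq_mul]
        ring
      rw [e]
      refine (abs_add_le _ _).trans ?_
      have k1 := abs_dv_dv_le_mixT hs' (v := ei l) (w := y - x - (y - x) l • ei l) (l := l)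
        (by simp)
      have k2 := norm_sub_coord_le (l := l) (y - x)
      have k3 := h.mixed z hm
      have k4 : mixT l u z * (‖ei l‖ * ‖y - x - (y - x) l • ei l‖) ≤ B * ‖y - x‖ := by
        have e1 : ‖ei l‖ = 1 := by simp
        rw [e1, one_mul]
        exact mul_le_mul k3 k2 (norm_nonneg _) hB
      have k5 : B * ‖y - x‖ ≤ d * B * ‖y - x‖ := by
        have : (1 : ℝ) ≤ d := by exact_mod_cast Nat.one_le_iff_ne_zero.2 (by
          rintro rfl; exact l.elim0)
        have := mul_le_mul_of_nonneg_right this (mul_nonneg hB (norm_nonneg (y - x)))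
        linarith
      have k6 : |(y - x) l * d2 (ei l) u z| ≤
          B * (((x + s • (y - x)) l ^ (1 - α) + 1) * (y - x) l) := by
        rw [abs_mul, abs_of_nonneg hyx]
        have := mul_le_mul_of_nonneg_left (h.normal z hm) hyx
        simp only [hz] at this ⊢
        linarith
      linarith
  have e0 : g 0 = B * (x l ^ (2 - α) / (2 - α) + x l) := by simp [hg]
  have e1 : g 1 = d * B * ‖y - x‖ + B * (y l ^ (2 - α) / (2 - α) + y l) := by simp [hg]
  have hpw := rpow_sub_rpow_le hα' hx0 hle hy1.le
  have hlen : y l - x l ≤ ‖y - x‖ := by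
    simpa using (le_abs_self _).trans (abs_coord_le (y - x) l)
  set δ := min (2 - α) 1 with hδ
  have hδ0 : 0 < δ := lt_min hα' one_pos
  have hδ1 : δ ≤ 1 := min_le_right _ _
  have q1 : (y l - x l) ^ δ ≤ ‖y - x‖ ^ δ := Real.rpow_le_rpow (by linarith) hlen hδ0.le
  have q2 : ‖y - x‖ ≤ ‖y - x‖ ^ δ := by
    rcases (norm_nonneg (y - x)).eq_or_lt with h0 | h0
    · rw [← h0]; exact Real.rpow_nonneg le_rfl _
    · simpa using Real.rpow_le_rpow_of_exponent_ge h0 hxy hδ1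
  rw [e0, e1] at hmain
  simp only [zero_smul, add_zero, one_smul, add_sub_cancel] at hmain
  refine hmain.trans ?_
  set T := ‖y - x‖ ^ δ
  have s1 : y l ^ (2 - α) / (2 - α) - x l ^ (2 - α) / (2 - α) ≤ (1 + (2 - α)⁻¹) * T := by
    rw [← sub_div, div_le_iff₀ hα']
    have : (1 + (2 - α)⁻¹) * T * (2 - α) = (2 - α + 1) * T := by field_simp
    rw [this]
    refine hpw.trans ?_
    gcongr
  have s2 : d * B * ‖y - x‖ ≤ d * B * T := by gcongr
  have s3 : B * (y l ^ (2 - α) / (2 - α) - x l ^ (2 - α) / (2 - α) + (y l - x l)) ≤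
      B * ((1 + (2 - α)⁻¹) * T + T) := mul_le_mul_of_nonneg_left (by linarith) hB
  linarith

/-- Hölder continuity of `x_l ^ (-α/2) g` for a Lipschitz function `g` that vanishes at
`x_l = 0`. -/
lemma weighted_holder {p q gp gq δ B A : ℝ} (hα : 0 < α) (hα2 : α < 2) (hp : 0 < p)
    (hpq : p ≤ q) (hδ : q - p ≤ δ) (hδ0 : 0 < δ) (hB : 0 ≤ B) (hA : 0 ≤ A) (h1 : |gp| ≤ B * p)
    (h2 : |gq| ≤ B * q) (h3 : |gp - gq| ≤ A * δ) :
    |p ^ (-(α / 2)) * gp - q ^ (-(α / 2)) * gq| ≤ (A + 3 * B) * δ ^ (1 - α / 2) := by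
  have hq : 0 < q := hp.trans_le hpq
  have hβ : 0 < 1 - α / 2 := by linarith
  have hw : ∀ s : ℝ, 0 < s → s ^ (-(α / 2)) * s = s ^ (1 - α / 2) := by
    intro s hs
    nth_rewrite 2 [← Real.rpow_one s]
    rw [← Real.rpow_add hs]; congr 1; ring
  have hp' : 0 < p ^ (-(α / 2)) := Real.rpow_pos_of_pos hp _
  have hq' : 0 < q ^ (-(α / 2)) := Real.rpow_pos_of_pos hq _
  have hδ' : 0 < δ ^ (1 - α / 2) := Real.rpow_pos_of_pos hδ0 _
  rcases le_or_gt δ p with h | h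
  · have a1 : p ^ (-(α / 2)) ≤ δ ^ (-(α / 2)) :=
      Real.rpow_le_rpow_of_nonpos hδ0 h (by linarith)
    have a2 : q ^ (-(α / 2)) ≤ p ^ (-(α / 2)) :=
      Real.rpow_le_rpow_of_nonpos hp hpq (by linarith)
    have a3 : p ^ (-(α / 2)) * δ ≤ δ ^ (1 - α / 2) := by
      rw [← hw δ hδ0]; gcongr
    have e : p ^ (-(α / 2)) * gp - q ^ (-(α / 2)) * gq =
        p ^ (-(α / 2)) * (gp - gq) + (p ^ (-(α / 2)) - q ^ (-(α / 2))) * gq := by ring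
    rw [e]
    refine (abs_add_le _ _).trans ?_
    rw [abs_mul, abs_mul, abs_of_pos hp', abs_of_nonneg (sub_nonneg.2 a2)]
    have b1 : p ^ (-(α / 2)) * |gp - gq| ≤ A * δ ^ (1 - α / 2) := by
      calc p ^ (-(α / 2)) * |gp - gq| ≤ p ^ (-(α / 2)) * (A * δ) := by gcongr
        _ = A * (p ^ (-(α / 2)) * δ) := by ring
        _ ≤ _ := by gcongr
    have b2 : (p ^ (-(α / 2)) - q ^ (-(α / 2))) * q ≤ δ ^ (1 - α / 2) := by
      have c1 := hw p hp
      have c2 := hw q hq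
      have c3 : p ^ (1 - α / 2) ≤ q ^ (1 - α / 2) := Real.rpow_le_rpow hp.le hpq hβ.le
      have c4 : p ^ (-(α / 2)) * (q - p) ≤ p ^ (-(α / 2)) * δ := by gcongr
      linarith
    have b3 : (p ^ (-(α / 2)) - q ^ (-(α / 2))) * |gq| ≤ B * δ ^ (1 - α / 2) := by
      calc (p ^ (-(α / 2)) - q ^ (-(α / 2))) * |gq|
          ≤ (p ^ (-(α / 2)) - q ^ (-(α / 2))) * (B * q) :=
            mul_le_mul_of_nonneg_left h2 (sub_nonneg.2 a2)
        _ = B * ((p ^ (-(α / 2)) - q ^ (-(α / 2))) * q) := by ring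
        _ ≤ _ := by gcongr
    have : 0 ≤ B * δ ^ (1 - α / 2) := by positivity
    linarith
  · have bound : ∀ s g : ℝ, 0 < s → |g| ≤ B * s → |s ^ (-(α / 2)) * g| ≤ B * s ^ (1 - α / 2) := by
      intro s g hs hg
      have := Real.rpow_pos_of_pos hs (-(α / 2))
      rw [abs_mul, abs_of_pos this, ← hw s hs]
      calc s ^ (-(α / 2)) * |g| ≤ s ^ (-(α / 2)) * (B * s) := by gcongr
        _ = _ := by ring
    have b1 := bound p gp hp h1
    have b2 := bound q gq hq h2
    have c1 : p ^ (1 - α / 2) ≤ δ ^ (1 - α / 2) := Real.rpow_le_rpow hp.le h.le hβ.le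
    have c2 : q ^ (1 - α / 2) ≤ 2 * δ ^ (1 - α / 2) := by
      calc q ^ (1 - α / 2) ≤ (2 * δ) ^ (1 - α / 2) :=
            Real.rpow_le_rpow hq.le (by linarith) hβ.le
        _ = 2 ^ (1 - α / 2) * δ ^ (1 - α / 2) := Real.mul_rpow (by norm_num) hδ0.le
        _ ≤ 2 * δ ^ (1 - α / 2) := by
            gcongr
            exact Real.rpow_le_self_of_one_le (by norm_num) (by linarith)
    have d1 : B * p ^ (1 - α / 2) ≤ B * δ ^ (1 - α / 2) := by gcongr
    have d2 : B * q ^ (1 - α / 2) ≤ B * (2 * δ ^ (1 - α / 2)) := by gcongr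
    have d3 := abs_sub (p ^ (-(α / 2)) * gp) (q ^ (-(α / 2)) * gq)
    have d4 : 0 ≤ A * δ ^ (1 - α / 2) := by positivity
    linarith

end Holder

section GradientMeanValue

variable {d : ℕ} {κ α lam r r' B p J : ℝ} {l : Fin d} {c : ℝ → ℝ} {b : ℝ → Fin d → Ed d}
  {u : ℝ × Ed d → ℝ}

lemma RegOn.mono {P P' : Set (ℝ × Ed d)} {B' : ℝ} (h : RegOn α l P B u) (hP : P' ⊆ P)
    (hpos : ∀ z ∈ P', 0 ≤ z.2 l) (hB : B ≤ B') : RegOn α l P' B' u where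
  val z hz := (h.val z (hP hz)).trans (mul_le_mul_of_nonneg_right hB (hpos z hz))
  grad z hz i := (h.grad z (hP hz) i).trans hB
  mixed z hz := (h.mixed z (hP hz)).trans hB
  normal z hz := (h.normal z (hP hz)).trans (mul_le_mul_of_nonneg_right hB
    (add_nonneg (Real.rpow_nonneg (hpos z hz) _) zero_le_one))

lemma exists_regOn_comp (hκ : 0 < κ) (hα : 0 < α) (hα2 : α < 2)
    {T : ℝ → (ℝ × Ed d → ℝ) → ℝ × Ed d → ℝ} (hT : Bd κ α l T) (hP : Pres κ α l T) :
    ∃ C : ℝ, 0 < C ∧ ∃ K : ℕ, ∀ (lam : ℝ) (c : ℝ → ℝ) (b : ℝ → Fin d → Ed d)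
      (u : ℝ × Ed d → ℝ) (r r' y S : ℝ), 0 ≤ lam → Coef κ α c b → Sol κ α lam l c b u →
      0 ≤ r → r' ≤ rtop α → 1 ≤ y → 1 ≤ y * (r' - r) → (∀ z ∈ Pr α l r', |u z| ≤ S) →
      RegOn α l (Pr α l r) (C * y ^ K * S) (T lam u) := by
  obtain ⟨C, hC, K, hF⟩ := exists_regOn (d := d) (l := l) hκ hα hα2
  obtain ⟨C', hC', K', hT⟩ := hT
  refine ⟨C * 2 ^ K * (C' * 2 ^ K'), by positivity, K + K', ?_⟩
  intro lam c b u r r' y S h1 h2 h3 h4 h5 h6 h7 h8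
  have hlt := lt_of_one_le_mul h6 h7
  obtain ⟨m1, m2⟩ := midpoint_scale h7
  have := hF lam c b (T lam u) r ((r + r') / 2) (2 * y) (C' * (2 * y) ^ K' * S) h1 h2
    (hP _ _ _ _ h3) h4 (by linarith) (by linarith) m1
    (hT lam c b u ((r + r') / 2) r' (2 * y) S h1 h2 h3 (by linarith) h5 (by linarith) m2 h8)
  convert this using 1
  rw [mul_pow, mul_pow, pow_add]
  ring

lemma RegOn.abs_grad_sub_le (hα2 : α < 2) (hr : r ≤ rtop α)
    (hu : ∀ z ∈ Qcl l, ContDiffAt ℝ ∞ u z) (h : RegOn α l (Pr α l r) B u)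
    (h' : RegOn α l (Pr α l r) B (dv (1, 0) u)) {t s η : ℝ} {x y : Ed d}
    (hx : (t, x) ∈ Pr α l r) (hy : (s, y) ∈ Pr α l r) (hη : η ≤ 1) (hη0 : 0 < η)
    (hxy : ‖y - x‖ ≤ η) (hst : |s - t| ≤ η) (i : Fin d) :
    |dv (0, ei i) u (s, y) - dv (0, ei i) u (t, x)| ≤
      (d + 3 + (2 - α)⁻¹) * B * η ^ min (2 - α) 1 := by
  have hB := h.nonneg hx
  have hα' : 0 < 2 - α := by linarith
  have hα'' := inv_pos.2 hα'
  have hδ : 0 < min (2 - α) 1 := lt_min hα' one_pos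
  have hηδ : η ≤ η ^ min (2 - α) 1 := by
    simpa using Real.rpow_le_rpow_of_exponent_ge hη0 hη (min_le_right (2 - α) 1)
  have hty : (t, y) ∈ Pr α l r := ⟨hx.1, hx.2.1, hy.2.2.1, hy.2.2.2⟩
  have h1 : |dv (0, ei i) u (t, y) - dv (0, ei i) u (t, x)| ≤
      (d + 2 + (2 - α)⁻¹) * B * η ^ min (2 - α) 1 := by
    by_cases hi : i = l
    · subst hi
      refine (h.abs_sub_normal_le hα2 hr hu hx hty (hxy.trans hη)).trans ?_
      gcongr
    · refine (h.abs_sub_tangential_le hr hu hx hty hi).trans ?_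
      gcongr
      · linarith
      · exact hxy.trans hηδ
  have hseg : ∀ τ ∈ Icc (0 : ℝ) 1, (t, y) + τ • (s - t, (0 : Ed d)) ∈ Pr α l r := by
    intro τ hτ
    have e : (t, y) + τ • (s - t, (0 : Ed d)) = (t + τ * (s - t), y) := by simp
    have a1 : t + τ * (s - t) = (1 - τ) * t + τ * s := by ring
    rw [e]
    have := (convex_Ioo (-((1 / 2 : ℝ) ^ (2 - α) + r)) 0) (x := t) ⟨hx.1, hx.2.1⟩ (y := s)
      ⟨hy.1, hy.2.1⟩ (sub_nonneg.2 hτ.2) hτ.1 (by ring)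
    simp only [smul_eq_mul] at this
    rw [← a1] at this
    exact ⟨this.1, this.2, hy.2.2.1, hy.2.2.2⟩
  have hsm : ∀ z ∈ Pr α l r, ContDiffAt ℝ ∞ u z := fun z hz =>
    hu z (Qop_subset_Qcl l (Pr_subset_Qop hr hz))
  have h2 : |dv (0, ei i) u (s, y) - dv (0, ei i) u (t, y)| ≤ B * η := by
    have := abs_increment_le (f := dv (0, ei i) u) (z := (t, y)) (V := (s - t, (0 : Ed d)))
      (M := B * η) (fun τ hτ => ((hsm _ (hseg τ hτ)).dir _).differentiableAt_top) fun τ hτ => by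
        have hz := hseg τ ⟨hτ.1.le, hτ.2.le⟩
        have e : (s - t, (0 : Ed d)) = (s - t) • ((1 : ℝ), (0 : Ed d)) := by simp
        rw [show dv (s - t, (0 : Ed d)) (dv (0, ei i) u) ((t, y) + τ • (s - t, (0 : Ed d))) =
          (s - t) * dv (1, 0) (dv (0, ei i) u) ((t, y) + τ • (s - t, (0 : Ed d))) by
            simp only [dv]; rw [e, map_smul, smul_eq_mul],
          dv_comm (hsm _ hz), abs_mul, mul_comm]
        have := h'.grad _ hz i
        gcongr
    simpa using this
  calc _ ≤ |dv (0, ei i) u (s, y) - dv (0, ei i) u (t, y)| +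
        |dv (0, ei i) u (t, y) - dv (0, ei i) u (t, x)| := _root_.abs_sub_le _ _ _
    _ ≤ B * η ^ min (2 - α) 1 + (d + 2 + (2 - α)⁻¹) * B * η ^ min (2 - α) 1 := by
      refine add_le_add (h2.trans ?_) h1
      gcongr
    _ = _ := by ring

lemma mul_le_of_lintegral_rpow_le {X : Type*} [MeasurableSpace X] {m : Measure X} {Q N : Set X}
    {f : X → ℝ} {a v : ℝ} (hp : 1 < p) (hN : N ⊆ Q) (hNm : MeasurableSet N) (ha : 0 ≤ a)
    (hv : 0 ≤ v) (hv1 : v ≤ 1) (hvN : ENNReal.ofReal v ≤ m N) (hJ : 0 ≤ J)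
    (hf : ∀ z ∈ N, a ≤ f z)
    (hI : ∫⁻ z in Q, ENNReal.ofReal (f z ^ p) ∂m ≤ ENNReal.ofReal (J ^ p)) : a * v ≤ J := by
  have hp0 : 0 < p := by linarith
  have h1 : ENNReal.ofReal (a ^ p * v) ≤ ENNReal.ofReal (J ^ p) := by
    rw [ENNReal.ofReal_mul (Real.rpow_nonneg ha _)]
    calc _ ≤ ENNReal.ofReal (a ^ p) * m N := by gcongr
      _ = ∫⁻ z in N, ENNReal.ofReal (a ^ p) ∂m := by rw [setLIntegral_const]
      _ ≤ ∫⁻ z in N, ENNReal.ofReal (f z ^ p) ∂m := by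
        refine setLIntegral_mono' hNm fun z hz => ?_
        have := hf z hz
        gcongr
      _ ≤ _ := (lintegral_mono_set hN).trans hI
  rw [ENNReal.ofReal_le_ofReal_iff (Real.rpow_nonneg hJ _)] at h1
  refine (Real.rpow_le_rpow_iff (mul_nonneg ha hv) hJ hp0).1 ?_
  rw [Real.mul_rpow ha hv]
  refine le_trans ?_ h1
  gcongr
  rcases hv.eq_or_lt with h0 | h0
  · rw [← h0, Real.zero_rpow hp0.ne']
  · simpa using Real.rpow_le_rpow_of_exponent_ge h0 hv1 hp.le

/-- A boundary-adapted cylinder of size `η` next to the point `z`. -/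
def nearCyl (l : Fin d) (η : ℝ) (z : ℝ × Ed d) : Set (ℝ × Ed d) :=
  Ioo (z.1 - η) z.1 ×ˢ Metric.ball (z.2 + (η / 2) • ei l) (η / 2)

lemma nearCyl_spec {η : ℝ} {z w : ℝ × Ed d} (hz : 0 < z.2 l)
    (hw : w ∈ nearCyl l η z) :
    z.1 - η ≤ w.1 ∧ w.1 ≤ z.1 ∧ ‖w.2 - z.2‖ ≤ η ∧ 0 < w.2 l := by
  obtain ⟨⟨h1, h2⟩, h3⟩ := hw
  rw [Metric.mem_ball, dist_eq_norm] at h3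
  refine ⟨h1.le, h2.le, ?_, ?_⟩
  · have e : w.2 - z.2 = (w.2 - (z.2 + (η / 2) • ei l)) + (η / 2) • ei l := by abel
    rw [e]
    refine (norm_add_le _ _).trans ?_
    have : ‖(η / 2) • (ei l : Ed d)‖ = η / 2 := by
      rw [norm_smul, Real.norm_of_nonneg (by linarith)]; simp [ei]
    linarith
  · have h4 := (abs_coord_le (w.2 - (z.2 + (η / 2) • ei l)) l).trans_lt h3
    have e : (w.2 - (z.2 + (η / 2) • ei l)) l = w.2 l - z.2 l - η / 2 := by
      simp [ei]; ring
    rw [e] at h4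
    linarith [(abs_lt.1 h4).1]

lemma exists_volume_nearCyl (l : Fin d) : ∃ w : ℝ, 0 < w ∧ w ≤ 1 ∧ ∀ (η : ℝ) (z : ℝ × Ed d),
    0 < η → ENNReal.ofReal (w * (η / 2) ^ (d + 1)) ≤ volume (nearCyl l η z) := by
  set m₁ := volume (Metric.ball (0 : Ed d) 1) with hm₁
  have hm₁0 : m₁ ≠ 0 := (Metric.measure_ball_pos _ _ one_pos).ne'
  have hm₁t : m₁ ≠ ⊤ := measure_ball_lt_top.ne
  have hm₁' : 0 < m₁.toReal := ENNReal.toReal_pos hm₁0 hm₁t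
  refine ⟨min m₁.toReal 1, lt_min hm₁' one_pos, min_le_right _ _, fun η z hη => ?_⟩
  have h1 : volume (nearCyl l η z) = ENNReal.ofReal (m₁.toReal * η * (η / 2) ^ d) := by
    rw [nearCyl, Measure.volume_eq_prod, Measure.prod_prod, Real.volume_Ioo,
      Measure.addHaar_ball_of_pos _ _ (by linarith), finrank_euclideanSpace_fin, ← hm₁,
      ENNReal.ofReal_mul (by positivity), ENNReal.ofReal_mul hm₁'.le, ENNReal.ofReal_toReal hm₁t,
      show z.1 - (z.1 - η) = η by ring]
    ring
  rw [h1]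
  refine ENNReal.ofReal_le_ofReal ?_
  have h2 : min m₁.toReal 1 * (η / 2) ^ (d + 1) = min m₁.toReal 1 * (η / 2) * (η / 2) ^ d := by ring
  rw [h2]
  gcongr
  · exact min_le_left _ _
  · linarith

lemma sum_abs_dv_le_norm_Du {z : ℝ × Ed d} (hu : DifferentiableAt ℝ u z) :
    ∑ i, |dv (0, ei i) u z| ≤ d * ‖Du u z‖ := by
  calc _ ≤ ∑ _i : Fin d, ‖Du u z‖ := by
        refine Finset.sum_le_sum fun i _ => ?_
        rw [← Du_apply hu]
        have := (Du u z).le_opNorm (ei i)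
        simpa [ei] using this
    _ = _ := by simp

end GradientMeanValue

section GradientAbsorption

variable {d : ℕ} {κ α p : ℝ} {l : Fin d}

lemma exists_coord_bound_of_lintegral (hκ : 0 < κ) (hα : 0 < α) (hα2 : α < 2) (hp : 1 < p) :
    ∃ C : ℝ, 0 < C ∧ ∀ (lam : ℝ) (c : ℝ → ℝ) (b : ℝ → Fin d → Ed d) (u : ℝ × Ed d → ℝ) (J : ℝ),
      0 ≤ lam → Coef κ α c b → Sol κ α lam l c b u → 0 ≤ J →
      (∫⁻ z in Qop l, ENNReal.ofReal (‖Du u z‖ ^ p) ≤ ENNReal.ofReal (J ^ p)) →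
      ∀ z ∈ Pr α l (rtop α / 2), |u z| ≤ C * J := by
  obtain ⟨C₁, hC₁, K₁, hR₁⟩ := exists_regOn (d := d) (l := l) hκ hα hα2
  have hPt : Pres κ α l (fun _ u => dv ((1 : ℝ), (0 : Ed d)) u) := Pres.dv (by simp)
  obtain ⟨C₂, hC₂, K₂, hR₂⟩ := exists_regOn_comp hκ hα hα2 (bd_time (d := d) (l := l) hκ hα hα2) hPt
  obtain ⟨w, hw0, hw1, hvol⟩ := exists_volume_nearCyl l
  have hα' : 0 < 2 - α := by linarith
  have hα'' := inv_pos.2 hα'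
  have hδ : 0 < min (2 - α) 1 := lt_min hα' one_pos
  obtain ⟨n, hn⟩ := exists_nat_gt (min (2 - α) 1)⁻¹
  have hnδ : 1 ≤ n * min (2 - α) 1 := by
    rw [inv_lt_iff_one_lt_mul₀ hδ] at hn
    linarith
  have hn0 : n ≠ 0 := by
    rintro rfl
    norm_num at hnδ
  have hr0 := rtop_pos hα2
  set K := max K₁ K₂ with hK
  set C := (C₁ + C₂) * 2 ^ K with hC
  have hC0 : 0 < C := by positivity
  set E : ℝ := d * (d + 3 + (2 - α)⁻¹) with hE
  have hE0 : 0 ≤ E := by positivity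
  set D₀ : ℝ := 2 * E * C + 2 with hD₀
  have hD₀2 : 2 ≤ D₀ := by
    have : 0 ≤ 2 * E * C := by positivity
    linarith
  set m := (K + 1) * (n * (d + 1)) with hm
  set Y : ℝ := max 1 (2 / rtop α) with hY
  have hdw : 0 ≤ d * w⁻¹ * (2 * D₀ ^ n) ^ (d + 1) := by positivity
  refine ⟨3 * (4 * (m + 1)) ^ m * (d * w⁻¹ * (2 * D₀ ^ n) ^ (d + 1)) * Y ^ m + 1, ?_, ?_⟩
  · have : 0 < Y := lt_max_of_lt_left one_pos
    positivity
  intro lam c b u J hlam hc hu hJ hI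
  have hsm : ∀ z ∈ Pr α l (rtop α), ContDiffAt ℝ ∞ u z := fun z hz =>
    hu.smooth z (Qop_subset_Qcl l (Pr_subset_Qop le_rfl hz))
  set g : ℝ × Ed d → ℝ := fun z => ∑ i, |dv (0, ei i) u z| with hg
  have hgl : ∀ z, |dv (0, ei l) u z| ≤ g z := fun z =>
    Finset.single_le_sum (f := fun i => |dv (0, ei i) u z|) (fun _ _ => abs_nonneg _)
      (Finset.mem_univ l)
  have hg_bdd : ∃ M₀ : ℝ, 0 ≤ M₀ ∧ ∀ z ∈ Pr α l (rtop α), g z ≤ M₀ := by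
    have := fun i : Fin d => exists_bound_of_smooth (l := l) (u := dv (0, ei i) u)
      fun z hz => (hu.smooth z hz).dir _
    choose M hM0 hM using this
    exact ⟨∑ i, M i, Finset.sum_nonneg fun i _ => (hM0 i).le, fun z hz =>
      Finset.sum_le_sum fun i _ => hM i z (Qop_subset_Qcl l (Pr_subset_Qop le_rfl hz))⟩
  obtain ⟨M₀, hM₀, hgM₀⟩ := hg_bdd
  have key : ∀ z ∈ Pr α l (rtop α / 2), g z ≤
      3 * (4 * (m + 1)) ^ m * (d * w⁻¹ * (2 * D₀ ^ n) ^ (d + 1) * J) * Y ^ m := by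
    refine absorb (mul_nonneg hdw hJ) hM₀ hgM₀ ?_ (le_max_left _ _) ?_
    · intro r r' y M hr hr' hy hρ hM hgM z hz
      have hr0' : 0 ≤ r := by linarith
      have hlt := lt_of_one_le_mul hy hρ
      obtain ⟨m1, m2⟩ := midpoint_scale hρ
      set rm := (r + r') / 2 with hrm
      have hrm' : rm ≤ rtop α := by linarith
      have hbu : ∀ z ∈ Pr α l r', |u z| ≤ M := fun z hz => by
        have h1 := abs_le_coord_mul_of_deriv_bound hu hr'
          (fun z hz => (hgl z).trans (hgM z hz)) z hz
        exact h1.trans (mul_le_of_le_one_right hM (Pr_coord_lt_one hr' hz).le)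
      set B := C * y ^ K * M with hB
      have hpow : ∀ (C' : ℝ) (K' : ℕ), 0 ≤ C' → C' ≤ C₁ + C₂ → K' ≤ K →
          C' * (2 * y) ^ K' * M ≤ B := by
        intro C' K' h0 h1 h2
        rw [hB, hC, mul_assoc (C₁ + C₂), ← mul_pow]
        have : (2 * y) ^ K' ≤ (2 * y) ^ K := pow_le_pow_right₀ (by linarith) h2
        gcongr
      have hreg : RegOn α l (Pr α l rm) B u :=
        (hR₁ lam c b u rm r' (2 * y) M hlam hc hu (by linarith) hr' (by linarith) m2 hbu).mono
          Subset.rfl (fun z hz => hz.2.2.2.le)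
          (hpow _ _ hC₁.le (by linarith) (le_max_left _ _))
      have hreg' : RegOn α l (Pr α l rm) B (dv (1, 0) u) :=
        (hR₂ lam c b u rm r' (2 * y) M hlam hc hu (by linarith) hr' (by linarith) m2 hbu).mono
          Subset.rfl (fun z hz => hz.2.2.2.le)
          (hpow _ _ hC₂.le (by linarith) (le_max_right _ _))
      have hB0 : 0 ≤ B := by positivity
      set D := D₀ * y ^ (K + 1) with hD
      have hy1 : 1 ≤ y ^ K := one_le_pow₀ hy
      have hyD : y ≤ y ^ (K + 1) := le_self_pow₀ hy (by omega)
      have hDy : 2 * y ≤ D := by rw [hD]; gcongr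
      have hD1 : 1 ≤ D := by linarith
      set η := (D ^ n)⁻¹ with hη
      have hη0 : 0 < η := by positivity
      have hηD : η ≤ (2 * y)⁻¹ := by
        have : D ≤ D ^ n := le_self_pow₀ hD1 hn0
        exact inv_anti₀ (by linarith) (hDy.trans this)
      have hη1 : η ≤ 1 := inv_le_one_of_one_le₀ (one_le_pow₀ hD1)
      have hηδ : η ^ min (2 - α) 1 ≤ D⁻¹ := by
        rw [hη, ← inv_pow, ← Real.rpow_natCast, ← Real.rpow_mul (by positivity)]
        simpa using Real.rpow_le_rpow_of_exponent_ge (by positivity) (inv_le_one_of_one_le₀ hD1)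
          hnδ
      have hosc : ∀ z' ∈ nearCyl l η z, g z ≤ g z' + M / 2 ∧ z' ∈ Pr α l rm := by
        intro z' hz'
        obtain ⟨a1, a2, a3, a4⟩ := nearCyl_spec hz.2.2.2 hz'
        have hzm : z ∈ Pr α l rm := Pr_mono (by linarith) hz
        have hz'm : z' ∈ Pr α l rm := mem_Pr_of_near (y := 2 * y) (by linarith) m1 hz
          (by linarith) a2 (a3.trans hηD) a4
        refine ⟨?_, hz'm⟩
        have h1 : ∀ i, |dv (0, ei i) u z| ≤ |dv (0, ei i) u z'| +
            (d + 3 + (2 - α)⁻¹) * B * η ^ min (2 - α) 1 := by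
          intro i
          have h2 := hreg.abs_grad_sub_le hα2 hrm' hu.smooth hreg' (t := z.1) (x := z.2)
            (s := z'.1) (y := z'.2) hzm hz'm hη1 hη0 a3
            (abs_le.2 ⟨by linarith, by linarith⟩) i
          have h3 := abs_sub_abs_le_abs_sub (dv (0, ei i) u z) (dv (0, ei i) u z')
          rw [abs_sub_comm] at h3
          simp only [Prod.mk.eta] at h2
          linarith
        have h2 : g z ≤ g z' + E * B * η ^ min (2 - α) 1 := by
          refine (Finset.sum_le_sum fun i _ => h1 i).trans (le_of_eq ?_)
          rw [Finset.sum_add_distrib]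
          simp [hg, hE]
          ring
        have h3 : E * B * η ^ min (2 - α) 1 ≤ E * B * D⁻¹ := by gcongr
        have h4 : E * B * D⁻¹ ≤ M / 2 := by
          rw [← div_eq_mul_inv, div_le_iff₀ (by linarith), hB, hD]
          have h5 : y ^ K ≤ y ^ (K + 1) := pow_le_pow_right₀ hy (by omega)
          have h6 : 2 * E * C ≤ D₀ := by linarith
          calc E * (C * y ^ K * M) = M / 2 * (2 * E * C * y ^ K) := by ring
            _ ≤ M / 2 * (D₀ * y ^ (K + 1)) := by gcongr
        linarith
      have hv := hvol η z hη0
      set v := w * (η / 2) ^ (d + 1) with hvd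
      have hv0 : 0 < v := by positivity
      have hv1 : v ≤ 1 := mul_le_one₀ hw1 (by positivity) (pow_le_one₀ (by positivity) (by linarith))
      rcases le_or_gt (g z) (M / 2) with hle | hgt
      · have : 0 ≤ d * w⁻¹ * (2 * D₀ ^ n) ^ (d + 1) * J * y ^ m := by positivity
        linarith
      have hd : 0 < (d : ℝ) := by
        have := l.pos
        exact_mod_cast this
      have hmain := mul_le_of_lintegral_rpow_le (m := volume) (f := fun z => ‖Du u z‖)
        (a := (g z - M / 2) / d) (N := nearCyl l η z) hp
        (fun z' hz' => Pr_subset_Qop hrm' (hosc z' hz').2)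
        (measurableSet_Ioo.prod measurableSet_ball) (div_nonneg (by linarith) hd.le) hv0.le hv1
        hv hJ (fun z' hz' => by
          obtain ⟨q1, q2⟩ := hosc z' hz'
          have q3 := sum_abs_dv_le_norm_Du
            (hsm z' (Pr_mono hrm' q2)).differentiableAt_top
          rw [div_le_iff₀ hd, mul_comm]
          linarith) hI
      have hvi : v⁻¹ = w⁻¹ * (2 * D₀ ^ n) ^ (d + 1) * y ^ m := by
        rw [hvd, hη, hD, hm, mul_inv, mul_assoc]
        congr 1
        rw [← inv_pow, inv_div, div_inv_eq_mul, mul_pow D₀, ← pow_mul y, ← mul_assoc, mul_pow _ _ (d + 1),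
          ← pow_mul y]
        congr 2
        ring
      have h5 : g z - M / 2 ≤ d * (J * v⁻¹) := by
        rw [div_mul_eq_mul_div, div_le_iff₀ hd] at hmain
        rw [← div_eq_mul_inv, mul_div_assoc', le_div_iff₀ hv0]
        linarith
      rw [hvi] at h5
      linarith
    · have h1 : 2 / rtop α ≤ Y := le_max_right _ _
      rw [div_le_iff₀ hr0] at h1
      linarith
  intro z hz
  have h1 := abs_le_coord_mul_of_deriv_bound hu (by linarith)
    (fun z hz => (hgl z).trans (key z hz)) z hz
  have h2 := (hgl z).trans (key z hz)
  have h3 := (abs_nonneg _).trans h2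
  refine h1.trans ((mul_le_of_le_one_right h3 (Pr_coord_lt_one (by linarith) hz).le).trans ?_)
  linarith

end GradientAbsorption

section NormAssembly

variable {d : ℕ} {κ α lam r B : ℝ} {l : Fin d} {u f : ℝ × Ed d → ℝ}

lemma ofReal_mul_c1Norm_le {Q : Set (ℝ × Ed d)} {a X β : ℝ} (ha : 0 ≤ a) (hX : 0 ≤ X)
    (h1 : ∀ z ∈ Q, a * |f z| ≤ X) (h2 : ∀ z ∈ Q, a * |td f z| ≤ X)
    (h3 : ∀ t x y, (t, x) ∈ Q → (t, y) ∈ Q → a * |f (t, x) - f (t, y)| ≤ X * ‖x - y‖ ^ β)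
    (h4 : ∀ t x y, (t, x) ∈ Q → (t, y) ∈ Q →
      a * |td f (t, x) - td f (t, y)| ≤ X * ‖x - y‖ ^ β) :
    ENNReal.ofReal a * c1Norm β Q f ≤ ENNReal.ofReal (4 * X) := by
  have hs : ∀ g : ℝ × Ed d → ℝ, (∀ z ∈ Q, a * |g z| ≤ X) →
      ENNReal.ofReal a * supN Q g ≤ ENNReal.ofReal X := by
    intro g hg
    simp only [supN, ENNReal.mul_iSup]
    refine iSup₂_le fun z hz => ?_
    rw [← ENNReal.ofReal_mul ha]
    exact ENNReal.ofReal_le_ofReal (hg z hz)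
  have hh : ∀ g : ℝ × Ed d → ℝ, (∀ t x y, (t, x) ∈ Q → (t, y) ∈ Q →
      a * |g (t, x) - g (t, y)| ≤ X * ‖x - y‖ ^ β) →
      ENNReal.ofReal a * hSemi β Q g ≤ ENNReal.ofReal X := by
    intro g hg
    simp only [hSemi, ENNReal.mul_iSup]
    refine iSup_le fun t => iSup_le fun x => iSup_le fun y => iSup_le fun hx => iSup_le fun hy =>
      iSup_le fun hxy => ?_
    rw [← ENNReal.ofReal_mul ha, mul_div_assoc']
    refine ENNReal.ofReal_le_ofReal ?_
    rw [div_le_iff₀ (Real.rpow_pos_of_pos (norm_pos_iff.2 (sub_ne_zero.2 hxy)) _)]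
    exact hg t x y hx hy
  rw [c1Norm, mul_add, mul_add, mul_add, show 4 * X = X + X + X + X by ring,
    ENNReal.ofReal_add (by linarith) hX, ENNReal.ofReal_add (by linarith) hX,
    ENNReal.ofReal_add hX hX]
  exact add_le_add (add_le_add (add_le_add (hs _ h1) (hs _ h2)) (hh _ h3)) (hh _ h4)

lemma td_pd_eq (hr : r ≤ rtop α) (hu : ∀ z ∈ Qcl l, ContDiffAt ℝ ∞ u z) (i : Fin d)
    {z : ℝ × Ed d} (hz : z ∈ Pr α l r) :
    td (pd i u) z = dv (0, ei i) (dv (1, 0) u) z := by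
  have hsm : ∀ z ∈ Pr α l r, ContDiffAt ℝ ∞ u z := fun z hz =>
    hu z (Qop_subset_Qcl l (Pr_subset_Qop hr hz))
  have hc : ContinuousAt (fun s : ℝ => (s, z.2)) z.1 := by fun_prop
  have hev : (fun s => pd i u (s, z.2)) =ᶠ[𝓝 z.1] fun s => dv (0, ei i) u (s, z.2) := by
    filter_upwards [hc.eventually (isOpen_Pr.mem_nhds hz)] with s hs
    exact Du_apply (hsm _ hs).differentiableAt_top _
  rw [td, ut, hev.deriv_eq, dv_comm (hsm z hz)]
  exact ut_eq_dv ((hsm z hz).dir _).differentiableAt_top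

lemma abs_sqrt_mul_le (hlam : 0 ≤ lam) (s : ℝ) : √lam * |s| ≤ |s| + |lam * s| := by
  rw [abs_mul, abs_of_nonneg hlam]
  have h1 : √lam ≤ 1 + lam := by
    nlinarith [Real.sq_sqrt hlam, Real.sqrt_nonneg lam, sq_nonneg (√lam - 1)]
  have := mul_le_mul_of_nonneg_right h1 (abs_nonneg s)
  linarith

lemma sqrt_mul_weighted_le (hα2 : α < 2) (hlam : 0 ≤ lam) (hr : r ≤ rtop α)
    (h1 : RegOn α l (Pr α l r) B u) (h2 : RegOn α l (Pr α l r) B (fun z => lam * u z))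
    {z : ℝ × Ed d} (hz : z ∈ Pr α l r) : √lam * |z.2 l ^ (-(α / 2)) * u z| ≤ 2 * B := by
  have hB := h1.nonneg hz
  have hz0 : 0 < z.2 l := hz.2.2.2
  have hw := Real.rpow_pos_of_pos hz0 (-(α / 2))
  have h3 := abs_sqrt_mul_le hlam (u z)
  have h4 := h1.val z hz
  have h5 := h2.val z hz
  rw [abs_mul, abs_of_pos hw]
  have h6 : z.2 l ^ (-(α / 2)) * z.2 l ≤ 1 := by
    nth_rewrite 2 [← Real.rpow_one (z.2 l)]
    rw [← Real.rpow_add hz0]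
    exact Real.rpow_le_one hz0.le (Pr_coord_lt_one hr hz).le (by linarith)
  calc √lam * (z.2 l ^ (-(α / 2)) * |u z|) = z.2 l ^ (-(α / 2)) * (√lam * |u z|) := by ring
    _ ≤ z.2 l ^ (-(α / 2)) * (2 * B * z.2 l) :=
      mul_le_mul_of_nonneg_left (by linarith) hw.le
    _ = 2 * B * (z.2 l ^ (-(α / 2)) * z.2 l) := by ring
    _ ≤ _ := mul_le_of_le_one_right (by linarith) h6

lemma sqrt_mul_weighted_sub_le (hα : 0 < α) (hα2 : α < 2) (hlam : 0 ≤ lam) (hr : r ≤ rtop α)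
    (hu : ∀ z ∈ Qcl l, ContDiffAt ℝ ∞ u z)
    (h1 : RegOn α l (Pr α l r) B u) (h2 : RegOn α l (Pr α l r) B (fun z => lam * u z))
    {t : ℝ} {x y : Ed d} (hx : (t, x) ∈ Pr α l r) (hy : (t, y) ∈ Pr α l r) :
    √lam * |x l ^ (-(α / 2)) * u (t, x) - y l ^ (-(α / 2)) * u (t, y)| ≤
      (2 * d + 6) * B * ‖x - y‖ ^ (1 - α / 2) := by
  wlog hle : x l ≤ y l generalizing x y
  · have := this hy hx (by linarith)
    rwa [norm_sub_rev, abs_sub_comm] at this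
  have hB := h1.nonneg hx
  rcases eq_or_ne x y with rfl | hne
  · simp only [_root_.sub_self, abs_zero, mul_zero]
    positivity
  have hval : ∀ z ∈ Pr α l r, |√lam * u z| ≤ 2 * B * z.2 l := by
    intro z hz
    rw [abs_mul, abs_of_nonneg (Real.sqrt_nonneg _)]
    have h3 := abs_sqrt_mul_le hlam (u z)
    have h4 := h1.val z hz
    have h5 := h2.val z hz
    linarith
  have hdiff : |√lam * u (t, x) - √lam * u (t, y)| ≤ 2 * d * B * ‖x - y‖ := by
    rw [← mul_sub, abs_mul, abs_of_nonneg (Real.sqrt_nonneg _)]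
    have h3 := abs_sqrt_mul_le hlam (u (t, x) - u (t, y))
    have h4 := h1.abs_sub_le hr hu hy hx
    have h5 := h2.abs_sub_le hr (fun z hz => contDiffAt_const.mul (hu z hz)) hy hx
    rw [← mul_sub] at h5
    linarith
  have hcoord : y l - x l ≤ ‖x - y‖ := by
    have := (le_abs_self _).trans (abs_coord_le (y - x) l)
    rwa [norm_sub_rev] at this
  have := weighted_holder hα hα2 hx.2.2.2 hle hcoord (norm_pos_iff.2 (sub_ne_zero.2 hne))
    (B := 2 * B) (A := 2 * d * B) (by positivity) (by positivity) (hval _ hx) (hval _ hy) hdiff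
  have e : √lam * |x l ^ (-(α / 2)) * u (t, x) - y l ^ (-(α / 2)) * u (t, y)| =
      |x l ^ (-(α / 2)) * (√lam * u (t, x)) - y l ^ (-(α / 2)) * (√lam * u (t, y))| := by
    rw [← abs_of_nonneg (Real.sqrt_nonneg lam), ← abs_mul, abs_of_nonneg (Real.sqrt_nonneg lam)]
    congr 1
    ring
  rw [e]
  refine this.trans (le_of_eq ?_)
  ring

lemma norms_le_of_regOn (hα : 0 < α) (hα2 : α < 2) (hlam : 0 ≤ lam)
    (hr : r ≤ rtop α) (hr2 : r ≤ 0)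
    (hu : ∀ z ∈ Qcl l, ContDiffAt ℝ ∞ u z) (hB : 0 ≤ B)
    (h1 : RegOn α l (Pr α l r) B u) (h2 : RegOn α l (Pr α l r) B (dv (1, 0) u))
    (h3 : RegOn α l (Pr α l r) B (fun z => lam * u z))
    (h4 : RegOn α l (Pr α l r) B (fun z => lam * dv (1, 0) u z)) :
    c1Norm 1 (Pr α l r) u + (∑ i, if i ≠ l then c1Norm 1 (Pr α l r) (pd i u) else 0) +
        c1Norm (min (2 - α) 1) (Pr α l r) (pd l u) +
        ENNReal.ofReal √lam * c1Norm (1 - α / 2) (Pr α l r) (fun z => z.2 l ^ (-(α / 2)) * u z) ≤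
      ENNReal.ofReal (4 * (d + 3) * ((2 * d + 6 + (2 - α)⁻¹) * B)) := by
  have hα' : 0 < (2 - α)⁻¹ := inv_pos.2 (by linarith)
  set X := (2 * d + 6 + (2 - α)⁻¹) * B with hX
  have hX0 : 0 ≤ X := by positivity
  have hXle : ∀ s : ℝ, s ≤ 2 * d + 6 + (2 - α)⁻¹ → s * B ≤ X := fun s hs =>
    mul_le_mul_of_nonneg_right hs hB
  have hBX : B ≤ X := by simpa using hXle 1 (by linarith [(Nat.cast_nonneg d : (0 : ℝ) ≤ d)])
  have hdX : d * B ≤ X := hXle d (by linarith [(Nat.cast_nonneg d : (0 : ℝ) ≤ d)])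
  have hut : ∀ z ∈ Pr α l r, ut u z = dv (1, 0) u z := fun z hz =>
    ut_eq_dv (hu z (Qop_subset_Qcl l (Pr_subset_Qop hr hz))).differentiableAt_top
  have hpd : ∀ (i : Fin d), ∀ z ∈ Pr α l r, pd i u z = dv (0, ei i) u z := fun i z hz =>
    Du_apply (hu z (Qop_subset_Qcl l (Pr_subset_Qop hr hz))).differentiableAt_top _
  have hu' : ∀ z ∈ Qcl l, ContDiffAt ℝ ∞ (dv (1, 0) u) z := fun z hz => (hu z hz).dir _
  have hval : ∀ g : ℝ × Ed d → ℝ, RegOn α l (Pr α l r) B g → ∀ z ∈ Pr α l r, |g z| ≤ X :=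
    fun g hg z hz => (hg.val z hz).trans
      ((mul_le_of_le_one_right hB (Pr_coord_lt_one hr hz).le).trans hBX)
  have hone : ∀ (β : ℝ) (f : ℝ × Ed d → ℝ), (∀ z ∈ Pr α l r, |f z| ≤ X) →
      (∀ z ∈ Pr α l r, |td f z| ≤ X) →
      (∀ t x y, (t, x) ∈ Pr α l r → (t, y) ∈ Pr α l r →
        |f (t, x) - f (t, y)| ≤ X * ‖x - y‖ ^ β) →
      (∀ t x y, (t, x) ∈ Pr α l r → (t, y) ∈ Pr α l r →
        |td f (t, x) - td f (t, y)| ≤ X * ‖x - y‖ ^ β) →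
      c1Norm β (Pr α l r) f ≤ ENNReal.ofReal (4 * X) := by
    intro β f k1 k2 k3 k4
    have := ofReal_mul_c1Norm_le (β := β) zero_le_one hX0 (fun z hz => by simpa using k1 z hz)
      (fun z hz => by simpa using k2 z hz) (fun t x y hx hy => by simpa using k3 t x y hx hy)
      (fun t x y hx hy => by simpa using k4 t x y hx hy)
    simpa using this
  have t1 : c1Norm 1 (Pr α l r) u ≤ ENNReal.ofReal (4 * X) := by
    refine hone 1 u (hval _ h1) (fun z hz => ?_) (fun t x y hx hy => ?_) fun t x y hx hy => ?_
    · rw [td, hut z hz]; exact hval _ h2 z hz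
    · rw [Real.rpow_one]
      exact (h1.abs_sub_le hr hu hy hx).trans (by gcongr)
    · rw [Real.rpow_one, td, td, hut _ hx, hut _ hy]
      exact (h2.abs_sub_le hr hu' hy hx).trans (by gcongr)
  have t2 : ∀ i, i ≠ l → c1Norm 1 (Pr α l r) (pd i u) ≤ ENNReal.ofReal (4 * X) := by
    intro i hi
    refine hone 1 _ (fun z hz => ?_) (fun z hz => ?_) (fun t x y hx hy => ?_) fun t x y hx hy => ?_
    · rw [hpd i z hz]; exact (h1.grad z hz i).trans hBX
    · rw [td_pd_eq hr hu i hz]; exact (h2.grad z hz i).trans hBX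
    · rw [Real.rpow_one, hpd _ _ hx, hpd _ _ hy]
      exact (h1.abs_sub_tangential_le hr hu hy hx hi).trans (by gcongr)
    · rw [Real.rpow_one, td_pd_eq hr hu i hx, td_pd_eq hr hu i hy]
      exact (h2.abs_sub_tangential_le hr hu' hy hx hi).trans (by gcongr)
  have hnear : ∀ t x y, (t, x) ∈ Pr α l r → (t, y) ∈ Pr α l r → ‖x - y‖ ≤ 1 := by
    intro t x y hx hy
    have a1 := hx.2.2.1
    have a2 := hy.2.2.1
    have a3 := norm_sub_le x y
    simp only at a1 a2
    linarith
  have hnX : (d + 2 + (2 - α)⁻¹) * B ≤ X :=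
    hXle _ (by linarith [(Nat.cast_nonneg d : (0 : ℝ) ≤ d)])
  have t3 : c1Norm (min (2 - α) 1) (Pr α l r) (pd l u) ≤ ENNReal.ofReal (4 * X) := by
    refine hone _ _ (fun z hz => ?_) (fun z hz => ?_) (fun t x y hx hy => ?_) fun t x y hx hy => ?_
    · rw [hpd l z hz]; exact (h1.grad z hz l).trans hBX
    · rw [td_pd_eq hr hu l hz]; exact (h2.grad z hz l).trans hBX
    · rw [hpd _ _ hx, hpd _ _ hy]
      exact (h1.abs_sub_normal_le hα2 hr hu hy hx (hnear t x y hx hy)).trans (by gcongr)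
    · rw [td_pd_eq hr hu l hx, td_pd_eq hr hu l hy]
      exact (h2.abs_sub_normal_le hα2 hr hu' hy hx (hnear t x y hx hy)).trans (by gcongr)
  have htw : ∀ z ∈ Pr α l r, td (fun z => z.2 l ^ (-(α / 2)) * u z) z =
      z.2 l ^ (-(α / 2)) * dv (1, 0) u z := by
    intro z hz
    rw [← hut z hz]
    exact deriv_const_mul_field (𝕜 := ℝ) (z.2 l ^ (-(α / 2))) (v := fun s => u (s, z.2))
  have hwX : (2 * d + 6) * B ≤ X := hXle _ (by linarith)
  have h2X : 2 * B ≤ X := hXle _ (by linarith [(Nat.cast_nonneg d : (0 : ℝ) ≤ d)])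
  have t4 : ENNReal.ofReal √lam * c1Norm (1 - α / 2) (Pr α l r)
      (fun z => z.2 l ^ (-(α / 2)) * u z) ≤ ENNReal.ofReal (4 * X) := by
    refine ofReal_mul_c1Norm_le (Real.sqrt_nonneg _) hX0 (fun z hz => ?_) (fun z hz => ?_)
      (fun t x y hx hy => ?_) fun t x y hx hy => ?_
    · exact (sqrt_mul_weighted_le hα2 hlam hr h1 h3 hz).trans h2X
    · rw [htw z hz]
      exact (sqrt_mul_weighted_le hα2 hlam hr h2 h4 hz).trans h2X
    · exact (sqrt_mul_weighted_sub_le hα hα2 hlam hr hu h1 h3 hx hy).trans (by gcongr)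
    · rw [htw _ hx, htw _ hy]
      exact (sqrt_mul_weighted_sub_le hα hα2 hlam hr hu' h2 h4 hx hy).trans (by gcongr)
  have t2' : (∑ i, if i ≠ l then c1Norm 1 (Pr α l r) (pd i u) else 0) ≤
      ENNReal.ofReal (d * (4 * X)) := by
    refine (Finset.sum_le_sum (g := fun _ => ENNReal.ofReal (4 * X)) fun i _ => ?_).trans ?_
    · split_ifs with hi
      exacts [t2 i hi, zero_le]
    · rw [Finset.sum_const, Finset.card_univ, Fintype.card_fin, nsmul_eq_mul,
        ENNReal.ofReal_mul (Nat.cast_nonneg d), ENNReal.ofReal_natCast]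
  rw [show 4 * (d + 3) * X = 4 * X + d * (4 * X) + 4 * X + 4 * X by ring,
    ENNReal.ofReal_add (by positivity) (by positivity),
    ENNReal.ofReal_add (by positivity) (by positivity),
    ENNReal.ofReal_add (by positivity) (by positivity)]
  exact add_le_add (add_le_add (add_le_add t1 t2') t3) t4

lemma exists_norms_le (hκ : 0 < κ) (hα : 0 < α) (hα2 : α < 2) {p : ℝ} (hp : 1 < p) :
    ∃ N : ℝ, 0 < N ∧ ∀ (lam : ℝ) (c : ℝ → ℝ) (b : ℝ → Fin d → Ed d) (u : ℝ × Ed d → ℝ),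
      0 ≤ lam → Coef κ α c b → Sol κ α lam l c b u →
      c1Norm 1 (Pr α l 0) u + (∑ i, if i ≠ l then c1Norm 1 (Pr α l 0) (pd i u) else 0) +
          c1Norm (min (2 - α) 1) (Pr α l 0) (pd l u) +
          ENNReal.ofReal √lam * c1Norm (1 - α / 2) (Pr α l 0) (fun z => z.2 l ^ (-(α / 2)) * u z) ≤
        ENNReal.ofReal N * (∫⁻ z in Qop l, ENNReal.ofReal (‖Du u z‖ ^ p)) ^ (1 / p) := by
  obtain ⟨C₀, hC₀, hS⟩ := exists_coord_bound_of_lintegral (d := d) (l := l) hκ hα hα2 hp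
  have hPt : Pres κ α l (fun _ u => dv ((1 : ℝ), (0 : Ed d)) u) := Pres.dv (by simp)
  have ht := bd_time (d := d) (l := l) hκ hα hα2
  have hl := bd_lam_mul (d := d) (l := l) hκ hα.le
  obtain ⟨C₁, hC₁, K₁, hR₁⟩ := exists_regOn (d := d) (l := l) hκ hα hα2
  obtain ⟨C₂, hC₂, K₂, hR₂⟩ := exists_regOn_comp hκ hα hα2 ht hPt
  obtain ⟨C₃, hC₃, K₃, hR₃⟩ := exists_regOn_comp hκ hα hα2 hl Pres.lam_mul
  obtain ⟨C₄, hC₄, K₄, hR₄⟩ := exists_regOn_comp hκ hα hα2 (hl.comp ht hPt)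
    (hPt.comp Pres.lam_mul)
  have hr0 := rtop_pos hα2
  set Y : ℝ := max 1 (2 / rtop α) with hY
  have hY1 : 1 ≤ Y := le_max_left _ _
  have hYr : 1 ≤ Y * (rtop α / 2 - 0) := by
    have h1 : 2 / rtop α ≤ Y := le_max_right _ _
    rw [div_le_iff₀ hr0] at h1
    linarith
  set A : ℝ := C₁ * Y ^ K₁ + C₂ * Y ^ K₂ + C₃ * Y ^ K₃ + C₄ * Y ^ K₄ with hA
  have p1 : 0 < C₁ * Y ^ K₁ := by positivity
  have p2 : 0 < C₂ * Y ^ K₂ := by positivity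
  have p3 : 0 < C₃ * Y ^ K₃ := by positivity
  have p4 : 0 < C₄ * Y ^ K₄ := by positivity
  have hα' : 0 < (2 - α)⁻¹ := inv_pos.2 (by linarith)
  refine ⟨4 * (d + 3) * ((2 * d + 6 + (2 - α)⁻¹) * (A * C₀)), by positivity, ?_⟩
  intro lam c b u hlam hc hu
  have hp0 : 0 < p := by linarith
  set I := ∫⁻ z in Qop l, ENNReal.ofReal (‖Du u z‖ ^ p) with hI
  rcases eq_or_ne I ⊤ with htop | hfin
  · rw [htop, ENNReal.top_rpow_of_pos (by positivity), ENNReal.mul_top]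
    · exact le_top
    · exact (ENNReal.ofReal_pos.2 (by positivity)).ne'
  set J := I.toReal ^ (1 / p) with hJ
  have hJ0 : 0 ≤ J := Real.rpow_nonneg ENNReal.toReal_nonneg _
  have hJI : ENNReal.ofReal (J ^ p) = I := by
    rw [hJ, ← Real.rpow_mul ENNReal.toReal_nonneg, one_div_mul_cancel hp0.ne', Real.rpow_one,
      ENNReal.ofReal_toReal hfin]
  have hJI' : I ^ (1 / p) = ENNReal.ofReal J := by
    rw [hJ, ← ENNReal.ofReal_rpow_of_nonneg ENNReal.toReal_nonneg (by positivity),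
      ENNReal.ofReal_toReal hfin]
  have hb := hS lam c b u J hlam hc hu hJ0 hJI.ge
  have hS0 : 0 ≤ C₀ * J := by positivity
  have hsub : ∀ {C : ℝ} {K : ℕ} {f : ℝ × Ed d → ℝ}, C * Y ^ K ≤ A →
      RegOn α l (Pr α l 0) (C * Y ^ K * (C₀ * J)) f → RegOn α l (Pr α l 0) (A * (C₀ * J)) f :=
    fun h hf => hf.mono Subset.rfl (fun z hz => hz.2.2.2.le)
      (mul_le_mul_of_nonneg_right h hS0)
  have hrt : rtop α / 2 ≤ rtop α := by linarith
  refine (norms_le_of_regOn (B := A * (C₀ * J)) hα hα2 hlam hr0.le le_rfl hu.smooth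
    (by positivity)
    (hsub (by linarith) (hR₁ lam c b u 0 _ Y _ hlam hc hu le_rfl hrt hY1 hYr hb))
    (hsub (by linarith) (hR₂ lam c b u 0 _ Y _ hlam hc hu le_rfl hrt hY1 hYr hb))
    (hsub (by linarith) (hR₃ lam c b u 0 _ Y _ hlam hc hu le_rfl hrt hY1 hYr hb))
    (hsub (by linarith) (hR₄ lam c b u 0 _ Y _ hlam hc hu le_rfl hrt hY1 hYr hb))).trans
    (le_of_eq ?_)
  rw [hJI', ← ENNReal.ofReal_mul (by positivity)]
  congr 1
  ring

end NormAssembly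

section NormalForm

variable {d : ℕ} {ν α lam : ℝ} {l : Fin d} {u : ℝ × Ed d → ℝ}

lemma Qcl_subset_closure (l : Fin d) : Qcl l ⊆ closure (Qop l) := by
  intro z hz
  set w : ℝ × Ed d := (-1 / 2, (1 / 2 : ℝ) • ei l) with hw
  have hc : Tendsto (fun s : ℝ => z + s • (w - z)) (𝓝[>] 0) (𝓝 z) := by
    have : ContinuousAt (fun s : ℝ => z + s • (w - z)) 0 := by fun_prop
    simpa using this.tendsto.mono_left nhdsWithin_le_nhds
  refine mem_closure_of_tendsto hc ?_
  filter_upwards [Ioo_mem_nhdsGT (zero_lt_one' ℝ)] with s hs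
  obtain ⟨hs0, hs1⟩ := hs
  obtain ⟨h1, h2, h3, h4⟩ := hz
  have e : z + s • (w - z) = ((1 - s) * z.1 + s * (-1 / 2), (1 - s) • z.2 + (s / 2) • ei l) := by
    ext1
    · simp [hw]; ring
    · simp only [hw, Prod.snd_add, Prod.smul_snd, Prod.snd_sub]
      module
  rw [e]
  refine ⟨?_, ?_, ?_, ?_⟩
  · simp only; nlinarith
  · simp only; nlinarith
  · simp only
    refine (norm_add_le _ _).trans_lt ?_
    rw [norm_smul, norm_smul, Real.norm_of_nonneg (by linarith), Real.norm_of_nonneg (by linarith)]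
    simp only [ei, PiLp.norm_single, norm_one]
    nlinarith
  · have : 0 ≤ (1 - s) * z.2 l := mul_nonneg (by linarith) h4
    simp
    linarith

/-- The operator with frozen coefficients: `a₀`, `c₀` scalar, `m` the degenerate factor and `A` the
leading matrix. -/
def frozenOp (lam a₀ c₀ m : ℝ) (A : Fin d → Fin d → ℝ) (u : ℝ × Ed d → ℝ) (z : ℝ × Ed d) : ℝ :=
  a₀ * dv (1, 0) u z + lam * c₀ * u z - m * ∑ i, ∑ j, A i j * dv (0, ei i) (dv (0, ei j) u) z

lemma tendsto_frozenOp {ι : Type*} {F : Filter ι} {a₀ c₀ m : ι → ℝ} {A : ι → Fin d → Fin d → ℝ}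
    {w : ι → ℝ × Ed d} {a₀' c₀' m' : ℝ} {A' : Fin d → Fin d → ℝ} {z : ℝ × Ed d}
    (ha : Tendsto a₀ F (𝓝 a₀')) (hc : Tendsto c₀ F (𝓝 c₀')) (hm : Tendsto m F (𝓝 m'))
    (hA : Tendsto A F (𝓝 A')) (hw : Tendsto w F (𝓝 z)) (hu : ContDiffAt ℝ ∞ u z) :
    Tendsto (fun n => frozenOp lam (a₀ n) (c₀ n) (m n) (A n) u (w n)) F
      (𝓝 (frozenOp lam a₀' c₀' m' A' u z)) := by
  have h1 := ((hu.dir ((1 : ℝ), (0 : Ed d))).continuousAt.tendsto.comp hw)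
  have h2 := hu.continuousAt.tendsto.comp hw
  have h3 : ∀ i j, Tendsto (fun n => A n i j * dv (0, ei i) (dv (0, ei j) u) (w n)) F
      (𝓝 (A' i j * dv (0, ei i) (dv (0, ei j) u) z)) := fun i j =>
    (tendsto_pi_nhds.1 (tendsto_pi_nhds.1 hA i) j).mul
      (((hu.dir _).dir _).continuousAt.tendsto.comp hw)
  exact ((ha.mul h1).add ((hc.const_mul lam).mul h2)).sub
    (hm.mul (tendsto_finsetSum _ fun i _ => tendsto_finsetSum _ fun j _ => h3 i j))

/-- An identity holding almost everywhere holds on full slices `{x_l = s}` for a dense set of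
levels `s`. -/
lemma exists_good_level (hu : ∀ z ∈ Qop l, ContDiffAt ℝ ∞ u z) {a₀ c₀ m : ℝ → ℝ}
    {A : ℝ → Fin d → Fin d → ℝ}
    (hae : ∀ᵐ z ∂(volume.restrict (Qop l)),
      frozenOp lam (a₀ (z.2 l)) (c₀ (z.2 l)) (m (z.2 l)) (A (z.2 l)) u z = 0)
    {z₀ : ℝ × Ed d} (hz₀ : z₀ ∈ Qop l) {ε : ℝ} (hε : 0 < ε) :
    ∃ s, 0 < s ∧ |s - z₀.2 l| < ε ∧ ∀ z ∈ Qop l, z.2 l = s →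
      frozenOp lam (a₀ s) (c₀ s) (m s) (A s) u z = 0 := by
  set π : ℝ × Ed d → ℝ × Ed d := fun w => (w.1, w.2 - w.2 l • ei l) with hπ
  have hπc : Continuous π := by fun_prop
  rw [ae_restrict_iff' (isOpen_Qop l).measurableSet] at hae
  have h1 : ∀ᵐ z : ℝ × Ed d, ∀ n : ℕ, z + π (TopologicalSpace.denseSeq _ n) ∈ Qop l →
      frozenOp lam (a₀ ((z + π (TopologicalSpace.denseSeq _ n)).2 l))
        (c₀ ((z + π (TopologicalSpace.denseSeq _ n)).2 l))
        (m ((z + π (TopologicalSpace.denseSeq _ n)).2 l))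
        (A ((z + π (TopologicalSpace.denseSeq _ n)).2 l)) u
        (z + π (TopologicalSpace.denseSeq _ n)) = 0 := by
    rw [ae_all_iff]
    intro n
    have : (volume : Measure (ℝ × Ed d)).IsAddHaarMeasure :=
      inferInstanceAs ((volume : Measure ℝ).prod (volume : Measure (Ed d))).IsAddHaarMeasure
    exact (measurePreserving_add_right volume
      (π (TopologicalSpace.denseSeq _ n))).quasiMeasurePreserving.ae hae
  have hd : Dense {z : ℝ × Ed d | ∀ n : ℕ, z + π (TopologicalSpace.denseSeq _ n) ∈ Qop l →
      frozenOp lam (a₀ ((z + π (TopologicalSpace.denseSeq _ n)).2 l))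
        (c₀ ((z + π (TopologicalSpace.denseSeq _ n)).2 l))
        (m ((z + π (TopologicalSpace.denseSeq _ n)).2 l))
        (A ((z + π (TopologicalSpace.denseSeq _ n)).2 l)) u
        (z + π (TopologicalSpace.denseSeq _ n)) = 0} := Measure.dense_of_ae h1
  have hO : IsOpen (Qop l ∩ {z : ℝ × Ed d | |z.2 l - z₀.2 l| < ε}) := by
    have : Continuous fun z : ℝ × Ed d => |z.2 l - z₀.2 l| := by fun_prop
    exact (isOpen_Qop l).inter (isOpen_lt this continuous_const)
  obtain ⟨z₁, ⟨hz₁, hz₁ε⟩, hz₁P⟩ := hd.inter_open_nonempty _ hO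
    ⟨z₀, hz₀, by simpa using hε⟩
  refine ⟨z₁.2 l, hz₁.2.2.2, hz₁ε, fun z hz hzl => ?_⟩
  have hπl : ∀ w, (π w).2 l = 0 := by
    intro w
    simp [hπ]
  have hπz : z₁ + π (z - z₁) = z := by
    have : (z - z₁).2 l = 0 := by simp [hzl]
    simp only [hπ, this, zero_smul, sub_zero]
    exact add_sub_cancel _ _
  by_contra hne
  have hcont : ContinuousAt (fun w => z₁ + π w) (z - z₁) := by fun_prop
  have hten : Tendsto (fun w => z₁ + π w) (𝓝 (z - z₁)) (𝓝 z) := by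
    have := hcont.tendsto
    rwa [hπz] at this
  have hT := tendsto_frozenOp (lam := lam) (a₀ := fun _ => a₀ (z₁.2 l)) (c₀ := fun _ => c₀ (z₁.2 l))
    (m := fun _ => m (z₁.2 l)) (A := fun _ => A (z₁.2 l)) tendsto_const_nhds tendsto_const_nhds
    tendsto_const_nhds tendsto_const_nhds hten (hu z hz)
  have hev := (hT.eventually_ne hne).and (hten.eventually ((isOpen_Qop l).mem_nhds hz))
  obtain ⟨_, ⟨n, rfl⟩, hw1, hw2⟩ :=
    (TopologicalSpace.denseRange_denseSeq (ℝ × Ed d)).inter_nhds_nonempty hev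
  have := hz₁P n hw2
  rw [Prod.snd_add, PiLp.add_apply, hπl, add_zero] at this
  exact hw1 this

end NormalForm

section LevelCoefficients

variable {d : ℕ} {ν α lam : ℝ} {l : Fin d} {u : ℝ × Ed d → ℝ}

/-- Admissible coefficients at a fixed level; `m` is the quotient `μ / x_l ^ α`. -/
structure LevelCoef (ν a₀ c₀ m : ℝ) (A : Fin d → Fin d → ℝ) : Prop where
  a_mem : a₀ ∈ Icc ν ν⁻¹
  c_mem : c₀ ∈ Icc ν ν⁻¹
  m_mem : m ∈ Icc ν ν⁻¹
  bound : ∀ i j, |A i j| ≤ ν⁻¹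
  elliptic : ∀ ξ : Fin d → ℝ, ν * ∑ i, ξ i ^ 2 ≤ ∑ i, ∑ j, A i j * ξ i * ξ j

lemma exists_levelCoef (hu : ∀ z ∈ Qop l, ContDiffAt ℝ ∞ u z) {a₀ c₀ m : ℝ → ℝ}
    {A : ℝ → Fin d → Fin d → ℝ}
    (hco : ∀ s, 0 < s → LevelCoef ν (a₀ s) (c₀ s) (m s / s ^ α) (A s))
    (hae : ∀ᵐ z ∂(volume.restrict (Qop l)),
      frozenOp lam (a₀ (z.2 l)) (c₀ (z.2 l)) (m (z.2 l)) (A (z.2 l)) u z = 0)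
    {s₀ : ℝ} (hs₀ : 0 < s₀) (hs₁ : s₀ < 1) :
    ∃ (a c μ : ℝ) (A' : Fin d → Fin d → ℝ), LevelCoef ν a c μ A' ∧
      ∀ z ∈ Qop l, z.2 l = s₀ → frozenOp lam a c (μ * s₀ ^ α) A' u z = 0 := by
  have hz₀ : ((-1 / 2 : ℝ), s₀ • (ei l : Ed d)) ∈ Qop l := by
    refine ⟨by norm_num, by norm_num, ?_, ?_⟩
    · simp only [norm_smul, Real.norm_of_nonneg hs₀.le]
      simpa [ei] using hs₁
    · simpa using hs₀
  have hlev := fun n : ℕ => exists_good_level hu hae hz₀ (ε := 1 / ((n : ℝ) + 1)) (by positivity)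
  choose s hs0 hsε hs using hlev
  have hsl : Tendsto s atTop (𝓝 s₀) := by
    rw [tendsto_iff_dist_tendsto_zero]
    refine squeeze_zero (fun _ => dist_nonneg) (fun n => ?_) tendsto_one_div_add_atTop_nhds_zero_nat
    simpa [Real.dist_eq] using (hsε n).le
  set v : ℕ → ℝ × ℝ × ℝ × (Fin d → Fin d → ℝ) := fun n =>
    (a₀ (s n), c₀ (s n), m (s n) / s n ^ α, A (s n)) with hv
  have hvK : ∀ n, v n ∈ Icc ((ν, ν, ν, fun _ _ => -ν⁻¹) : ℝ × ℝ × ℝ × (Fin d → Fin d → ℝ))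
      (ν⁻¹, ν⁻¹, ν⁻¹, fun _ _ => ν⁻¹) := by
    intro n
    have h := hco (s n) (hs0 n)
    exact ⟨⟨h.a_mem.1, h.c_mem.1, h.m_mem.1, fun i j => (abs_le.1 (h.bound i j)).1⟩,
      ⟨h.a_mem.2, h.c_mem.2, h.m_mem.2, fun i j => (abs_le.1 (h.bound i j)).2⟩⟩
  obtain ⟨⟨a, c, μ, A'⟩, hmem, φ, hφ, hlim⟩ := isCompact_Icc.tendsto_subseq hvK
  have ha : Tendsto (fun n => a₀ (s (φ n))) atTop (𝓝 a) :=
    (continuous_fst.tendsto _).comp hlim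
  have hc : Tendsto (fun n => c₀ (s (φ n))) atTop (𝓝 c) :=
    ((continuous_fst.comp continuous_snd).tendsto _).comp hlim
  have hμ : Tendsto (fun n => m (s (φ n)) / s (φ n) ^ α) atTop (𝓝 μ) :=
    ((continuous_fst.comp (continuous_snd.comp continuous_snd)).tendsto _).comp hlim
  have hA : Tendsto (fun n => A (s (φ n))) atTop (𝓝 A') :=
    ((continuous_snd.comp (continuous_snd.comp continuous_snd)).tendsto _).comp hlim
  have hsφ : Tendsto (fun n => s (φ n)) atTop (𝓝 s₀) := hsl.comp hφ.tendsto_atTop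
  have hm : Tendsto (fun n => m (s (φ n))) atTop (𝓝 (μ * s₀ ^ α)) := by
    refine (hμ.mul (hsφ.rpow_const (p := α) (Or.inl hs₀.ne'))).congr fun n => ?_
    exact div_mul_cancel₀ _ (Real.rpow_pos_of_pos (hs0 _) _).ne'
  refine ⟨a, c, μ, A', ⟨⟨hmem.1.1, hmem.2.1⟩, ⟨hmem.1.2.1, hmem.2.2.1⟩,
    ⟨hmem.1.2.2.1, hmem.2.2.2.1⟩, fun i j => abs_le.2 ⟨hmem.1.2.2.2 i j, hmem.2.2.2.2 i j⟩,
    fun ξ => ?_⟩, fun z hz hzl => ?_⟩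
  · refine ge_of_tendsto' (f := fun n => ∑ i, ∑ j, A (s (φ n)) i j * ξ i * ξ j) (x := atTop)
      ?_ fun n => (hco _ (hs0 (φ n))).elliptic ξ
    exact tendsto_finsetSum _ fun i _ => tendsto_finsetSum _ fun j _ =>
      ((tendsto_pi_nhds.1 (tendsto_pi_nhds.1 hA i) j).mul_const _).mul_const _
  · have hw : Tendsto (fun n => (z.1, z.2 + (s (φ n) - s₀) • (ei l : Ed d))) atTop (𝓝 z) := by
      have h1 : Continuous fun q : ℝ => (z.1, z.2 + (q - s₀) • (ei l : Ed d)) := by fun_prop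
      have h2 := (h1.tendsto s₀).comp hsφ
      simpa [Function.comp_def] using h2
    have hT := tendsto_frozenOp (lam := lam) ha hc hm hA hw (hu z hz)
    refine tendsto_nhds_unique_of_eventuallyEq hT tendsto_const_nhds ?_
    filter_upwards [hw.eventually ((isOpen_Qop l).mem_nhds hz)] with n hn
    exact hs (φ n) _ hn (by simp [hzl])

open scoped MatrixOrder in
lemma LevelCoef.exists_normal_form {a₀ c₀ m : ℝ} {A : Fin d → Fin d → ℝ} (hν : 0 < ν)
    (hν1 : ν < 1) (h : LevelCoef ν a₀ c₀ m A) {s : ℝ} (hs : 0 < s) :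
    ∃ (c : ℝ) (b : Fin d → Ed d), ν ^ 3 / (d + 1) ≤ c ∧ c ≤ (ν ^ 3 / (d + 1))⁻¹ ∧
      ∑ k, ‖b k‖ ^ 2 ≤ (ν ^ 3 / (d + 1))⁻¹ * s ^ α ∧
      ∀ (lam : ℝ) (u : ℝ × Ed d → ℝ) (z : ℝ × Ed d), ContDiffAt ℝ ∞ u z →
        frozenOp lam a₀ c₀ (m * s ^ α) A u z = 0 →
        dv (1, 0) u z + lam * c * u z =
          ∑ k, d2 (b k) u z + ν ^ 3 / (d + 1) * s ^ α * ∑ i, d2 (ei i) u z := by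
  set κ := ν ^ 3 / (d + 1) with hκ
  have hd0 : (0 : ℝ) ≤ d := Nat.cast_nonneg d
  have ha0 : 0 < a₀ := hν.trans_le h.a_mem.1
  have hm0 : 0 < m := hν.trans_le h.m_mem.1
  have hsα : 0 < s ^ α := Real.rpow_pos_of_pos hs _
  have hκν : κ ≤ ν ^ 3 := div_le_self (by positivity) (by linarith)
  have hν32 : ν ^ 3 ≤ ν ^ 2 := pow_le_pow_of_le_one hν.le hν1.le (by norm_num)
  have hquot : ∀ q ∈ Icc ν ν⁻¹, ν ^ 2 ≤ q / a₀ ∧ q / a₀ ≤ (ν ^ 2)⁻¹ := by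
    intro q hq
    have e1 : a₀ * ν ≤ 1 := by
      have := mul_le_mul_of_nonneg_right h.a_mem.2 hν.le
      rwa [inv_mul_cancel₀ hν.ne'] at this
    have e2 : q * ν ≤ 1 := by
      have := mul_le_mul_of_nonneg_right hq.2 hν.le
      rwa [inv_mul_cancel₀ hν.ne'] at this
    constructor
    · rw [le_div_iff₀ ha0]
      nlinarith [hq.1]
    · rw [div_le_iff₀ ha0, ← div_eq_inv_mul, le_div_iff₀ (by positivity)]
      nlinarith [h.a_mem.1, mul_le_mul_of_nonneg_right e2 hν.le]
  obtain ⟨hθ1, hθ2⟩ := hquot m h.m_mem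
  set θ := m / a₀ with hθ
  have hθ0 : 0 < θ := by positivity
  set M : Matrix (Fin d) (Fin d) ℝ :=
    Matrix.of fun i j => θ * ((A i j + A j i) / 2) - if i = j then κ else 0 with hM
  have hsum : ∀ ξ : Fin d → ℝ, ∑ i, ∑ j, (A i j + A j i) / 2 * ξ i * ξ j =
      ∑ i, ∑ j, A i j * ξ i * ξ j := by
    intro ξ
    have e1 : ∑ i, ∑ j, A j i * ξ i * ξ j = ∑ i, ∑ j, A i j * ξ i * ξ j := by
      rw [Finset.sum_comm]
      exact Finset.sum_congr rfl fun i _ => Finset.sum_congr rfl fun j _ => by ring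
    have e2 : ∀ i j, (A i j + A j i) / 2 * ξ i * ξ j =
        1 / 2 * (A i j * ξ i * ξ j) + 1 / 2 * (A j i * ξ i * ξ j) := fun i j => by ring
    simp only [e2, Finset.sum_add_distrib, ← Finset.mul_sum, e1]
    ring
  have hPSD : M.PosSemidef := by
    refine Matrix.PosSemidef.of_dotProduct_mulVec_nonneg ?_ fun ξ => ?_
    · ext i j
      simp [hM, add_comm, eq_comm]
    · have e : star ξ ⬝ᵥ M.mulVec ξ =
          θ * ∑ i, ∑ j, A i j * ξ i * ξ j - κ * ∑ i, ξ i ^ 2 := by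
        rw [← hsum]
        simp only [dotProduct, Matrix.mulVec, hM, Matrix.of_apply, sub_mul, ite_mul, zero_mul,
          Finset.sum_sub_distrib, Finset.sum_ite_eq, Finset.mem_univ, if_true, mul_sub,
          Finset.mul_sum, star_trivial]
        congr 1
        · exact Finset.sum_congr rfl fun i _ => Finset.sum_congr rfl fun j _ => by ring
        · exact Finset.sum_congr rfl fun i _ => by ring
      rw [e]
      have h1 := h.elliptic ξ
      have h2 : 0 ≤ ∑ i, ξ i ^ 2 := Finset.sum_nonneg fun _ _ => sq_nonneg _
      have h3 : κ ≤ θ * ν := by nlinarith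
      nlinarith [mul_le_mul_of_nonneg_left h1 hθ0.le, mul_le_mul_of_nonneg_right h3 h2]
  obtain ⟨R, hR⟩ := CStarAlgebra.nonneg_iff_eq_star_mul_self.1 hPSD.nonneg
  have hRM : ∀ i j, ∑ k, R k i * R k j = M i j := by
    intro i j
    rw [hR]
    simp [Matrix.mul_apply, Matrix.star_apply]
  refine ⟨c₀ / a₀, fun k => WithLp.toLp 2 fun i => √(s ^ α) * R k i, ?_, ?_, ?_, ?_⟩
  · exact (hκν.trans hν32).trans (hquot c₀ h.c_mem).1
  · refine (hquot c₀ h.c_mem).2.trans (inv_anti₀ (by positivity) (hκν.trans hν32))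
  · have e : ∑ k, ‖(WithLp.toLp 2 fun i => √(s ^ α) * R k i : Ed d)‖ ^ 2 = s ^ α * ∑ i, M i i := by
      simp only [EuclideanSpace.norm_sq_eq, Real.norm_eq_abs, sq_abs, mul_pow,
        Real.sq_sqrt hsα.le, ← Finset.mul_sum, ← hRM]
      rw [Finset.sum_comm]
      simp only [sq]
    rw [e, mul_comm]
    have h1 : ∀ i, M i i ≤ (ν ^ 3)⁻¹ := by
      intro i
      have h2 : M i i = θ * A i i - κ := by simp [hM]
      have h3 : θ * A i i ≤ (ν ^ 2)⁻¹ * ν⁻¹ :=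
        (mul_le_mul_of_nonneg_left (abs_le.1 (h.bound i i)).2 hθ0.le).trans
          (mul_le_mul_of_nonneg_right hθ2 (inv_nonneg.2 hν.le))
      have h4 : (ν ^ 2)⁻¹ * ν⁻¹ = (ν ^ 3)⁻¹ := by rw [← mul_inv, ← pow_succ]
      have h5 : 0 ≤ κ := by positivity
      linarith
    have h2 : ∑ i, M i i ≤ κ⁻¹ := by
      refine (Finset.sum_le_sum fun i _ => h1 i).trans ?_
      rw [Finset.sum_const, Finset.card_univ, Fintype.card_fin, nsmul_eq_mul, hκ, inv_div,
        div_eq_mul_inv]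
      have : 0 < (ν ^ 3)⁻¹ := by positivity
      nlinarith
    gcongr
  · intro lam u z hu h0
    set H : Fin d → Fin d → ℝ := fun i j => dv (0, ei i) (dv (0, ei j) u) z with hH
    have hHs : ∀ i j, H i j = H j i := fun i j => dv_comm hu _ _
    have e1 : ∀ k, d2 (WithLp.toLp 2 fun i => √(s ^ α) * R k i : Ed d) u z =
        s ^ α * ∑ i, ∑ j, R k i * R k j * H i j := by
      intro k
      rw [d2, dv_dv_eq_sum hu]
      simp only [Finset.mul_sum]
      refine Finset.sum_congr rfl fun i _ => Finset.sum_congr rfl fun j _ => ?_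
      have := Real.mul_self_sqrt hsα.le
      calc _ = (√(s ^ α) * √(s ^ α)) * (R k i * R k j * H i j) := by simp only [hH]; ring
        _ = _ := by rw [this]
    have e2 : ∑ k, d2 (WithLp.toLp 2 fun i => √(s ^ α) * R k i : Ed d) u z =
        s ^ α * ∑ i, ∑ j, M i j * H i j := by
      simp only [e1, ← Finset.mul_sum, ← hRM, Finset.sum_mul]
      rw [Finset.sum_comm]
      congr 1
      exact Finset.sum_congr rfl fun i _ => Finset.sum_comm
    have e3 : ∑ i, ∑ j, M i j * H i j = θ * ∑ i, ∑ j, A i j * H i j - κ * ∑ i, H i i := by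
      have e4 : ∑ i, ∑ j, A j i * H i j = ∑ i, ∑ j, A i j * H i j := by
        rw [Finset.sum_comm]
        exact Finset.sum_congr rfl fun i _ => Finset.sum_congr rfl fun j _ => by rw [hHs]
      have e5 : ∀ i j, M i j * H i j = θ / 2 * (A i j * H i j) + θ / 2 * (A j i * H i j) -
          if i = j then κ * H i j else 0 := by
        intro i j
        simp only [hM, Matrix.of_apply]
        split_ifs <;> ring
      simp only [e5, Finset.sum_sub_distrib, Finset.sum_add_distrib, ← Finset.mul_sum, e4,
        Finset.sum_ite_eq, Finset.mem_univ, if_true]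
      ring
    rw [e2, e3]
    have h0' : a₀ * dv (1, 0) u z + lam * c₀ * u z - m * s ^ α * ∑ i, ∑ j, A i j * H i j = 0 := h0
    have h6 : dv (1, 0) u z + lam * (c₀ / a₀) * u z = s ^ α * (θ * ∑ i, ∑ j, A i j * H i j) := by
      rw [hθ]
      field_simp
      linarith
    rw [h6]
    ring

end LevelCoefficients

section Main

variable {d : ℕ} {ν α lam : ℝ} {l : Fin d} {u : ℝ × Ed d → ℝ}

lemma CoeffOK.levelCoef {μc a0 c0 : ℝ → ℝ} {aij : Fin d → Fin d → ℝ → ℝ}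
    (h : CoeffOK d ν α μc a0 c0 aij) {s : ℝ} (hs : 0 < s) :
    LevelCoef ν (a0 s) (c0 s) (μc s / s ^ α) (fun i j => aij i j s) := by
  obtain ⟨-, -, -, -, hb, he, ha⟩ := h
  exact ⟨(hb s hs).1, (hb s hs).2.1, (hb s hs).2.2, ha s hs, he s hs⟩

lemma exists_sol (hν : 0 < ν) (hν1 : ν < 1) (hu : ∀ z ∈ Qcl l, ContDiffAt ℝ ∞ u z)
    (hzero : ∀ z ∈ Qcl l, z.2 l = 0 → u z = 0) {a₀ c₀ m : ℝ → ℝ} {A : ℝ → Fin d → Fin d → ℝ}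
    (hco : ∀ s, 0 < s → LevelCoef ν (a₀ s) (c₀ s) (m s / s ^ α) (A s))
    (hae : ∀ᵐ z ∂(volume.restrict (Qop l)),
      frozenOp lam (a₀ (z.2 l)) (c₀ (z.2 l)) (m (z.2 l)) (A (z.2 l)) u z = 0) :
    ∃ (c : ℝ → ℝ) (b : ℝ → Fin d → Ed d), Coef (ν ^ 3 / (d + 1)) α c b ∧
      Sol (ν ^ 3 / (d + 1)) α lam l c b u := by
  have key : ∀ s : ℝ, ∃ (c : ℝ) (b : Fin d → Ed d), 0 < s → s < 1 →
      ν ^ 3 / (d + 1) ≤ c ∧ c ≤ (ν ^ 3 / (d + 1))⁻¹ ∧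
      ∑ k, ‖b k‖ ^ 2 ≤ (ν ^ 3 / (d + 1))⁻¹ * s ^ α ∧
      ∀ z ∈ Qop l, z.2 l = s → dv (1, 0) u z + lam * c * u z =
          ∑ k, d2 (b k) u z + ν ^ 3 / (d + 1) * s ^ α * ∑ i, d2 (ei i) u z := by
    intro s
    by_cases hs : 0 < s ∧ s < 1
    · obtain ⟨a, c, μ, A', hA', h0⟩ :=
        exists_levelCoef (fun z hz => hu z (Qop_subset_Qcl l hz)) hco hae hs.1 hs.2
      obtain ⟨c', b, h1, h2, h3, h4⟩ := hA'.exists_normal_form (α := α) hν hν1 hs.1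
      exact ⟨c', b, fun _ _ => ⟨h1, h2, h3, fun z hz hzs =>
        h4 lam u z (hu z (Qop_subset_Qcl l hz)) (h0 z hz hzs)⟩⟩
    · exact ⟨0, 0, fun h h' => (hs ⟨h, h'⟩).elim⟩
  choose c b hcb using key
  refine ⟨c, b, ⟨fun s h h' => (hcb s h h').1, fun s h h' => (hcb s h h').2.1,
    fun s h h' => (hcb s h h').2.2.1⟩, hu, fun z h1 h2 h3 h4 =>
      hzero z ⟨h1.le, h2.le, h3.le, h4.ge⟩ h4, fun z hz => ?_⟩
  have hlt : z.2 l < 1 :=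
    ((le_abs_self _).trans (PiLp.norm_apply_le z.2 l)).trans_lt hz.2.2.1
  exact (hcb _ hz.2.2.2 hlt).2.2.2 z hz rfl

lemma xd_eq_apply (hd : 0 < d) (x : Ed d) : xd x = x ⟨d - 1, Nat.sub_lt hd one_pos⟩ :=
  dif_pos hd

lemma Qo_one_eq (hd : 0 < d) (α : ℝ) : Qo d α 1 = Qop ⟨d - 1, Nat.sub_lt hd one_pos⟩ := by
  simp [Qo, Qop, xd_eq_apply hd]

lemma Qo_half_eq (hd : 0 < d) (α : ℝ) :
    Qo d α (1 / 2) = Pr α ⟨d - 1, Nat.sub_lt hd one_pos⟩ 0 := by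
  simp only [Qo, Pr, xd_eq_apply hd, add_zero]

end Main

end

/-- Lemma 3.4: boundary Hölder estimates for solutions of the homogeneous
equation `𝓛₀ u = 0` in `Q₁⁺` vanishing on `{x_d = 0}`. -/
theorem stmt12 (d : ℕ) (hd : 1 ≤ d) (ν α p₀ : ℝ)
    (hν : ν ∈ Set.Ioo (0 : ℝ) 1) (hα : α ∈ Set.Ioo (0 : ℝ) 2) (hp₀ : 1 < p₀) :
    ∃ N : ℝ, 0 < N ∧
      ∀ lam : ℝ, 0 ≤ lam →
        ∀ (μc a0 c0 : ℝ → ℝ) (aij : Fin d → Fin d → ℝ → ℝ),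
          CoeffOK d ν α μc a0 c0 aij →
          ∀ u : ℝ × Ed d → ℝ,
            (∃ U : Set (ℝ × Ed d), IsOpen U ∧ closure (Qo d α 1) ⊆ U ∧
              ContDiffOn ℝ (⊤ : ℕ∞) u U) →
            (∀ z ∈ closure (Qo d α 1), xd z.2 = 0 → u z = 0) →
            (∀ᵐ z ∂(volume.restrict (Qo d α 1)),
              a0 (xd z.2) * ut u z + lam * c0 (xd z.2) * u z -
                μc (xd z.2) * ∑ i, ∑ j, aij i j (xd z.2) *
                  D2u u z (EuclideanSpace.single i 1) (EuclideanSpace.single j 1)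
                = 0) →
            c1Norm 1 (Qo d α (1 / 2)) u
              + (∑ i : Fin d, if (i : ℕ) < d - 1 then
                  c1Norm 1 (Qo d α (1 / 2)) (pd i u) else 0)
              + c1Norm (min (2 - α) 1) (Qo d α (1 / 2))
                  (pd (⟨d - 1, by omega⟩ : Fin d) u)
              + ENNReal.ofReal (Real.sqrt lam) *
                  c1Norm (1 - α / 2) (Qo d α (1 / 2))
                    (fun z => xd z.2 ^ (-(α / 2)) * u z)
            ≤ ENNReal.ofReal N *
                (∫⁻ z in Qo d α 1, ENNReal.ofReal (‖Du u z‖ ^ p₀)) ^ (1 / p₀) := by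
  have hν0 := hν.1
  obtain ⟨N, hN, H⟩ := exists_norms_le (l := (⟨d - 1, Nat.sub_lt hd one_pos⟩ : Fin d))
    (κ := ν ^ 3 / (d + 1)) (by positivity) hα.1 hα.2 hp₀
  refine ⟨N, hN, fun lam hlam μc a0 c0 aij hco u hsm hzero hae => ?_⟩
  simp only [Qo_one_eq hd, Qo_half_eq hd, xd_eq_apply hd] at hsm hzero hae ⊢
  obtain ⟨U, hU, hUQ, huU⟩ := hsm
  have hu : ∀ z ∈ Qcl ⟨d - 1, Nat.sub_lt hd one_pos⟩, ContDiffAt ℝ (⊤ : ℕ∞) u z := fun z hz =>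
    huU.contDiffAt (hU.mem_nhds (hUQ (Qcl_subset_closure _ hz)))
  obtain ⟨c, b, hcb, hsol⟩ := exists_sol (lam := lam) hν.1 hν.2 hu
    (fun z hz h => hzero z (Qcl_subset_closure _ hz) h)
    (A := fun s i j => aij i j s) (fun s hs => hco.levelCoef hs) (by
      filter_upwards [hae, ae_restrict_mem (isOpen_Qop _).measurableSet] with z hz hzQ
      have hz' := hu z (Qop_subset_Qcl _ hzQ)
      simpa only [frozenOp, ut_eq_dv hz'.differentiableAt_top, D2u_apply hz'] using hz)
  have hif : ∀ i : Fin d, (i : ℕ) < d - 1 ↔ i ≠ ⟨d - 1, Nat.sub_lt hd one_pos⟩ := by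
    intro i
    rw [Ne, Fin.ext_iff]
    have := i.2
    simp only
    omega
  simp only [hif]
  exact H lam c b u hlam hcb hsol
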